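/- Let f(t) = e^t and suppose that for each λ < 0, u_λ is a classical solution of (P_f^λ) on Ω, i.e. −Δu_λ = λ e^{u_λ} in Ω with u_λ = 0 on ∂Ω. Let v : Ω → ℝ be twice continuously differentiable with Δv(x) = e^{v(x)} for every x ∈ Ω and v(x) → +∞ as x → ∂Ω (i.e. for every M > 0 there is a compact set K ⊂ Ω with v ≥ M on Ω∖K). Then u_λ + log(−λ) → v uniformly on every compact subset of Ω as λ → −∞: for every compact K ⊂ Ω, sup_{x ∈ K} |u_λ(x) + log(−λ) − v(x)| → 0. -/

import Mathlib

open Set MeasureTheory Filter Topology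

/-- The Laplacian of `u` at `x`: the trace of the Hessian of `u`. -/
noncomputable def laplacian {N : ℕ} (u : EuclideanSpace ℝ (Fin N) → ℝ)
    (x : EuclideanSpace ℝ (Fin N)) : ℝ :=
  ∑ i : Fin N, iteratedFDeriv ℝ 2 u x ![EuclideanSpace.single i 1, EuclideanSpace.single i 1]

/-- A classical solution of the problem `(P_f^λ)` on `Ω`:
`u` is continuous on the closure of `Ω`, twice continuously differentiable on `Ω`,
satisfies `-Δ u = λ f(u)` in `Ω` and `u = 0` on `∂ Ω`. -/
def IsClassicalSolution {N : ℕ} (Ω : Set (EuclideanSpace ℝ (Fin N))) (lam : ℝ)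
    (f : ℝ → ℝ) (u : EuclideanSpace ℝ (Fin N) → ℝ) : Prop :=
  ContinuousOn u (closure Ω) ∧ ContDiffOn ℝ 2 u Ω ∧
    (∀ x ∈ Ω, -laplacian u x = lam * f (u x)) ∧
    (∀ x ∈ frontier Ω, u x = 0)

/-- Condition (1.2): `f` is continuous, non-decreasing, non-negative and `f 0 > 0`. -/
def Cond12 (f : ℝ → ℝ) : Prop :=
  Continuous f ∧ Monotone f ∧ (∀ t, 0 ≤ f t) ∧ 0 < f 0


abbrev Eu (N : ℕ) := EuclideanSpace ℝ (Fin N)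

noncomputable def ee {N : ℕ} (i : Fin N) : Eu N := EuclideanSpace.single i 1

noncomputable def pd {N : ℕ} (i : Fin N) (u : Eu N → ℝ) (x : Eu N) : ℝ := fderiv ℝ u x (ee i)

noncomputable def gradSq {N : ℕ} (u : Eu N → ℝ) (x : Eu N) : ℝ := ∑ i, (pd i u x) ^ 2

section lapcalc
variable {N : ℕ} {u v : Eu N → ℝ} {x : Eu N} {i : Fin N}

lemma gradSq_nonneg : 0 ≤ gradSq u x := Finset.sum_nonneg fun _ _ => sq_nonneg _

lemma pd_diff (hu : ContDiffAt ℝ 2 u x) : DifferentiableAt ℝ (pd i u) x := by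
  have h1 : DifferentiableAt ℝ (fderiv ℝ u) x :=
    (hu.fderiv_right (m := 1) (by norm_num)).differentiableAt (by norm_num)
  exact h1.clm_apply (differentiableAt_const _)

lemma cd_diff (hu : ContDiffAt ℝ 2 u x) : DifferentiableAt ℝ u x :=
  hu.differentiableAt (by norm_num)

lemma lap_eq (hu : ContDiffAt ℝ 2 u x) : laplacian u x = ∑ i, pd i (pd i u) x := by
  have h1 : DifferentiableAt ℝ (fderiv ℝ u) x :=
    (hu.fderiv_right (m := 1) (by norm_num)).differentiableAt (by norm_num)
  unfold laplacian
  refine Finset.sum_congr rfl fun i _ => ?_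
  rw [iteratedFDeriv_two_apply]
  have : pd i u = fun y => fderiv ℝ u y (ee i) := rfl
  unfold pd
  rw [fderiv_clm_apply h1 (differentiableAt_const _)]
  simp [ee]

lemma pd_congr (h : u =ᶠ[𝓝 x] v) : pd i u x = pd i v x := by
  unfold pd; rw [h.fderiv_eq]

lemma pd_congr_ev (h : u =ᶠ[𝓝 x] v) : pd i u =ᶠ[𝓝 x] pd i v := by
  filter_upwards [h.fderiv (𝕜 := ℝ)] with y hy
  unfold pd; rw [hy]

lemma lap_congr (h : u =ᶠ[𝓝 x] v) : laplacian u x = laplacian v x := by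
  unfold laplacian
  rw [(h.iteratedFDeriv ℝ 2).eq_of_nhds]

lemma pd_add (hu : DifferentiableAt ℝ u x) (hv : DifferentiableAt ℝ v x) :
    pd i (fun y => u y + v y) x = pd i u x + pd i v x := by
  unfold pd; rw [fderiv_fun_add hu hv]; simp

lemma pd_sub (hu : DifferentiableAt ℝ u x) (hv : DifferentiableAt ℝ v x) :
    pd i (fun y => u y - v y) x = pd i u x - pd i v x := by
  unfold pd; rw [fderiv_fun_sub hu hv]; simp

lemma pd_cmul (c : ℝ) (hu : DifferentiableAt ℝ u x) :
    pd i (fun y => c * u y) x = c * pd i u x := by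
  unfold pd; rw [fderiv_const_mul hu]; simp

lemma pd_mul (hu : DifferentiableAt ℝ u x) (hv : DifferentiableAt ℝ v x) :
    pd i (fun y => u y * v y) x = u x * pd i v x + v x * pd i u x := by
  unfold pd; rw [fderiv_fun_mul hu hv]; simp

lemma pd_const (c : ℝ) : pd i (fun _ : Eu N => c) x = 0 := by
  unfold pd; simp

lemma pd_comp {f : ℝ → ℝ} {f' : ℝ} (hf : HasDerivAt f f' (u x)) (hu : DifferentiableAt ℝ u x) :
    pd i (fun y => f (u y)) x = f' * pd i u x := by
  unfold pd
  have := (hf.comp_hasFDerivAt x hu.hasFDerivAt).fderiv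
  have h2 : (f ∘ u) = fun y => f (u y) := rfl
  rw [h2] at this
  rw [this]; simp

lemma ev_cd (hu : ContDiffAt ℝ 2 u x) : ∀ᶠ y in 𝓝 x, ContDiffAt ℝ 2 u y :=
  hu.eventually (by norm_num)

lemma lap_add (hu : ContDiffAt ℝ 2 u x) (hv : ContDiffAt ℝ 2 v x) :
    laplacian (fun y => u y + v y) x = laplacian u x + laplacian v x := by
  rw [lap_eq hu, lap_eq hv, lap_eq (hu.add hv), ← Finset.sum_add_distrib]
  refine Finset.sum_congr rfl fun i _ => ?_
  rw [← pd_add (pd_diff hu) (pd_diff hv)]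
  apply pd_congr
  filter_upwards [ev_cd hu, ev_cd hv] with y h1 h2
  exact pd_add (cd_diff h1) (cd_diff h2)

lemma lap_sub (hu : ContDiffAt ℝ 2 u x) (hv : ContDiffAt ℝ 2 v x) :
    laplacian (fun y => u y - v y) x = laplacian u x - laplacian v x := by
  rw [lap_eq hu, lap_eq hv, lap_eq (hu.sub hv), ← Finset.sum_sub_distrib]
  refine Finset.sum_congr rfl fun i _ => ?_
  rw [← pd_sub (pd_diff hu) (pd_diff hv)]
  apply pd_congr
  filter_upwards [ev_cd hu, ev_cd hv] with y h1 h2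
  exact pd_sub (cd_diff h1) (cd_diff h2)

lemma lap_cmul (c : ℝ) (hu : ContDiffAt ℝ 2 u x) :
    laplacian (fun y => c * u y) x = c * laplacian u x := by
  rw [lap_eq hu, lap_eq (contDiffAt_const.mul hu), Finset.mul_sum]
  refine Finset.sum_congr rfl fun i _ => ?_
  rw [← pd_cmul c (pd_diff hu)]
  apply pd_congr
  filter_upwards [ev_cd hu] with y h1
  exact pd_cmul c (cd_diff h1)

lemma lap_const (c : ℝ) : laplacian (fun _ : Eu N => c) x = 0 := by
  rw [lap_eq contDiffAt_const]
  refine Finset.sum_eq_zero fun i _ => ?_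
  have : pd i (fun _ : Eu N => c) = fun _ => 0 := by funext y; exact pd_const c
  rw [this]; exact pd_const 0

lemma lap_neg (hu : ContDiffAt ℝ 2 u x) : laplacian (fun y => - u y) x = - laplacian u x := by
  have := lap_cmul (-1) hu
  simpa using this

lemma lap_mul (hu : ContDiffAt ℝ 2 u x) (hv : ContDiffAt ℝ 2 v x) :
    laplacian (fun y => u y * v y) x =
      u x * laplacian v x + v x * laplacian u x + 2 * ∑ i, pd i u x * pd i v x := by
  rw [lap_eq hu, lap_eq hv, lap_eq (hu.mul hv), Finset.mul_sum, Finset.mul_sum, Finset.mul_sum,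
    ← Finset.sum_add_distrib, ← Finset.sum_add_distrib]
  refine Finset.sum_congr rfl fun i _ => ?_
  have : pd i (fun y => u y * v y) =ᶠ[𝓝 x] fun y => u y * pd i v y + v y * pd i u y := by
    filter_upwards [ev_cd hu, ev_cd hv] with y h1 h2
    exact pd_mul (cd_diff h1) (cd_diff h2)
  rw [pd_congr this, pd_add (u := fun y => u y * pd i v y) (v := fun y => v y * pd i u y)
    ((cd_diff hu).mul (pd_diff hv)) ((cd_diff hv).mul (pd_diff hu)),
    pd_mul (cd_diff hu) (pd_diff hv), pd_mul (cd_diff hv) (pd_diff hu)]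
  ring

lemma lap_comp {f f' f'' : ℝ → ℝ} (hf : ContDiff ℝ 2 f) (h1 : ∀ t, HasDerivAt f (f' t) t)
    (h2 : ∀ t, HasDerivAt f' (f'' t) t) (hu : ContDiffAt ℝ 2 u x) :
    laplacian (fun y => f (u y)) x = f'' (u x) * gradSq u x + f' (u x) * laplacian u x := by
  rw [lap_eq hu, lap_eq (u := fun y => f (u y)) (hf.contDiffAt.comp x hu), gradSq, Finset.mul_sum, Finset.mul_sum,
    ← Finset.sum_add_distrib]
  refine Finset.sum_congr rfl fun i _ => ?_
  have : pd i (fun y => f (u y)) =ᶠ[𝓝 x] fun y => f' (u y) * pd i u y := by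
    filter_upwards [ev_cd hu] with y h
    exact pd_comp (h1 _) (cd_diff h)
  rw [pd_congr this,
    pd_mul (u := fun y => f' (u y)) (((h2 _).differentiableAt).comp x (cd_diff hu)) (pd_diff hu),
    pd_comp (h2 _) (cd_diff hu)]
  ring

lemma pd_cont {Ω : Set (Eu N)} (hΩ : IsOpen Ω) (hu : ContDiffOn ℝ 2 u Ω) :
    ContinuousOn (pd i u) Ω := by
  intro y hy
  exact (pd_diff (hu.contDiffAt (hΩ.mem_nhds hy))).continuousAt.continuousWithinAt

lemma pd_contDiffAt (hu : ContDiffAt ℝ 2 u x) : ContDiffAt ℝ 1 (pd i u) x :=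
  (hu.fderiv_right (m := 1) (by norm_num)).clm_apply contDiffAt_const

lemma lap_cont {Ω : Set (Eu N)} (hΩ : IsOpen Ω) (hu : ContDiffOn ℝ 2 u Ω) :
    ContinuousOn (laplacian u) Ω := by
  intro y hy
  have h : ContDiffAt ℝ 2 u y := hu.contDiffAt (hΩ.mem_nhds hy)
  have : (fun z => ∑ i, pd i (pd i u) z) =ᶠ[𝓝 y] laplacian u := by
    filter_upwards [ev_cd h] with z hz
    exact (lap_eq hz).symm
  refine ContinuousAt.continuousWithinAt (ContinuousAt.congr ?_ this)
  refine tendsto_finsetSum _ fun i _ => ?_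
  have h3 : ContDiffAt ℝ 0 (fderiv ℝ (pd i u)) y :=
    (pd_contDiffAt (i := i) h).fderiv_right (m := 0) (by norm_num)
  exact (h3.continuousAt.clm_apply continuousAt_const)

lemma lap_continuous (hu : ContDiff ℝ 2 u) : Continuous (laplacian u) := by
  rw [← continuousOn_univ]; exact lap_cont isOpen_univ hu.contDiffOn

lemma pd_continuous (hu : ContDiff ℝ 2 u) : Continuous (pd i u) := by
  rw [← continuousOn_univ]; exact pd_cont isOpen_univ hu.contDiffOn

lemma gradSq_continuous (hu : ContDiff ℝ 2 u) : Continuous (gradSq u) := by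
  unfold gradSq
  exact continuous_finsetSum _ fun i _ => (pd_continuous hu).pow 2

lemma ev_zero (hx : x ∉ tsupport u) : u =ᶠ[𝓝 x] fun _ => 0 := by
  exact notMem_tsupport_iff_eventuallyEq.1 hx

lemma lap_zero_off (hx : x ∉ tsupport u) : laplacian u x = 0 := by
  rw [lap_congr (ev_zero hx), lap_const]

lemma pd_zero_off (hx : x ∉ tsupport u) : pd i u x = 0 := by
  rw [pd_congr (ev_zero hx), pd_const]

lemma tsupport_pd : tsupport (pd i u) ⊆ tsupport u := by
  apply closure_minimal _ (isClosed_tsupport _)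
  intro y hy
  by_contra h
  exact hy (pd_zero_off h)

lemma tsupport_lap : tsupport (laplacian u) ⊆ tsupport u := by
  apply closure_minimal _ (isClosed_tsupport _)
  intro y hy
  by_contra h
  exact hy (lap_zero_off h)

lemma mul_cs_cont {Ω : Set (Eu N)} (hΩ : IsOpen Ω) {f g : Eu N → ℝ} (hf : ContinuousOn f Ω)
    (hg : ContinuousOn g Ω) (hs : tsupport g ⊆ Ω) : Continuous (fun y => f y * g y) := by
  rw [continuous_iff_continuousAt]
  intro y
  by_cases hy : y ∈ tsupport g
  · exact (hf.continuousAt (hΩ.mem_nhds (hs hy))).mul (hg.continuousAt (hΩ.mem_nhds (hs hy)))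
  · have : (fun _ => (0:ℝ)) =ᶠ[𝓝 y] fun y => f y * g y := by
      filter_upwards [ev_zero hy] with z hz
      simp [hz]
    exact continuousAt_const.congr this

lemma mul_cs_int {Ω : Set (Eu N)} (hΩ : IsOpen Ω) {f g : Eu N → ℝ} (hf : ContinuousOn f Ω)
    (hg : ContinuousOn g Ω) (hs : tsupport g ⊆ Ω) (hc : HasCompactSupport g) :
    Integrable (fun y => f y * g y) := by
  exact (mul_cs_cont hΩ hf hg hs).integrable_of_hasCompactSupport hc.mul_left

lemma hcs_of_tsupport {f g : Eu N → ℝ} (hc : HasCompactSupport g) (h : tsupport f ⊆ tsupport g) :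
    HasCompactSupport f := IsCompact.of_isClosed_subset hc (isClosed_tsupport _) h

/-- Green formula with a compactly supported test function. -/
lemma green {Ω : Set (Eu N)} (hΩ : IsOpen Ω) {φ : Eu N → ℝ} (hu : ContDiffOn ℝ 2 u Ω)
    (hφ : ContDiff ℝ 2 φ) (hc : HasCompactSupport φ) (hs : tsupport φ ⊆ Ω) :
    ∫ y, u y * laplacian φ y = ∫ y, laplacian u y * φ y := by
  have huc := hu.continuousOn
  have hφc := hφ.continuous.continuousOn (s := Ω)
  have cpd : ∀ i, HasCompactSupport (pd i φ) := fun i => hcs_of_tsupport hc tsupport_pd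
  have spd : ∀ i, tsupport (pd i φ) ⊆ Ω := fun i => tsupport_pd.trans hs
  have hpc : ∀ i, ContDiff ℝ 1 (pd i φ) := fun i => contDiff_iff_contDiffAt.2 fun y =>
    pd_contDiffAt hφ.contDiffAt
  have hppc : ∀ i, Continuous (pd i (pd i φ)) := fun i =>
    ((hpc i).continuous_fderiv (by norm_num)).clm_apply continuous_const
  have huu : ∀ i, ContinuousOn (pd i (pd i u)) Ω := by
    intro i y hy
    have h3 : ContDiffAt ℝ 0 (fderiv ℝ (pd i u)) y :=
      (pd_contDiffAt (i := i) (hu.contDiffAt (hΩ.mem_nhds hy))).fderiv_right (m := 0) (by norm_num)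
    exact (h3.continuousAt.clm_apply continuousAt_const).continuousWithinAt
  have key : ∀ i, ∫ y, u y * pd i (pd i φ) y = ∫ y, pd i (pd i u) y * φ y := by
    intro i
    have e1 : ∫ y, u y * pd i (pd i φ) y = - ∫ y, pd i u y * pd i φ y := by
      apply integral_mul_fderiv_eq_neg_fderiv_mul_of_integrable
      · exact mul_cs_int hΩ (pd_cont hΩ hu) (hpc i).continuous.continuousOn (spd i) (cpd i)
      · exact mul_cs_int hΩ huc (hppc i).continuousOn (tsupport_pd.trans (spd i))
          (hcs_of_tsupport (cpd i) tsupport_pd)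
      · exact mul_cs_int hΩ huc (hpc i).continuous.continuousOn (spd i) (cpd i)
      · exact fun y hy => cd_diff (hu.contDiffAt (hΩ.mem_nhds (spd i hy)))
      · exact fun y _ => (hpc i).differentiable (by norm_num) y
    have e2 : ∫ y, pd i u y * pd i φ y = - ∫ y, pd i (pd i u) y * φ y := by
      apply integral_mul_fderiv_eq_neg_fderiv_mul_of_integrable
      · exact mul_cs_int hΩ (huu i) hφc hs hc
      · exact mul_cs_int hΩ (pd_cont hΩ hu) (hpc i).continuous.continuousOn (spd i) (cpd i)
      · exact mul_cs_int hΩ (pd_cont hΩ hu) hφc hs hc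
      · exact fun y hy => pd_diff (hu.contDiffAt (hΩ.mem_nhds (hs hy)))
      · exact fun y _ => hφ.differentiable (by norm_num) y
    rw [e1, e2, neg_neg]
  have l1 : ∀ y, u y * laplacian φ y = ∑ i, u y * pd i (pd i φ) y := by
    intro y; rw [lap_eq hφ.contDiffAt, Finset.mul_sum]
  have l2 : ∀ y, laplacian u y * φ y = ∑ i, pd i (pd i u) y * φ y := by
    intro y
    by_cases hy : y ∈ tsupport φ
    · rw [lap_eq (hu.contDiffAt (hΩ.mem_nhds (hs hy))), Finset.sum_mul]
    · simp [image_eq_zero_of_notMem_tsupport hy]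
  simp_rw [l1, l2]
  rw [integral_finsetSum, integral_finsetSum]
  · exact Finset.sum_congr rfl fun i _ => key i
  · intro i _; exact mul_cs_int hΩ (huu i) hφc hs hc
  · intro i _
    exact mul_cs_int hΩ huc (hppc i).continuousOn (tsupport_pd.trans (spd i))
          (hcs_of_tsupport (cpd i) tsupport_pd)


/-- Second order condition at a local maximum. -/
lemma lap_nonpos_of_isLocalMax (hu : ContDiffAt ℝ 2 u x) (hm : IsLocalMax u x) :
    laplacian u x ≤ 0 := by
  rw [lap_eq hu]
  refine Finset.sum_nonpos fun i _ => ?_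
  set L : ℝ → Eu N := fun t => x + t • ee i with hL
  have hLd : ∀ t, HasDerivAt L (ee i) t := by
    intro t
    have := ((hasDerivAt_id t).smul_const (ee i)).const_add x
    rw [one_smul] at this
    exact this
  have hL0 : L 0 = x := by simp [hL]
  have hLc : Tendsto L (𝓝 0) (𝓝 x) := by
    have := (hLd 0).continuousAt.tendsto; rwa [hL0] at this
  have hd : ∀ w : Eu N → ℝ, ∀ t, DifferentiableAt ℝ w (L t) →
      deriv (fun t => w (L t)) t = pd i w (L t) := by
    intro w t hw
    exact (hw.hasFDerivAt.comp_hasDerivAt t (hLd t)).deriv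
  set f : ℝ → ℝ := fun t => u (L t) with hf
  have hmax : IsLocalMax f 0 := by
    have := hLc.eventually hm
    simpa [IsLocalMax, IsMaxFilter, hf, hL0] using this
  have h1 : deriv f =ᶠ[𝓝 0] fun t => pd i u (L t) := by
    filter_upwards [hLc.eventually (ev_cd hu)] with t ht
    exact hd u t (cd_diff ht)
  have h2 : deriv (deriv f) 0 = pd i (pd i u) x := by
    rw [h1.deriv_eq, hd (pd i u) 0 (by rw [hL0]; exact pd_diff hu), hL0]
  have hz : deriv f 0 = 0 := hmax.deriv_eq_zero
  by_contra hpos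
  push Not at hpos
  rw [← h2] at hpos
  have hcont : ContinuousAt f 0 := by
    have : ContinuousAt u (L 0) := by rw [hL0]; exact hu.continuousAt
    exact ContinuousAt.comp this (hLd 0).continuousAt
  have hmin := isLocalMin_of_deriv_deriv_pos hpos hz hcont
  have hconst : f =ᶠ[𝓝 0] fun _ => f 0 := by
    filter_upwards [hmin, hmax] with t a b
    exact le_antisymm b a
  have h3 : deriv f =ᶠ[𝓝 0] fun _ => 0 := by
    filter_upwards [hconst.eventuallyEq_nhds] with t ht
    rw [ht.deriv_eq]; simp
  rw [h3.deriv_eq] at hpos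
  simp at hpos

end lapcalc

noncomputable def pw (k : ℕ) (t : ℝ) : ℝ := (max t 0) ^ k

lemma pw_nonneg (k : ℕ) (t : ℝ) : 0 ≤ pw k t := pow_nonneg (le_max_right _ _) _

lemma pw_of_nonneg (k : ℕ) {t : ℝ} (h : 0 ≤ t) : pw k t = t ^ k := by simp [pw, max_eq_left h]

lemma pw_of_nonpos (k : ℕ) {t : ℝ} (h : t ≤ 0) : pw (k + 1) t = 0 := by
  simp [pw, max_eq_right h]

lemma pw_continuous (k : ℕ) : Continuous (pw k) := (continuous_id.max continuous_const).pow k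

lemma pw_hasDerivAt (k : ℕ) (t : ℝ) :
    HasDerivAt (pw (k + 2)) ((k + 2 : ℝ) * pw (k + 1) t) t := by
  rcases lt_trichotomy t 0 with h | h | h
  · rw [pw_of_nonpos k h.le, mul_zero]
    refine (hasDerivAt_const t (0:ℝ)).congr_of_eventuallyEq ?_
    filter_upwards [gt_mem_nhds h] with y hy
    exact pw_of_nonpos _ hy.le
  · subst h
    rw [pw_of_nonpos k le_rfl, mul_zero]
    have hr : HasDerivWithinAt (pw (k + 2)) 0 (Ici 0) 0 := by
      have h1 : HasDerivAt (fun y : ℝ => y ^ (k + 2)) 0 0 := by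
        simpa using hasDerivAt_pow (k + 2) (0:ℝ)
      exact h1.hasDerivWithinAt.congr (fun y hy => pw_of_nonneg _ hy) (pw_of_nonneg _ le_rfl)
    have hl : HasDerivWithinAt (pw (k + 2)) 0 (Iic 0) 0 :=
      (hasDerivWithinAt_const (0:ℝ) (Iic 0) (0:ℝ)).congr (fun y hy => pw_of_nonpos _ hy)
        (pw_of_nonpos _ le_rfl)
    have := hl.union hr
    rwa [Iic_union_Ici, hasDerivWithinAt_univ] at this
  · rw [pw_of_nonneg _ h.le]
    have h1 : HasDerivAt (fun y : ℝ => y ^ (k + 2)) ((k + 2 : ℝ) * t ^ (k + 1)) t := by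
      have := hasDerivAt_pow (k + 2) t
      simpa using this
    refine h1.congr_of_eventuallyEq ?_
    filter_upwards [lt_mem_nhds h] with y hy
    exact pw_of_nonneg _ hy.le

lemma contDiff_two_of {f f' f'' : ℝ → ℝ} (h1 : ∀ t, HasDerivAt f (f' t) t)
    (h2 : ∀ t, HasDerivAt f' (f'' t) t) (h3 : Continuous f'') : ContDiff ℝ 2 f := by
  have d1 : deriv f = f' := funext fun t => (h1 t).deriv
  have d2 : deriv f' = f'' := funext fun t => (h2 t).deriv
  rw [show (2 : WithTop ℕ∞) = 1 + 1 from by norm_num, contDiff_succ_iff_deriv]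
  refine ⟨fun t => (h1 t).differentiableAt, by simp, ?_⟩
  rw [d1, contDiff_one_iff_deriv]
  exact ⟨fun t => (h2 t).differentiableAt, by rw [d2]; exact h3⟩

noncomputable def Th (t : ℝ) : ℝ := pw 3 t - pw 4 t / 2 + pw 3 (t - 1) + pw 4 (t - 1) / 2
noncomputable def Th1 (t : ℝ) : ℝ := 3 * pw 2 t - 2 * pw 3 t + 3 * pw 2 (t - 1) + 2 * pw 3 (t - 1)
noncomputable def Th2 (t : ℝ) : ℝ := 6 * pw 1 t - 6 * pw 2 t + 6 * pw 1 (t - 1) + 6 * pw 2 (t - 1)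

lemma pw_hasDerivAt_sub (k : ℕ) (t c : ℝ) :
    HasDerivAt (fun t => pw (k + 2) (t - c)) ((k + 2 : ℝ) * pw (k + 1) (t - c)) t := by
  have := (pw_hasDerivAt k (t - c)).comp t ((hasDerivAt_id t).sub_const c)
  rw [mul_one] at this
  exact this

lemma Th_hasDerivAt (t : ℝ) : HasDerivAt Th (Th1 t) t := by
  have h := ((((pw_hasDerivAt 1 t).sub ((pw_hasDerivAt 2 t).div_const 2)).add
    (pw_hasDerivAt_sub 1 t 1)).add ((pw_hasDerivAt_sub 2 t 1).div_const 2))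
  refine h.congr_deriv ?_
  unfold Th1; norm_num; ring

lemma Th1_hasDerivAt (t : ℝ) : HasDerivAt Th1 (Th2 t) t := by
  have h := (((((pw_hasDerivAt 0 t).const_mul 3).sub ((pw_hasDerivAt 1 t).const_mul 2)).add
    ((pw_hasDerivAt_sub 0 t 1).const_mul 3)).add ((pw_hasDerivAt_sub 1 t 1).const_mul 2))
  refine h.congr_deriv ?_
  unfold Th2; norm_num; ring

lemma Th2_continuous : Continuous Th2 := by
  unfold Th2
  have h (k : ℕ) : Continuous fun t : ℝ => pw k (t - 1) := (pw_continuous k).comp (by fun_prop)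
  have h' (k : ℕ) := pw_continuous k
  exact ((((h' 1).const_mul 6).sub ((h' 2).const_mul 6)).add ((h 1).const_mul 6)).add
    ((h 2).const_mul 6)

lemma Th_contDiff : ContDiff ℝ 2 Th := contDiff_two_of Th_hasDerivAt Th1_hasDerivAt Th2_continuous

lemma Th_continuous : Continuous Th := Th_contDiff.continuous
lemma Th1_continuous : Continuous Th1 :=
  continuous_iff_continuousAt.2 fun t => (Th1_hasDerivAt t).continuousAt

lemma Th_neg {t : ℝ} (h : t ≤ 0) : Th t = 0 ∧ Th1 t = 0 ∧ Th2 t = 0 := by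
  have h' : t - 1 ≤ 0 := by linarith
  simp [Th, Th1, Th2, pw_of_nonpos _ h, pw_of_nonpos _ h']

lemma Th_mid {t : ℝ} (h0 : 0 ≤ t) (h1 : t ≤ 1) :
    Th t = t ^ 3 - t ^ 4 / 2 ∧ Th1 t = 3 * t ^ 2 - 2 * t ^ 3 ∧ Th2 t = 6 * t - 6 * t ^ 2 := by
  have h' : t - 1 ≤ 0 := by linarith
  simp [Th, Th1, Th2, pw_of_nonneg _ h0, pw_of_nonpos _ h']

lemma Th_big {t : ℝ} (h1 : 1 ≤ t) : Th t = t - 1 / 2 ∧ Th1 t = 1 ∧ Th2 t = 0 := by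
  have h0 : 0 ≤ t := by linarith
  have h' : 0 ≤ t - 1 := by linarith
  simp only [Th, Th1, Th2, pw_of_nonneg _ h0, pw_of_nonneg _ h']
  refine ⟨by ring, by ring, by ring⟩

noncomputable def cl (t : ℝ) : ℝ := max 0 (min t 1)

lemma cl_neg {t : ℝ} (h : t ≤ 0) : cl t = 0 := by
  unfold cl; rw [min_eq_left (by linarith), max_eq_left h]
lemma cl_mid {t : ℝ} (h0 : 0 ≤ t) (h1 : t ≤ 1) : cl t = t := by
  unfold cl; rw [min_eq_left h1, max_eq_right h0]
lemma cl_big {t : ℝ} (h1 : 1 ≤ t) : cl t = 1 := by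
  unfold cl; rw [min_eq_right h1]; simp
lemma cl_nonneg (t : ℝ) : 0 ≤ cl t := le_max_left _ _
lemma cl_le_one (t : ℝ) : cl t ≤ 1 := max_le (by norm_num) (min_le_right _ _)
lemma cl_continuous : Continuous cl := by unfold cl; fun_prop

lemma tri (P : ℝ → Prop) (hn : ∀ t ≤ 0, P t) (hm : ∀ t, 0 ≤ t → t ≤ 1 → P t) (hb : ∀ t, 1 ≤ t → P t)
    (t : ℝ) : P t := by
  rcases le_total t 0 with h | h
  · exact hn t h
  · rcases le_total t 1 with h' | h'
    · exact hm t h h'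
    · exact hb t h'

lemma Th_nonneg (t : ℝ) : 0 ≤ Th t := by
  revert t; apply tri
  · intro t h; rw [(Th_neg h).1]
  · intro t h0 h1; rw [(Th_mid h0 h1).1]; nlinarith [pow_nonneg h0 3, pow_nonneg h0 4, mul_nonneg (pow_nonneg h0 3) (sub_nonneg.2 h1)]
  · intro t h; rw [(Th_big h).1]; linarith

lemma Th1_nonneg (t : ℝ) : 0 ≤ Th1 t := by
  revert t; apply tri
  · intro t h; rw [(Th_neg h).2.1]
  · intro t h0 h1; rw [(Th_mid h0 h1).2.1]; nlinarith [pow_nonneg h0 2, mul_nonneg (pow_nonneg h0 2) (sub_nonneg.2 h1)]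
  · intro t h; rw [(Th_big h).2.1]; norm_num

lemma Th1_le_one (t : ℝ) : Th1 t ≤ 1 := by
  revert t; apply tri
  · intro t h; rw [(Th_neg h).2.1]; norm_num
  · intro t h0 h1; rw [(Th_mid h0 h1).2.1]; nlinarith [mul_nonneg (sq_nonneg (1 - t)) (by linarith : (0:ℝ) ≤ 1 + 2 * t)]
  · intro t h; rw [(Th_big h).2.1]

lemma Th1_le (t : ℝ) : Th1 t ≤ 3 * cl t ^ 2 := by
  revert t; apply tri
  · intro t h; rw [(Th_neg h).2.1, cl_neg h]; norm_num
  · intro t h0 h1; rw [(Th_mid h0 h1).2.1, cl_mid h0 h1]; nlinarith [pow_nonneg h0 3]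
  · intro t h; rw [(Th_big h).2.1, cl_big h]; norm_num

lemma Th2_nonneg (t : ℝ) : 0 ≤ Th2 t := by
  revert t; apply tri
  · intro t h; rw [(Th_neg h).2.2]
  · intro t h0 h1; rw [(Th_mid h0 h1).2.2]; nlinarith
  · intro t h; rw [(Th_big h).2.2]

lemma Th2_le (t : ℝ) : Th2 t ≤ 6 * cl t := by
  revert t; apply tri
  · intro t h; rw [(Th_neg h).2.2, cl_neg h]; norm_num
  · intro t h0 h1; rw [(Th_mid h0 h1).2.2, cl_mid h0 h1]; nlinarith
  · intro t h; rw [(Th_big h).2.2, cl_big h]; norm_num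

lemma cl_cube_le (t : ℝ) : cl t ^ 3 ≤ 2 * Th t := by
  revert t; apply tri
  · intro t h; rw [(Th_neg h).1, cl_neg h]; norm_num
  · intro t h0 h1; rw [(Th_mid h0 h1).1, cl_mid h0 h1]; nlinarith [mul_nonneg (pow_nonneg h0 3) (sub_nonneg.2 h1)]
  · intro t h; rw [(Th_big h).1, cl_big h]; linarith

lemma Th_le (t : ℝ) : Th t ≤ max t 0 := by
  revert t; apply tri
  · intro t h; rw [(Th_neg h).1]; exact le_max_right _ _
  · intro t h0 h1
    rw [(Th_mid h0 h1).1, max_eq_left h0]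
    have h2 : t ^ 3 ≤ t ^ 1 := pow_le_pow_of_le_one h0 h1 (by norm_num)
    nlinarith [pow_nonneg h0 4]
  · intro t h; rw [(Th_big h).1, max_eq_left (by linarith)]; linarith

lemma Th_ge (t : ℝ) : max t 0 - 1 / 2 ≤ Th t := by
  revert t; apply tri
  · intro t h; rw [(Th_neg h).1, max_eq_right h]; norm_num
  · intro t h0 h1
    rw [(Th_mid h0 h1).1, max_eq_left h0]
    nlinarith [mul_nonneg (sq_nonneg (1 - t)) (sq_nonneg (1 - t)), mul_nonneg (sq_nonneg (t*(1 - t))) h0, sq_nonneg (t * (1 - t)), sq_nonneg (1-t^2), mul_nonneg h0 (sq_nonneg (1-t)), mul_nonneg h0 (pow_nonneg (sub_nonneg.2 h1) 3), pow_nonneg (sub_nonneg.2 h1) 3]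
  · intro t h; rw [(Th_big h).1, max_eq_left (by linarith)]

/-- scaled version -/
noncomputable def Ths (δ t : ℝ) : ℝ := δ * Th (t / δ)

lemma Ths_hasDerivAt {δ : ℝ} (hδ : 0 < δ) (t : ℝ) : HasDerivAt (Ths δ) (Th1 (t / δ)) t := by
  have := ((Th_hasDerivAt (t / δ)).comp t ((hasDerivAt_id t).div_const δ)).const_mul δ
  refine this.congr_deriv ?_
  field_simp

lemma Ths1_hasDerivAt {δ : ℝ} (t : ℝ) :
    HasDerivAt (fun t => Th1 (t / δ)) (Th2 (t / δ) / δ) t := by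
  have := ((Th1_hasDerivAt (t / δ)).comp t ((hasDerivAt_id t).div_const δ))
  refine this.congr_deriv ?_
  simp [div_eq_mul_inv]

lemma Ths_contDiff {δ : ℝ} (hδ : 0 < δ) : ContDiff ℝ 2 (Ths δ) :=
  contDiff_two_of (Ths_hasDerivAt hδ) Ths1_hasDerivAt
    ((Th2_continuous.comp (continuous_id.div_const δ)).div_const δ)

lemma Ths_nonneg {δ : ℝ} (hδ : 0 < δ) (t : ℝ) : 0 ≤ Ths δ t := mul_nonneg hδ.le (Th_nonneg _)

lemma Ths_zero {δ t : ℝ} (hδ : 0 < δ) (h : t ≤ 0) : Ths δ t = 0 := by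
  unfold Ths; rw [(Th_neg (div_nonpos_of_nonpos_of_nonneg h hδ.le)).1, mul_zero]

lemma max_div {δ : ℝ} (hδ : 0 < δ) (t : ℝ) : δ * max (t / δ) 0 = max t 0 := by
  rw [mul_max_of_nonneg _ _ hδ.le]; congr 1 <;> field_simp
  simp

lemma Ths_le {δ : ℝ} (hδ : 0 < δ) (t : ℝ) : Ths δ t ≤ max t 0 := by
  rw [← max_div hδ t]; exact mul_le_mul_of_nonneg_left (Th_le _) hδ.le

lemma Ths_ge {δ : ℝ} (hδ : 0 < δ) (t : ℝ) : max t 0 - δ / 2 ≤ Ths δ t := by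
  have := mul_le_mul_of_nonneg_left (Th_ge (t / δ)) hδ.le
  rw [mul_sub, max_div hδ t] at this
  unfold Ths; linarith

lemma lap_Ths {N : ℕ} {u : Eu N → ℝ} {x : Eu N} {δ : ℝ} (hδ : 0 < δ) (hu : ContDiffAt ℝ 2 u x) :
    laplacian (fun y => Ths δ (u y)) x =
      Th2 (u x / δ) / δ * gradSq u x + Th1 (u x / δ) * laplacian u x :=
  lap_comp (Ths_contDiff hδ) (Ths_hasDerivAt hδ) Ths1_hasDerivAt hu

section comparison
variable {N : ℕ} {Ω : Set (Eu N)}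

lemma comparison (hΩ : IsOpen Ω) {f : Eu N → ℝ} (hf : ContDiffOn ℝ 2 f Ω)
    (hlap : ∀ x ∈ Ω, 0 < f x → 0 < laplacian f x)
    (hbd : ∀ δ > (0:ℝ), ∃ K, K ⊆ Ω ∧ IsCompact K ∧ ∀ x ∈ Ω \ K, f x ≤ δ) :
    ∀ x ∈ Ω, f x ≤ 0 := by
  intro x0 hx0
  by_contra hpos
  push Not at hpos
  obtain ⟨K, hKΩ, hK, hKb⟩ := hbd (f x0 / 2) (by linarith)
  have hx0K : x0 ∈ K := by
    by_contra h
    have := hKb x0 ⟨hx0, h⟩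
    linarith
  obtain ⟨y, hyK, hy⟩ := hK.exists_isMaxOn ⟨x0, hx0K⟩ (hf.continuousOn.mono hKΩ)
  have hy0 : f x0 ≤ f y := hy hx0K
  have hyΩ := hKΩ hyK
  have hloc : IsLocalMax f y := by
    filter_upwards [hΩ.mem_nhds hyΩ] with z hz
    by_cases hzK : z ∈ K
    · exact hy hzK
    · have := hKb z ⟨hz, hzK⟩
      linarith
  have h1 := lap_nonpos_of_isLocalMax (hf.contDiffAt (hΩ.mem_nhds hyΩ)) hloc
  have h2 := hlap y hyΩ (by linarith)
  linarith

lemma bd_of_cont (hΩ : IsOpen Ω) (hb : Bornology.IsBounded Ω) {f : Eu N → ℝ}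
    (hf : ContinuousOn f (closure Ω)) (h0 : ∀ x ∈ frontier Ω, f x ≤ 0) :
    ∀ δ > (0:ℝ), ∃ K, K ⊆ Ω ∧ IsCompact K ∧ ∀ x ∈ Ω \ K, f x ≤ δ := by
  intro δ hδ
  have hc : IsCompact (closure Ω) := hb.isCompact_closure
  refine ⟨closure Ω ∩ f ⁻¹' (Ici δ), ?_, ?_, ?_⟩
  · rintro x ⟨hx, hx2⟩
    by_contra hxΩ
    have : x ∈ frontier Ω := by
      rw [hΩ.frontier_eq]; exact ⟨hx, hxΩ⟩
    have := h0 x this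
    simp only [mem_preimage, mem_Ici] at hx2
    linarith
  · exact hc.of_isClosed_subset (hf.preimage_isClosed_of_isClosed isClosed_closure isClosed_Ici)
      inter_subset_left
  · rintro x ⟨hx, hx2⟩
    by_contra h
    push Not at h
    exact hx2 ⟨subset_closure hx, h.le⟩

end comparison

/-- The system of approximating solutions and the large solution. -/
structure Sys {N : ℕ} (Ω : Set (Eu N)) (U : ℕ → Eu N → ℝ) (V : Eu N → ℝ) (B : ℝ) : Prop where
  op : IsOpen Ω
  bdd : Bornology.IsBounded Ω
  Ucd : ∀ n, ContDiffOn ℝ 2 (U n) Ω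
  Ueq : ∀ n, ∀ x ∈ Ω, laplacian (U n) x = Real.exp (U n x)
  Ucont : ∀ n, ContinuousOn (U n) (closure Ω)
  Ufr : ∀ n, ∀ x ∈ frontier Ω, U n x = n
  Vcd : ContDiffOn ℝ 2 V Ω
  Veq : ∀ x ∈ Ω, laplacian V x = Real.exp (V x)
  Vbd : ∀ M > (0:ℝ), ∃ K, K ⊆ Ω ∧ IsCompact K ∧ ∀ x ∈ Ω \ K, M ≤ V x
  Bpos : 0 ≤ B
  Uge : ∀ n, ∀ x ∈ Ω, -B ≤ U n x
  Umono : ∀ n m, n ≤ m → ∀ x ∈ Ω, U n x ≤ U m x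
  UV : ∀ n, ∀ x ∈ Ω, U n x ≤ V x
  Ule : ∀ n, ∀ x ∈ Ω, U n x ≤ n

section build
variable {N : ℕ} {Ω : Set (Eu N)} {u : ℝ → Eu N → ℝ}

noncomputable def Uf (u : ℝ → Eu N → ℝ) (M : ℝ) (x : Eu N) : ℝ := u (-Real.exp M) x + M

lemma Uf_cd (hu : ∀ lam < (0:ℝ), IsClassicalSolution Ω lam Real.exp (u lam))
    (M : ℝ) : ContDiffOn ℝ 2 (Uf u M) Ω :=
  (hu (-Real.exp M) (by simp [Real.exp_pos])).2.1.add contDiffOn_const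

lemma Uf_cont (hu : ∀ lam < (0:ℝ), IsClassicalSolution Ω lam Real.exp (u lam))
    (M : ℝ) : ContinuousOn (Uf u M) (closure Ω) :=
  (hu (-Real.exp M) (by simp [Real.exp_pos])).1.add continuousOn_const

lemma Uf_fr (hu : ∀ lam < (0:ℝ), IsClassicalSolution Ω lam Real.exp (u lam))
    (M : ℝ) : ∀ x ∈ frontier Ω, Uf u M x = M := by
  intro x hx
  simp [Uf, (hu (-Real.exp M) (by simp [Real.exp_pos])).2.2.2 x hx]

lemma Uf_eq (hΩo : IsOpen Ω) (hu : ∀ lam < (0:ℝ), IsClassicalSolution Ω lam Real.exp (u lam))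
    (M : ℝ) : ∀ x ∈ Ω, laplacian (Uf u M) x = Real.exp (Uf u M x) := by
  intro x hx
  have h := hu (-Real.exp M) (by simp [Real.exp_pos])
  have h1 := h.2.2.1 x hx
  have h2 : laplacian (Uf u M) x = laplacian (u (-Real.exp M)) x := by
    have := lap_add (v := fun _ => M) (h.2.1.contDiffAt (hΩo.mem_nhds hx)) contDiffAt_const
    rw [lap_const, add_zero] at this
    exact this
  rw [h2, Uf, Real.exp_add]
  linarith

lemma Uf_mono (hΩo : IsOpen Ω) (hΩb : Bornology.IsBounded Ω)
    (hu : ∀ lam < (0:ℝ), IsClassicalSolution Ω lam Real.exp (u lam))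
    {M M' : ℝ} (h : M ≤ M') : ∀ x ∈ Ω, Uf u M x ≤ Uf u M' x := by
  have := comparison hΩo (f := fun x => Uf u M x - Uf u M' x)
    ((Uf_cd hu M).sub (Uf_cd hu M')) ?_ ?_
  · intro x hx; linarith [this x hx]
  · intro x hx hpos
    rw [lap_sub ((Uf_cd hu M).contDiffAt (hΩo.mem_nhds hx))
      ((Uf_cd hu M').contDiffAt (hΩo.mem_nhds hx)), Uf_eq hΩo hu M x hx, Uf_eq hΩo hu M' x hx]
    have := Real.exp_lt_exp.2 (sub_pos.1 hpos)
    linarith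
  · apply bd_of_cont hΩo hΩb ((Uf_cont hu M).sub (Uf_cont hu M'))
    intro x hx
    have h1 := Uf_fr hu M x hx
    have h2 := Uf_fr hu M' x hx
    show Uf u M x - Uf u M' x ≤ 0
    rw [h1, h2]; linarith

lemma Uf_le (hΩo : IsOpen Ω) (hΩb : Bornology.IsBounded Ω)
    (hu : ∀ lam < (0:ℝ), IsClassicalSolution Ω lam Real.exp (u lam))
    (M : ℝ) : ∀ x ∈ Ω, Uf u M x ≤ M := by
  have := comparison hΩo (f := fun x => Uf u M x - M)
    ((Uf_cd hu M).sub contDiffOn_const) ?_ ?_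
  · intro x hx; linarith [this x hx]
  · intro x hx hpos
    rw [lap_sub ((Uf_cd hu M).contDiffAt (hΩo.mem_nhds hx)) contDiffAt_const,
      Uf_eq hΩo hu M x hx, lap_const]
    simp [Real.exp_pos]
  · apply bd_of_cont hΩo hΩb ((Uf_cont hu M).sub continuousOn_const)
    intro x hx
    simp [Uf_fr hu M x hx]

lemma Uf_le_V (hΩo : IsOpen Ω) (hΩb : Bornology.IsBounded Ω)
    (hu : ∀ lam < (0:ℝ), IsClassicalSolution Ω lam Real.exp (u lam))
    {v : Eu N → ℝ} (hvd : ContDiffOn ℝ 2 v Ω)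
    (hveq : ∀ x ∈ Ω, laplacian v x = Real.exp (v x))
    (hvbd : ∀ M > (0:ℝ), ∃ K, K ⊆ Ω ∧ IsCompact K ∧ ∀ x ∈ Ω \ K, M ≤ v x) (M : ℝ) :
    ∀ x ∈ Ω, Uf u M x ≤ v x := by
  have := comparison hΩo (f := fun x => Uf u M x - v x) ((Uf_cd hu M).sub hvd) ?_ ?_
  · intro x hx; linarith [this x hx]
  · intro x hx hpos
    rw [lap_sub ((Uf_cd hu M).contDiffAt (hΩo.mem_nhds hx))
      (hvd.contDiffAt (hΩo.mem_nhds hx)), Uf_eq hΩo hu M x hx, hveq x hx]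
    have := Real.exp_lt_exp.2 (sub_pos.1 hpos)
    linarith
  · intro δ hδ
    obtain ⟨K, h1, h2, h3⟩ := hvbd (max M 1) (by positivity)
    refine ⟨K, h1, h2, fun x hx => ?_⟩
    have := h3 x hx
    have := Uf_le hΩo hΩb hu M x hx.1
    have := le_max_left M 1
    linarith

lemma sys_exists (hΩo : IsOpen Ω) (hΩb : Bornology.IsBounded Ω)
    (hu : ∀ lam < (0:ℝ), IsClassicalSolution Ω lam Real.exp (u lam))
    {v : Eu N → ℝ} (hvd : ContDiffOn ℝ 2 v Ω)
    (hveq : ∀ x ∈ Ω, laplacian v x = Real.exp (v x))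
    (hvbd : ∀ M > (0:ℝ), ∃ K, K ⊆ Ω ∧ IsCompact K ∧ ∀ x ∈ Ω \ K, M ≤ v x) :
    ∃ B, Sys Ω (fun n : ℕ => Uf u n) v B := by
  have hc : IsCompact (closure Ω) := hΩb.isCompact_closure
  obtain ⟨C, hC⟩ := (hc.exists_bound_of_continuousOn (Uf_cont hu 0))
  refine ⟨max C 0, hΩo, hΩb, fun n => Uf_cd hu n, fun n => Uf_eq hΩo hu n, fun n => Uf_cont hu n,
    fun n => Uf_fr hu n, hvd, hveq, hvbd, le_max_right _ _, ?_, ?_, ?_, ?_⟩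
  · intro n x hx
    have h1 := Uf_mono hΩo hΩb hu (Nat.cast_nonneg (α := ℝ) n) x hx
    have h2 := hC x (subset_closure hx)
    have h3 := neg_abs_le (Uf u 0 x)
    rw [Real.norm_eq_abs] at h2
    have := le_max_left C 0
    linarith
  · intro n m h; exact Uf_mono hΩo hΩb hu (by exact_mod_cast h)
  · intro n; exact Uf_le_V hΩo hΩb hu hvd hveq hvbd n
  · intro n; exact Uf_le hΩo hΩb hu n

end build

section W
variable {N : ℕ} {Ω : Set (Eu N)} {U : ℕ → Eu N → ℝ} {V : Eu N → ℝ} {B : ℝ}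

/-- The pointwise supremum of the approximating solutions, extended by zero. -/
noncomputable def WW (Ω : Set (Eu N)) (U : ℕ → Eu N → ℝ) (x : Eu N) : ℝ :=
  ⨆ n, indicator Ω (U n) x

lemma WW_off {x : Eu N} (hx : x ∉ Ω) : WW Ω U x = 0 := by
  simp [WW, hx]

lemma WW_tendsto (h : Sys Ω U V B) (x : Eu N) :
    Tendsto (fun n => indicator Ω (U n) x) atTop (𝓝 (WW Ω U x)) := by
  by_cases hx : x ∈ Ω
  · apply tendsto_atTop_ciSup
    · intro n m hnm
      simp only [indicator_of_mem hx]
      exact h.Umono n m hnm x hx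
    · refine ⟨V x, ?_⟩
      rintro _ ⟨n, rfl⟩
      simp only [indicator_of_mem hx]
      exact h.UV n x hx
  · simp [WW, hx]

lemma WW_tendsto' (h : Sys Ω U V B) {x : Eu N} (hx : x ∈ Ω) :
    Tendsto (fun n => U n x) atTop (𝓝 (WW Ω U x)) := by
  have := WW_tendsto h x
  simpa only [indicator_of_mem hx] using this

lemma U_le_WW (h : Sys Ω U V B) {x : Eu N} (hx : x ∈ Ω) (n : ℕ) : U n x ≤ WW Ω U x :=
  ge_of_tendsto (WW_tendsto' h hx) (eventually_atTop.2 ⟨n, fun m hm => h.Umono n m hm x hx⟩)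

lemma WW_le (h : Sys Ω U V B) {x : Eu N} (hx : x ∈ Ω) : WW Ω U x ≤ V x :=
  le_of_tendsto (WW_tendsto' h hx) (Eventually.of_forall fun n => h.UV n x hx)

lemma WW_ge (h : Sys Ω U V B) (x : Eu N) : -B ≤ WW Ω U x := by
  by_cases hx : x ∈ Ω
  · exact (h.Uge 0 x hx).trans (U_le_WW h hx 0)
  · rw [WW_off hx]; linarith [h.Bpos]

lemma meas_indicator (hΩ : IsOpen Ω) {f : Eu N → ℝ} (hf : ContinuousOn f Ω) :
    Measurable (indicator Ω f) := by
  classical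
  have := ContinuousOn.measurable_piecewise (f := f) (g := fun _ => (0:ℝ)) hf continuousOn_const
    hΩ.measurableSet
  convert this using 1
  ext x
  by_cases hx : x ∈ Ω <;> simp [hx]

lemma WW_meas (h : Sys Ω U V B) : Measurable (WW Ω U) :=
  measurable_of_tendsto_metrizable
    (fun n => meas_indicator h.op (h.Ucd n).continuousOn) (tendsto_pi_nhds.2 (WW_tendsto h))

lemma WW_loc (h : Sys Ω U V B) {K : Set (Eu N)} (hK : IsCompact K) (hKΩ : K ⊆ Ω) :
    ∃ M, 0 ≤ M ∧ ∀ x ∈ K, Real.exp (WW Ω U x) ≤ M := by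
  obtain ⟨C, hC⟩ := hK.exists_bound_of_continuousOn (h.Vcd.continuousOn.mono hKΩ)
  refine ⟨Real.exp C, (Real.exp_pos _).le, fun x hx => Real.exp_le_exp.2 ?_⟩
  exact (WW_le h (hKΩ hx)).trans ((le_abs_self _).trans (hC x hx))

end W

section HB
variable {N : ℕ} {Ω : Set (Eu N)}

def Adm (Ω : Set (Eu N)) (Ψ : Eu N → ℝ) : Prop :=
  ContDiff ℝ 2 Ψ ∧ ∃ K, K ⊆ Ω ∧ IsCompact K ∧ ∀ x ∈ Ω \ K, 0 ≤ Ψ x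

noncomputable def LL (a Ψ : Eu N → ℝ) (x : Eu N) : ℝ := -laplacian Ψ x + a x * Ψ x

lemma Adm.add {Ψ Φ : Eu N → ℝ} (h1 : Adm Ω Ψ) (h2 : Adm Ω Φ) : Adm Ω (fun x => Ψ x + Φ x) := by
  obtain ⟨c1, K1, s1, k1, p1⟩ := h1
  obtain ⟨c2, K2, s2, k2, p2⟩ := h2
  refine ⟨c1.add c2, K1 ∪ K2, union_subset s1 s2, k1.union k2, fun x hx => ?_⟩
  have := p1 x ⟨hx.1, fun h => hx.2 (Or.inl h)⟩
  have := p2 x ⟨hx.1, fun h => hx.2 (Or.inr h)⟩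
  linarith

lemma Adm.smul {Ψ : Eu N → ℝ} (h1 : Adm Ω Ψ) {c : ℝ} (hc : 0 ≤ c) :
    Adm Ω (fun x => c * Ψ x) := by
  obtain ⟨c1, K1, s1, k1, p1⟩ := h1
  exact ⟨contDiff_const.mul c1, K1, s1, k1, fun x hx => mul_nonneg hc (p1 x hx)⟩

lemma Adm.zero : Adm Ω (fun _ => 0) :=
  ⟨contDiff_const, ∅, by simp, isCompact_empty, by simp⟩

lemma bdd_on {f : Eu N → ℝ} (hb : Bornology.IsBounded Ω) (hf : Continuous f) :
    ∃ C, 0 ≤ C ∧ ∀ x ∈ Ω, |f x| ≤ C := by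
  obtain ⟨C, hC⟩ := hb.isCompact_closure.exists_bound_of_continuousOn hf.continuousOn
  exact ⟨max C 0, le_max_right _ _, fun x hx => (hC x (subset_closure hx)).trans (le_max_left _ _)⟩

structure HBd (Ω : Set (Eu N)) (T a b : Eu N → ℝ) (CT CB : ℝ) : Prop where
  op : IsOpen Ω
  bdd : Bornology.IsBounded Ω
  Tcd : ContDiffOn ℝ 2 T Ω
  Tnn : ∀ x ∈ Ω, 0 ≤ T x
  Tle : ∀ x ∈ Ω, T x ≤ CT
  am : Measurable a
  ann : ∀ x, 0 ≤ a x
  aloc : ∀ K, IsCompact K → K ⊆ Ω → ∃ M, 0 ≤ M ∧ ∀ x ∈ K, a x ≤ M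
  bm : Measurable b
  bnn : ∀ x, 0 ≤ b x
  ble : ∀ x, b x ≤ CB
  bT : ∀ x ∈ Ω, b x ≤ -laplacian T x

variable {T a b : Eu N → ℝ} {CT CB : ℝ}

lemma HBd.fin (h : HBd Ω T a b CT CB) : IsFiniteMeasure (volume.restrict Ω) := by
  constructor
  rw [Measure.restrict_apply_univ]
  exact h.bdd.measure_lt_top

lemma HBd.Lbd (h : HBd Ω T a b CT CB) {Ψ : Eu N → ℝ} (hΨ : Adm Ω Ψ) :
    ∃ C, 0 ≤ C ∧ ∀ x ∈ Ω, -LL a Ψ x ≤ C := by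
  obtain ⟨c1, K1, s1, k1, p1⟩ := hΨ
  obtain ⟨C1, hC1, hl⟩ := bdd_on h.bdd (lap_continuous c1)
  obtain ⟨C2, hC2, hp⟩ := bdd_on h.bdd c1.continuous
  obtain ⟨M, hM, ha⟩ := h.aloc K1 k1 s1
  refine ⟨C1 + M * C2, by positivity, fun x hx => ?_⟩
  have h1 := (abs_le.1 (hl x hx)).2
  have h2 : -(a x * Ψ x) ≤ M * C2 := by
    by_cases hxK : x ∈ K1
    · have := ha x hxK
      have h3 := (abs_le.1 (hp x hx)).1
      have : a x * (-Ψ x) ≤ M * C2 := by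
        calc a x * (-Ψ x) ≤ a x * C2 := mul_le_mul_of_nonneg_left (by linarith) (h.ann x)
          _ ≤ M * C2 := mul_le_mul_of_nonneg_right this hC2
      linarith
    · have := mul_nonneg (h.ann x) (p1 x ⟨hx, hxK⟩)
      have : 0 ≤ M * C2 := by positivity
      linarith
  unfold LL
  linarith

lemma HBd.LLm (h : HBd Ω T a b CT CB) {Ψ : Eu N → ℝ} (hΨ : Adm Ω Ψ) :
    Measurable (LL a Ψ) :=
  (lap_continuous hΨ.1).measurable.neg.add (h.am.mul hΨ.1.continuous.measurable)

lemma HBd.Tm (h : HBd Ω T a b CT CB) : AEStronglyMeasurable T (volume.restrict Ω) :=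
  h.Tcd.continuousOn.aestronglyMeasurable h.op.measurableSet

lemma HBd.int1 (h : HBd Ω T a b CT CB) {f : Eu N → ℝ} (hf : Integrable f (volume.restrict Ω))
    {Ψ : Eu N → ℝ} (hΨ : Adm Ω Ψ) :
    Integrable (fun x => T x * max (f x - LL a Ψ x) 0) (volume.restrict Ω) := by
  obtain ⟨C, hC, hL⟩ := h.Lbd hΨ
  have := h.fin
  refine Integrable.mono' ((hf.abs.add (integrable_const C)).const_mul CT)
    (h.Tm.mul ((hf.aestronglyMeasurable.sub (h.LLm hΨ).aestronglyMeasurable).sup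
      aestronglyMeasurable_const)) ?_
  rw [ae_restrict_iff' h.op.measurableSet]
  refine Eventually.of_forall fun x hx => ?_
  have h1 := hL x hx
  rw [Real.norm_of_nonneg (mul_nonneg (h.Tnn x hx) (le_max_right _ _))]
  have h2 : max (f x - LL a Ψ x) 0 ≤ |f x| + C := by
    apply max_le
    · linarith [le_abs_self (f x)]
    · positivity
  exact mul_le_mul (h.Tle x hx) h2 (le_max_right _ _) ((h.Tnn x hx).trans (h.Tle x hx))

lemma HBd.int2 (h : HBd Ω T a b CT CB) {Ψ : Eu N → ℝ} (hΨ : Continuous Ψ) :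
    Integrable (fun x => b x * Ψ x) (volume.restrict Ω) := by
  obtain ⟨C, hC, hL⟩ := bdd_on h.bdd hΨ
  have := h.fin
  refine Integrable.mono' (integrable_const (CB * C))
    (h.bm.mul hΨ.measurable).aestronglyMeasurable ?_
  rw [ae_restrict_iff' h.op.measurableSet]
  refine Eventually.of_forall fun x hx => ?_
  rw [norm_mul, Real.norm_of_nonneg (h.bnn x)]
  exact mul_le_mul (h.ble x) (hL x hx) (norm_nonneg _) ((h.bnn x).trans (h.ble x))

noncomputable def trm (Ω : Set (Eu N)) (T a b f Ψ : Eu N → ℝ) : ℝ :=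
  (∫ x in Ω, T x * max (f x - LL a Ψ x) 0) + ∫ x in Ω, b x * Ψ x

lemma LL_add {Ψ Φ : Eu N → ℝ} (h1 : ContDiff ℝ 2 Ψ) (h2 : ContDiff ℝ 2 Φ) (x : Eu N) :
    LL a (fun x => Ψ x + Φ x) x = LL a Ψ x + LL a Φ x := by
  unfold LL
  rw [lap_add h1.contDiffAt h2.contDiffAt]; ring

lemma LL_smul {Ψ : Eu N → ℝ} (h1 : ContDiff ℝ 2 Ψ) (c : ℝ) (x : Eu N) :
    LL a (fun x => c * Ψ x) x = c * LL a Ψ x := by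
  unfold LL
  rw [lap_cmul c h1.contDiffAt]; ring

lemma LL_zero (x : Eu N) : LL a (fun _ => 0) x = 0 := by
  unfold LL
  rw [lap_const]; ring

lemma HBd.trm_add (h : HBd Ω T a b CT CB) {f g : Eu N → ℝ}
    (hf : Integrable f (volume.restrict Ω)) (hg : Integrable g (volume.restrict Ω))
    {Ψ Φ : Eu N → ℝ} (hΨ : Adm Ω Ψ) (hΦ : Adm Ω Φ) :
    trm Ω T a b (fun x => f x + g x) (fun x => Ψ x + Φ x) ≤ trm Ω T a b f Ψ + trm Ω T a b g Φ := by
  unfold trm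
  have e1 : ∫ x in Ω, b x * (Ψ x + Φ x) = (∫ x in Ω, b x * Ψ x) + ∫ x in Ω, b x * Φ x := by
    rw [← integral_add (h.int2 hΨ.1.continuous) (h.int2 hΦ.1.continuous)]
    simp only [mul_add]
  have e2 : ∫ x in Ω, T x * max (f x + g x - LL a (fun x => Ψ x + Φ x) x) 0 ≤
      (∫ x in Ω, T x * max (f x - LL a Ψ x) 0) + ∫ x in Ω, T x * max (g x - LL a Φ x) 0 := by
    rw [← integral_add (h.int1 hf hΨ) (h.int1 hg hΦ)]
    refine setIntegral_mono_on (h.int1 (hf.add hg) (hΨ.add hΦ))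
      ((h.int1 hf hΨ).add (h.int1 hg hΦ)) h.op.measurableSet fun x hx => ?_
    simp only [← mul_add]
    refine mul_le_mul_of_nonneg_left ?_ (h.Tnn x hx)
    rw [LL_add hΨ.1 hΦ.1]
    apply max_le
    · linarith [le_max_left (f x - LL a Ψ x) 0, le_max_left (g x - LL a Φ x) 0]
    · linarith [le_max_right (f x - LL a Ψ x) 0, le_max_right (g x - LL a Φ x) 0]
  linarith

lemma trm_smul {f : Eu N → ℝ} {Ψ : Eu N → ℝ} (hΨ : Adm Ω Ψ) {c : ℝ} (hc : 0 ≤ c) :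
    trm Ω T a b (fun x => c * f x) (fun x => c * Ψ x) = c * trm Ω T a b f Ψ := by
  unfold trm
  rw [mul_add, ← integral_const_mul, ← integral_const_mul]
  congr 1
  · congr 1; ext x
    rw [LL_smul hΨ.1, ← mul_sub, show (0:ℝ) = c * 0 by ring, ← mul_max_of_nonneg _ _ hc, mul_zero]; ring
  · congr 1; ext x; ring

/-- The key weak maximum principle. -/
lemma HBd.trm_nonneg (h : HBd Ω T a b CT CB) {Ψ : Eu N → ℝ} (hΨ : Adm Ω Ψ) :
    0 ≤ trm Ω T a b (fun _ => 0) Ψ := by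
  obtain ⟨c1, K, s1, k1, p1⟩ := id hΨ
  have := h.fin
  have key : ∀ δ > (0:ℝ), -(∫ x in Ω, b x * Ψ x) - δ / 2 * ∫ x in Ω, b x * 1 ≤
      ∫ x in Ω, T x * max ((fun _ => (0:ℝ)) x - LL a Ψ x) 0 := by
    intro δ hδ
    classical
    set η : Eu N → ℝ := fun x => -Ψ x with hη
    have hηc : ContDiff ℝ 2 η := c1.neg
    have hcomp : ContDiff ℝ 2 (fun x => Ths δ (η x)) := (Ths_contDiff hδ).comp hηc
    set φ : Eu N → ℝ := indicator Ω (fun x => Ths δ (η x)) with hφ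
    have hzero : ∀ x ∉ K, φ x = 0 := by
      intro x hx
      by_cases hxΩ : x ∈ Ω
      · rw [hφ, indicator_of_mem hxΩ]
        apply Ths_zero hδ
        have := p1 x ⟨hxΩ, hx⟩
        simp only [hη]; linarith
      · simp [hφ, hxΩ]
    have hts : tsupport φ ⊆ K := by
      apply closure_minimal _ k1.isClosed
      intro x hx
      by_contra hxK
      exact hx (hzero x hxK)
    have hφc : ContDiff ℝ 2 φ := by
      rw [contDiff_iff_contDiffAt]
      intro x
      by_cases hxK : x ∈ K
      · refine hcomp.contDiffAt.congr_of_eventuallyEq ?_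
        filter_upwards [h.op.mem_nhds (s1 hxK)] with y hy
        simp [hφ, hy]
      · refine (contDiffAt_const (c := (0:ℝ))).congr_of_eventuallyEq ?_
        filter_upwards [k1.isClosed.isOpen_compl.mem_nhds hxK] with y hy
        exact hzero y hy
    have hφs : HasCompactSupport φ := k1.of_isClosed_subset (isClosed_tsupport _) hts
    have hG := green h.op h.Tcd hφc hφs (hts.trans s1)
    have hset : ∀ f : Eu N → ℝ, (∀ x ∉ Ω, f x = 0) → ∫ x, f x = ∫ x in Ω, f x := by
      intro f hf
      rw [setIntegral_eq_integral_of_forall_compl_eq_zero hf]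
    rw [hset _ ?_, hset _ ?_] at hG
    rotate_left
    · intro x hx
      rw [show φ x = 0 from hzero x fun hk => hx (s1 hk), mul_zero]
    · intro x hx
      rw [lap_zero_off (fun hk => hx (s1 (hts hk))), mul_zero]
    have hTφ : Integrable (fun x => T x * laplacian φ x) (volume.restrict Ω) :=
      (mul_cs_int h.op h.Tcd.continuousOn (lap_continuous hφc).continuousOn
        ((tsupport_lap).trans (hts.trans s1)) (hcs_of_tsupport hφs tsupport_lap)).integrableOn
    have hTφ2 : Integrable (fun x => laplacian T x * φ x) (volume.restrict Ω) :=
      (mul_cs_int h.op (lap_cont h.op h.Tcd) hφc.continuous.continuousOn (hts.trans s1) hφs).integrableOn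
    have hb1 : -(∫ x in Ω, b x * Ψ x) - δ / 2 * ∫ x in Ω, b x * 1 ≤
        ∫ x in Ω, -(laplacian T x * φ x) := by
      have i1 : Integrable (fun x => -(b x * Ψ x)) (volume.restrict Ω) := (h.int2 c1.continuous).neg
      have i2 : Integrable (fun x => δ / 2 * (b x * 1)) (volume.restrict Ω) :=
        (h.int2 continuous_const).const_mul _
      rw [← integral_neg, ← integral_const_mul, ← integral_sub i1 i2]
      refine setIntegral_mono_on (i1.sub i2) hTφ2.neg h.op.measurableSet fun x hx => ?_
      have h1 : φ x = Ths δ (η x) := by simp [hφ, hx]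
      have h2 := Ths_ge hδ (η x)
      have h3 := le_max_left (η x) 0
      have h4 : η x = -Ψ x := rfl
      have h5 := Ths_nonneg hδ (η x)
      have h6 := mul_le_mul_of_nonneg_right (h.bT x hx) h5
      have h7 : b x * (η x - δ/2) ≤ b x * Ths δ (η x) :=
        mul_le_mul_of_nonneg_left (by linarith) (h.bnn x)
      rw [h1]
      rw [h4] at *
      linarith
    refine hb1.trans ?_
    rw [integral_neg, ← hG, ← integral_neg]
    refine setIntegral_mono_on hTφ.neg (h.int1 (integrable_zero _ _ _) hΨ) h.op.measurableSet
      fun x hx => ?_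
    have h1 : laplacian φ x = laplacian (fun y => Ths δ (η y)) x := by
      apply lap_congr
      filter_upwards [h.op.mem_nhds hx] with y hy
      simp [hφ, hy]
    rw [h1, lap_Ths hδ hηc.contDiffAt, ← mul_neg]
    refine mul_le_mul_of_nonneg_left ?_ (h.Tnn x hx)
    have h2 : 0 ≤ Th2 (η x/δ)/δ * gradSq η x :=
      mul_nonneg (div_nonneg (Th2_nonneg _) hδ.le) (gradSq_nonneg)
    have h3 : laplacian η x = - laplacian Ψ x := lap_neg c1.contDiffAt
    rw [h3]
    by_cases hpos : 0 < η x
    · have h4 := Th1_nonneg (η x/δ)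
      have h5 := Th1_le_one (η x/δ)
      have h6 : laplacian Ψ x ≤ max (0 - LL a Ψ x) 0 := by
        refine le_trans ?_ (le_max_left _ _)
        have := mul_nonneg (h.ann x) hpos.le
        simp only [hη, LL] at this ⊢
        linarith
      have h7 := le_max_right (0 - LL a Ψ x) 0
      nlinarith
    · have h4 : Th1 (η x / δ) = 0 := (Th_neg (div_nonpos_of_nonpos_of_nonneg (not_lt.1 hpos) hδ.le)).2.1
      rw [h4]
      have h7 := le_max_right (0 - LL a Ψ x) 0
      linarith
  unfold trm
  have hlim : Tendsto (fun δ : ℝ => -(∫ x in Ω, b x * Ψ x) - δ / 2 * ∫ x in Ω, b x * 1) (𝓝[>] 0)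
      (𝓝 (-(∫ x in Ω, b x * Ψ x) - 0 / 2 * ∫ x in Ω, b x * 1)) := by
    apply Tendsto.mono_left _ nhdsWithin_le_nhds
    exact (Continuous.tendsto (by fun_prop) 0)
  have := le_of_tendsto hlim (by filter_upwards [self_mem_nhdsWithin] with δ hδ using key δ hδ)
  linarith

end HB

section HB2
variable {N : ℕ} {Ω : Set (Eu N)} {T a b : Eu N → ℝ} {CT CB : ℝ}

lemma trm_congr {f g : Eu N → ℝ} (hfg : f =ᵐ[volume.restrict Ω] g) (Ψ : Eu N → ℝ) :
    trm Ω T a b f Ψ = trm Ω T a b g Ψ := by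
  unfold trm
  congr 1
  apply integral_congr_ae
  filter_upwards [hfg] with x hx
  rw [hx]

noncomputable def pp (Ω : Set (Eu N)) (T a b : Eu N → ℝ) (f : Eu N → ℝ) : ℝ :=
  ⨅ Ψ : {Ψ : Eu N → ℝ // Adm Ω Ψ}, trm Ω T a b f Ψ.1

lemma pp_congr {f g : Eu N → ℝ} (hfg : f =ᵐ[volume.restrict Ω] g) :
    pp Ω T a b f = pp Ω T a b g := by
  unfold pp
  congr 1; ext Ψ; exact trm_congr hfg _

instance : Nonempty {Ψ : Eu N → ℝ // Adm Ω Ψ} := ⟨⟨_, Adm.zero⟩⟩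

lemma HBd.pp_bdd (h : HBd Ω T a b CT CB) {f : Eu N → ℝ} (hf : Integrable f (volume.restrict Ω)) :
    BddBelow (range fun Ψ : {Ψ : Eu N → ℝ // Adm Ω Ψ} => trm Ω T a b f Ψ.1) := by
  refine ⟨-trm Ω T a b (fun x => -f x) (fun _ => 0), ?_⟩
  rintro _ ⟨Ψ, rfl⟩
  have h1 := h.trm_add hf hf.neg Ψ.2 Adm.zero
  have h2 := h.trm_nonneg Ψ.2
  simp only [add_zero, Pi.neg_apply, add_neg_cancel] at h1
  have h3 : trm Ω T a b (-f) (fun _ => 0) = trm Ω T a b (fun x => -f x) (fun _ => 0) := rfl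
  simp only
  linarith

lemma HBd.pp_le (h : HBd Ω T a b CT CB) {f : Eu N → ℝ} (hf : Integrable f (volume.restrict Ω))
    {Ψ : Eu N → ℝ} (hΨ : Adm Ω Ψ) : pp Ω T a b f ≤ trm Ω T a b f Ψ :=
  ciInf_le (h.pp_bdd hf) (⟨Ψ, hΨ⟩ : {Ψ : Eu N → ℝ // Adm Ω Ψ})

lemma HBd.pp_add (h : HBd Ω T a b CT CB) {f g : Eu N → ℝ} (hf : Integrable f (volume.restrict Ω))
    (hg : Integrable g (volume.restrict Ω)) :
    pp Ω T a b (fun x => f x + g x) ≤ pp Ω T a b f + pp Ω T a b g := by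
  have : ∀ Ψ Φ : {Ψ : Eu N → ℝ // Adm Ω Ψ}, pp Ω T a b (fun x => f x + g x) ≤
      trm Ω T a b f Ψ.1 + trm Ω T a b g Φ.1 := fun Ψ Φ =>
    (h.pp_le (hf.add hg) (Ψ.2.add Φ.2)).trans (h.trm_add hf hg Ψ.2 Φ.2)
  exact le_ciInf_add_ciInf this

lemma HBd.pp_smul_le (h : HBd Ω T a b CT CB) {f : Eu N → ℝ}
    (hf : Integrable f (volume.restrict Ω)) {c : ℝ} (hc : 0 < c) :
    pp Ω T a b (fun x => c * f x) ≤ c * pp Ω T a b f := by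
  unfold pp
  rw [Real.mul_iInf_of_nonneg hc.le]
  refine le_ciInf fun Ψ => ?_
  rw [← trm_smul Ψ.2 hc.le]
  exact h.pp_le (hf.const_mul c) (Ψ.2.smul hc.le)

lemma HBd.pp_smul (h : HBd Ω T a b CT CB) {f : Eu N → ℝ}
    (hf : Integrable f (volume.restrict Ω)) {c : ℝ} (hc : 0 < c) :
    pp Ω T a b (fun x => c * f x) = c * pp Ω T a b f := by
  apply le_antisymm (h.pp_smul_le hf hc)
  have := h.pp_smul_le (hf.const_mul c) (inv_pos.2 hc)
  simp only [inv_mul_cancel_left₀ hc.ne'] at this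
  calc c * pp Ω T a b f ≤ c * (c⁻¹ * pp Ω T a b (fun x => c * f x)) := by gcongr
    _ = _ := by field_simp

lemma HBd.exists_L2 (h : HBd Ω T a b CT CB) : ∃ g : Lp ℝ 2 (volume.restrict Ω),
    ∀ f : Eu N → ℝ, MemLp f 2 (volume.restrict Ω) → ∀ Ψ, Adm Ω Ψ →
      ∫ x in Ω, g x * f x ≤ trm Ω T a b f Ψ := by
  have hfin := h.fin
  set μ := volume.restrict Ω with hμ
  have hitg : ∀ f : Lp ℝ 2 μ, Integrable f μ := fun f => (Lp.memLp f).integrable (by norm_num)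
  have n1 : ∀ c : ℝ, 0 < c → ∀ f : Lp ℝ 2 μ, pp Ω T a b (c • f : Lp ℝ 2 μ) = c * pp Ω T a b f := by
    intro c hc f
    show pp Ω T a b (c • f : Lp ℝ 2 μ) = c * pp Ω T a b f
    rw [← h.pp_smul (hitg f) hc]
    apply pp_congr
    filter_upwards [Lp.coeFn_smul c f] with x hx
    rw [hx]; simp
  have n2 : ∀ f g : Lp ℝ 2 μ, pp Ω T a b (f + g : Lp ℝ 2 μ) ≤ pp Ω T a b f + pp Ω T a b g := by
    intro f g
    show pp Ω T a b (f + g : Lp ℝ 2 μ) ≤ pp Ω T a b f + pp Ω T a b g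
    refine le_trans (le_of_eq ?_) (h.pp_add (hitg f) (hitg g))
    apply pp_congr
    filter_upwards [Lp.coeFn_add f g] with x hx
    rw [hx]; simp
  have n3 : (0:ℝ) ≤ pp Ω T a b (0 : Lp ℝ 2 μ) := by
    rw [pp_congr (g := fun _ => 0) (by
      filter_upwards [Lp.coeFn_zero ℝ 2 μ] with x hx; rw [hx]; rfl)]
    exact le_ciInf fun Ψ => h.trm_nonneg Ψ.2
  obtain ⟨l, -, hl⟩ := exists_extension_of_le_sublinear (E := Lp ℝ 2 μ) ⟨⊥, 0⟩
    (fun f => pp Ω T a b f) n1 n2 (by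
      rintro ⟨x, hx⟩
      have hx0 : x = 0 := by simpa using hx
      subst hx0
      exact n3)
  have hCT : 0 ≤ |CT| := abs_nonneg _
  set τ : Lp ℝ 2 μ := MemLp.toLp (fun _ => |CT|) (memLp_const |CT|) with hτ
  have hbd : ∀ f, l f ≤ ‖τ‖ * ‖f‖ := by
    intro f
    refine (hl f).trans ?_
    refine (h.pp_le (hitg f) Adm.zero).trans ?_
    have h1 : inner ℝ τ |f| ≤ ‖τ‖ * ‖f‖ := by
      have := real_inner_le_norm τ |f|
      rwa [norm_abs_eq_norm] at this
    refine le_trans ?_ h1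
    rw [L2.inner_def]
    unfold trm
    simp only [mul_zero, integral_zero, add_zero]
    refine integral_mono_ae (h.int1 (hitg f) Adm.zero) (L2.integrable_inner _ _) ?_
    filter_upwards [Lp.coeFn_abs f, MemLp.coeFn_toLp (memLp_const (μ := μ) (p := 2) |CT|),
      ae_restrict_mem h.op.measurableSet] with x h1 h2 h3
    rw [h1, hτ, h2, LL_zero]
    simp only [sub_zero, RCLike.inner_apply, conj_trivial]
    rw [mul_comm |f x|]
    exact mul_le_mul ((h.Tle x h3).trans (le_abs_self _)) (max_le (le_abs_self _) (abs_nonneg _))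
      (le_max_right _ _) hCT
  have hbd2 : ∀ f, ‖l f‖ ≤ ‖τ‖ * ‖f‖ := by
    intro f
    rw [Real.norm_eq_abs, abs_le]
    constructor
    · have := hbd (-f)
      rw [map_neg, norm_neg] at this
      linarith
    · exact hbd f
  set lc := l.mkContinuous _ hbd2 with hlc
  refine ⟨(InnerProductSpace.toDual ℝ (Lp ℝ 2 μ)).symm lc, fun f hf Ψ hΨ => ?_⟩
  set g := (InnerProductSpace.toDual ℝ (Lp ℝ 2 μ)).symm lc with hg
  have h1 : inner ℝ g (hf.toLp f) = lc (hf.toLp f) := InnerProductSpace.toDual_symm_apply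
  have h2 : lc (hf.toLp f) ≤ trm Ω T a b f Ψ := by
    refine (hl _).trans ?_
    refine (h.pp_le (hitg _) hΨ).trans (le_of_eq (trm_congr (hf.coeFn_toLp) Ψ))
  rw [← h1, L2.inner_def] at h2
  refine le_trans (le_of_eq ?_) h2
  apply integral_congr_ae
  filter_upwards [hf.coeFn_toLp] with x hx
  rw [hx]
  simp [mul_comm]

lemma HBd.memLp (h : HBd Ω T a b CT CB) {f : Eu N → ℝ} (hm : Measurable f) {C : ℝ}
    (hC : ∀ x ∈ Ω, |f x| ≤ C) : MemLp f 2 (volume.restrict Ω) := by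
  have := h.fin
  refine MemLp.of_bound hm.aestronglyMeasurable C ?_
  filter_upwards [ae_restrict_mem h.op.measurableSet] with x hx using hC x hx

lemma HBd.exists_g (h : HBd Ω T a b CT CB) : ∃ g : Eu N → ℝ, Measurable g ∧
    (∀ x ∈ Ω, 0 ≤ g x ∧ g x ≤ T x) ∧ (∀ x ∉ Ω, g x = 0) ∧
    ∀ f : Eu N → ℝ, MemLp f 2 (volume.restrict Ω) → ∀ Ψ, Adm Ω Ψ →
      ∫ x in Ω, g x * f x ≤ trm Ω T a b f Ψ := by
  obtain ⟨g, hg⟩ := h.exists_L2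
  have hfin := h.fin
  have hgi : Integrable g (volume.restrict Ω) := (Lp.memLp g).integrable (by norm_num)
  have hTi : Integrable T (volume.restrict Ω) := by
    refine Integrable.of_bound h.Tm CT ?_
    filter_upwards [ae_restrict_mem h.op.measurableSet] with x hx
    rw [Real.norm_of_nonneg (h.Tnn x hx)]
    exact h.Tle x hx
  have hnn : 0 ≤ᵐ[volume.restrict Ω] g := by
    refine ae_nonneg_of_forall_setIntegral_nonneg hgi fun s hs _ => ?_
    have := hg (indicator s fun _ => -1) (h.memLp (C := 1) (measurable_const.indicator hs)
      (fun x _ => by by_cases hx : x ∈ s <;> simp [hx])) _ Adm.zero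
    unfold trm at this
    have e1 : ∀ x, max (s.indicator (fun _ => (-1:ℝ)) x - LL a (fun _ => 0) x) 0 = 0 := by
      intro x; rw [LL_zero]; by_cases hx : x ∈ s <;> simp [hx]
    simp only [e1, mul_zero, integral_zero, add_zero] at this
    have e2 : ∀ x, g x * s.indicator (fun _ => (-1:ℝ)) x = - s.indicator g x := by
      intro x; by_cases hx : x ∈ s <;> simp [hx]
    simp only [e2, integral_neg, integral_indicator hs] at this
    linarith
  have hle : g ≤ᵐ[volume.restrict Ω] T := by
    refine ae_le_of_forall_setIntegral_le hgi hTi fun s hs _ => ?_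
    have := hg (indicator s fun _ => 1) (h.memLp (C := 1) (measurable_const.indicator hs)
      (fun x _ => by by_cases hx : x ∈ s <;> simp [hx])) _ Adm.zero
    unfold trm at this
    have e1 : ∀ x, T x * max (s.indicator (fun _ => (1:ℝ)) x - LL a (fun _ => 0) x) 0 =
        s.indicator T x := by
      intro x; rw [LL_zero]; by_cases hx : x ∈ s <;> simp [hx]
    have e2 : ∀ x, g x * s.indicator (fun _ => (1:ℝ)) x = s.indicator g x := by
      intro x; by_cases hx : x ∈ s <;> simp [hx]
    simp only [e1, e2, mul_zero, integral_zero, add_zero, integral_indicator hs] at this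
    exact this
  have hgm := (Lp.aestronglyMeasurable g)
  set g1 : Eu N → ℝ := fun x => max 0 (min (hgm.mk g x) (indicator Ω T x)) with hg1
  have hm1 : Measurable g1 := measurable_const.max
    (hgm.stronglyMeasurable_mk.measurable.min (meas_indicator h.op h.Tcd.continuousOn))
  have hae : g1 =ᵐ[volume.restrict Ω] g := by
    filter_upwards [hnn, hle, hgm.ae_eq_mk, ae_restrict_mem h.op.measurableSet] with x h1 h2 h3 h4
    simp only [hg1, indicator_of_mem h4, ← h3]
    rw [min_eq_left h2]
    exact max_eq_right h1
  refine ⟨g1, hm1, fun x hx => ⟨le_max_left _ _, ?_⟩, fun x hx => ?_, fun f hf Ψ hΨ => ?_⟩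
  · simp only [hg1, indicator_of_mem hx]
    exact max_le (h.Tnn x hx) (min_le_right _ _)
  · simp [hg1, hx]
  · refine le_trans (le_of_eq ?_) (hg f hf Ψ hΨ)
    apply integral_congr_ae
    filter_upwards [hae] with x hx
    rw [hx]

end HB2

lemma fatou_int {α : Type*} [MeasurableSpace α] {μ : Measure α} {f : ℕ → α → ℝ} {g : α → ℝ}
    (hf : ∀ n, Integrable (f n) μ) (hnn : ∀ n, 0 ≤ᵐ[μ] f n)
    (hlim : ∀ᵐ x ∂μ, Tendsto (fun n => f n x) atTop (𝓝 (g x))) {C : ℝ} (hC : ∀ n, ∫ x, f n x ∂μ ≤ C) :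
    Integrable g μ ∧ ∫ x, g x ∂μ ≤ C := by
  have hgm : AEStronglyMeasurable g μ :=
    aestronglyMeasurable_of_tendsto_ae atTop (fun n => (hf n).aestronglyMeasurable) hlim
  have hC0 : 0 ≤ C := (integral_nonneg_of_ae (hnn 0)).trans (hC 0)
  have hgnn : 0 ≤ᵐ[μ] g := by
    filter_upwards [hlim, ae_all_iff.2 hnn] with x h1 h2
    exact ge_of_tendsto' h1 h2
  have hl : ∫⁻ x, ENNReal.ofReal (g x) ∂μ ≤ ENNReal.ofReal C := by
    calc ∫⁻ x, ENNReal.ofReal (g x) ∂μ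
        = ∫⁻ x, liminf (fun n => ENNReal.ofReal (f n x)) atTop ∂μ := by
          apply lintegral_congr_ae
          filter_upwards [hlim] with x hx
          exact ((ENNReal.continuous_ofReal.tendsto _).comp hx).liminf_eq.symm
      _ ≤ liminf (fun n => ∫⁻ x, ENNReal.ofReal (f n x) ∂μ) atTop :=
          lintegral_liminf_le' fun n => (hf n).aestronglyMeasurable.aemeasurable.ennreal_ofReal
      _ ≤ ENNReal.ofReal C := by
          apply liminf_le_of_le
          · isBoundedDefault
          · intro b hb
            obtain ⟨n, hn⟩ := hb.exists
            refine hn.trans ?_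
            rw [← ofReal_integral_eq_lintegral_ofReal (hf n) (hnn n)]
            exact ENNReal.ofReal_le_ofReal (hC n)
  have hgi : Integrable g μ := by
    refine ⟨hgm, ?_⟩
    rw [hasFiniteIntegral_iff_ofReal hgnn]
    exact hl.trans_lt ENNReal.ofReal_lt_top
  refine ⟨hgi, ?_⟩
  rw [← ofReal_integral_eq_lintegral_ofReal hgi hgnn] at hl
  exact (ENNReal.ofReal_le_ofReal_iff hC0).1 hl

section
variable {N : ℕ} {Ω : Set (Eu N)} {T a b : Eu N → ℝ} {CT CB : ℝ}

lemma HBd.exists_g2 (h : HBd Ω T a b CT CB) : ∃ g : Eu N → ℝ, Measurable g ∧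
    (∀ x ∈ Ω, 0 ≤ g x ∧ g x ≤ T x) ∧ (∀ x ∉ Ω, g x = 0) ∧
    Integrable (fun x => a x * g x) (volume.restrict Ω) ∧
    ∀ Ψ, Adm Ω Ψ → ∫ x in Ω, a x * g x * Ψ x ≤ (∫ x in Ω, b x * Ψ x) +
      ∫ x in Ω, g x * laplacian Ψ x := by
  obtain ⟨g, hgm, hgb, hg0, hg⟩ := h.exists_g
  have hfin := h.fin
  have gint : ∀ f : Eu N → ℝ, Measurable f → ∀ C, (∀ x ∈ Ω, |f x| ≤ C) →
      Integrable (fun x => g x * f x) (volume.restrict Ω) := by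
    intro f hf C hC
    refine Integrable.of_bound (hgm.mul hf).aestronglyMeasurable (CT * C) ?_
    filter_upwards [ae_restrict_mem h.op.measurableSet] with x hx
    rw [norm_mul, Real.norm_of_nonneg (hgb x hx).1]
    have h1 := (hgb x hx).2.trans (h.Tle x hx)
    exact mul_le_mul h1 (hC x hx) (norm_nonneg _) ((hgb x hx).1.trans h1)
  have key : ∀ Ψ, Adm Ω Ψ → ∀ᶠ n : ℕ in atTop, ∫ x in Ω, g x * (min (a x) n * Ψ x) ≤
      (∫ x in Ω, b x * Ψ x) + ∫ x in Ω, g x * laplacian Ψ x := by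
    intro Ψ hΨ
    obtain ⟨c1, K, s1, k1, p1⟩ := id hΨ
    obtain ⟨M, hM, ha⟩ := h.aloc K k1 s1
    obtain ⟨C1, hC1, hl⟩ := bdd_on h.bdd (lap_continuous c1)
    obtain ⟨C2, hC2, hp⟩ := bdd_on h.bdd c1.continuous
    filter_upwards [eventually_ge_atTop (Nat.ceil M)] with n hn
    have hn' : M ≤ n := Nat.ceil_le.1 hn
    have m1 : Measurable (fun x => min (a x) n * Ψ x) :=
      (h.am.min measurable_const).mul c1.continuous.measurable
    have bd1 : ∀ x ∈ Ω, |min (a x) n * Ψ x| ≤ n * C2 := by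
      intro x hx
      rw [abs_mul, abs_of_nonneg (le_min (h.ann x) (Nat.cast_nonneg n))]
      exact mul_le_mul (min_le_right _ _) (hp x hx) (abs_nonneg _) (Nat.cast_nonneg n)
    have m2 := (lap_continuous c1).measurable
    have := hg (fun x => -laplacian Ψ x + min (a x) n * Ψ x)
      (h.memLp (C := C1 + n * C2) (m2.neg.add m1)
        (fun x hx => (abs_add_le _ _).trans (add_le_add (by rw [abs_neg]; exact hl x hx) (bd1 x hx)))) Ψ hΨ
    have e1 : ∫ x in Ω, T x * max (-laplacian Ψ x + min (a x) n * Ψ x - LL a Ψ x) 0 = 0 := by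
      refine (setIntegral_congr_fun (g := fun _ => (0:ℝ)) h.op.measurableSet fun x hx => ?_).trans
        (by simp)
      have : -laplacian Ψ x + min (a x) n * Ψ x - LL a Ψ x ≤ 0 := by
        unfold LL
        by_cases hxK : x ∈ K
        · rw [min_eq_left ((ha x hxK).trans hn')]; linarith
        · have := mul_le_mul_of_nonneg_right (min_le_left (a x) n) (p1 x ⟨hx, hxK⟩)
          linarith
      show T x * max (-laplacian Ψ x + min (a x) n * Ψ x - LL a Ψ x) 0 = 0
      rw [max_eq_right this, mul_zero]
    unfold trm at this
    rw [e1] at this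
    have e2 : ∫ x in Ω, g x * (-laplacian Ψ x + min (a x) n * Ψ x) =
        -(∫ x in Ω, g x * laplacian Ψ x) + ∫ x in Ω, g x * (min (a x) n * Ψ x) := by
      have i1 : Integrable (fun x => -(g x * laplacian Ψ x)) (volume.restrict Ω) :=
        (gint _ m2 C1 hl).neg
      rw [← integral_neg, ← integral_add i1 (gint _ m1 _ bd1)]
      congr 1; ext x; ring
    rw [e2] at this
    linarith
  have hlim : ∀ x, Tendsto (fun n : ℕ => min (a x) n) atTop (𝓝 (a x)) := by
    intro x
    refine tendsto_const_nhds.congr' ?_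
    filter_upwards [eventually_ge_atTop (Nat.ceil (a x))] with n hn
    rw [min_eq_left (Nat.ceil_le.1 hn)]
  have hone : Adm Ω (fun _ => (1:ℝ)) := ⟨contDiff_const, ∅, by simp, isCompact_empty, by simp⟩
  have hag : Integrable (fun x => a x * g x) (volume.restrict Ω) := by
    obtain ⟨n0, hn0⟩ := eventually_atTop.1 (key _ hone)
    refine (fatou_int (f := fun n x => g x * min (a x) (n + n0 : ℕ)) ?_ ?_ ?_
      (C := (∫ x in Ω, b x * 1) + ∫ x in Ω, g x * laplacian (fun _ => (1:ℝ)) x) ?_).1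
    · intro n
      exact gint _ (h.am.min measurable_const) (n + n0 : ℕ) (fun x _ => by
        rw [abs_of_nonneg (le_min (h.ann x) (Nat.cast_nonneg _))]; exact min_le_right _ _)
    · intro n
      filter_upwards [ae_restrict_mem h.op.measurableSet] with x hx
      exact mul_nonneg (hgb x hx).1 (le_min (h.ann x) (Nat.cast_nonneg _))
    · refine Eventually.of_forall fun x => ?_
      rw [mul_comm (a x)]
      exact ((hlim x).comp (tendsto_add_atTop_nat n0)).const_mul _
    · intro n
      have := hn0 (n + n0) (by omega)
      simpa only [mul_one] using this
  refine ⟨g, hgm, hgb, hg0, hag, fun Ψ hΨ => ?_⟩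
  obtain ⟨C2, hC2, hp⟩ := bdd_on h.bdd hΨ.1.continuous
  refine le_of_tendsto (f := fun n : ℕ => ∫ x in Ω, g x * (min (a x) n * Ψ x)) (x := atTop) ?_ (key Ψ hΨ)
  refine tendsto_integral_of_dominated_convergence (fun x => a x * g x * C2) ?_
    (hag.mul_const C2) ?_ ?_
  · intro n
    exact (hgm.mul ((h.am.min measurable_const).mul hΨ.1.continuous.measurable)).aestronglyMeasurable
  · intro n
    filter_upwards [ae_restrict_mem h.op.measurableSet] with x hx
    rw [norm_mul, norm_mul, Real.norm_of_nonneg (hgb x hx).1,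
      Real.norm_of_nonneg (le_min (h.ann x) (Nat.cast_nonneg _))]
    have := mul_le_mul (min_le_left (a x) n) (hp x hx) (abs_nonneg _) (h.ann x)
    have := mul_le_mul_of_nonneg_left this (hgb x hx).1
    rw [Real.norm_eq_abs]
    linarith
  · refine Eventually.of_forall fun x => ?_
    have := ((hlim x).mul_const (Ψ x)).const_mul (g x)
    convert this using 2
    ring

end

section quad
variable {N : ℕ}

lemma normSq_eq (x : Eu N) : ‖x‖^2 = ∑ i, (x i)^2 := by
  rw [EuclideanSpace.norm_sq_eq]; simp

lemma coord_contDiff (i : Fin N) {n : WithTop ℕ∞} : ContDiff ℝ n (fun y : Eu N => y i) :=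
  (EuclideanSpace.proj i : Eu N →L[ℝ] ℝ).contDiff

lemma pd_coord (i j : Fin N) (x : Eu N) : pd i (fun y : Eu N => y j) x = if i = j then 1 else 0 := by
  unfold pd
  have : (fun y : Eu N => y j) = (EuclideanSpace.proj j : Eu N →L[ℝ] ℝ) := by ext; simp
  rw [this, ContinuousLinearMap.fderiv]
  simp [ee, eq_comm, Pi.single_apply]

/-- the quadratic `c - s * |y-z|^2`. -/
noncomputable def qd (c s : ℝ) (z y : Eu N) : ℝ := c - s * ‖y - z‖^2

lemma qd_contDiff (c s : ℝ) (z : Eu N) : ContDiff ℝ 2 (qd c s z) := by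
  unfold qd
  exact contDiff_const.sub (contDiff_const.mul ((contDiff_id.sub contDiff_const).norm_sq ℝ))

lemma pd_qd (c s : ℝ) (z y : Eu N) (i : Fin N) : pd i (qd c s z) y = -2 * s * (y i - z i) := by
  unfold pd
  have h1 : HasFDerivAt (fun y : Eu N => ‖y - z‖^2) (2 • (innerSL ℝ (y - z)).comp (ContinuousLinearMap.id ℝ (Eu N))) y := by
    exact ((hasFDerivAt_id y).sub_const z).norm_sq
  have h2 := ((h1.const_mul s).const_sub c).fderiv
  unfold qd
  rw [h2]
  simp [ee, EuclideanSpace.inner_single_right]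
  ring

lemma gradSq_qd (c s : ℝ) (z y : Eu N) : gradSq (qd c s z) y = 4 * s^2 * ‖y - z‖^2 := by
  unfold gradSq
  rw [normSq_eq, Finset.mul_sum]
  refine Finset.sum_congr rfl fun i _ => ?_
  rw [pd_qd]; simp; ring

lemma lap_qd (c s : ℝ) (z y : Eu N) : laplacian (qd c s z) y = -2 * N * s := by
  rw [lap_eq (qd_contDiff c s z).contDiffAt]
  have : ∀ i, pd i (pd i (qd c s z)) y = -2 * s := by
    intro i
    have e : pd i (qd c s z) = fun y => -2 * s * (y i - z i) := funext fun y => pd_qd c s z y i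
    rw [e, pd_cmul (u := fun y : Eu N => y i - z i) _ (((coord_contDiff i (n := 2)).differentiable (by norm_num)).differentiableAt.sub_const _),
      pd_sub (v := fun _ => z i) ((coord_contDiff i (n := 2)).differentiable (by norm_num)).differentiableAt (differentiableAt_const _),
      pd_coord, pd_const]
    simp
  simp [this]; ring

lemma pw_contDiff (k : ℕ) : ContDiff ℝ 2 (pw (k + 3)) := by
  refine contDiff_two_of (f' := fun t => (((k + 1 : ℕ) : ℝ) + 2) * pw (k + 1 + 1) t)
    (f'' := fun t => (((k + 1 : ℕ) : ℝ) + 2) * (((k : ℝ) + 2) * pw (k + 1) t))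
    (fun t => pw_hasDerivAt (k + 1) t) (fun t => (pw_hasDerivAt k t).const_mul _)
    (((pw_continuous _).const_mul _).const_mul _)

lemma lap_pw (k : ℕ) (c s : ℝ) (z y : Eu N) :
    laplacian (fun y => pw (k + 3) (qd c s z y)) y =
      (k + 3) * (k + 2) * pw (k + 1) (qd c s z y) * (4 * s^2 * ‖y - z‖^2)
       - 2 * N * s * (k + 3) * pw (k + 2) (qd c s z y) := by
  rw [lap_comp (f' := fun t => (((k + 1 : ℕ) : ℝ) + 2) * pw (k + 1 + 1) t)
    (f'' := fun t => (((k + 1 : ℕ) : ℝ) + 2) * (((k : ℝ) + 2) * pw (k + 1) t)) (pw_contDiff k)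
    (fun t => pw_hasDerivAt (k + 1) t) (fun t => (pw_hasDerivAt k t).const_mul _)
    (qd_contDiff c s z).contDiffAt, gradSq_qd, lap_qd]
  push_cast
  ring

lemma pd_pw (k : ℕ) (c s : ℝ) (z y : Eu N) (i : Fin N) :
    pd i (fun y => pw (k + 2) (qd c s z y)) y = -2 * s * (k + 2) * (y i - z i) * pw (k + 1) (qd c s z y) := by
  rw [pd_comp (pw_hasDerivAt k _) ((qd_contDiff c s z).differentiable (by norm_num)).differentiableAt,
    pd_qd]
  ring

end quad

section flux
variable {N : ℕ} {Ω : Set (Eu N)} {U : ℕ → Eu N → ℝ} {V : Eu N → ℝ} {B : ℝ}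

lemma ind_contDiff (hΩ : IsOpen Ω) {f : Eu N → ℝ} (hf : ContDiffOn ℝ 2 f Ω) {K : Set (Eu N)}
    (hK : IsCompact K) (hKΩ : K ⊆ Ω) (h0 : ∀ x ∈ Ω \ K, f x = 0) :
    ContDiff ℝ 2 (indicator Ω f) ∧ tsupport (indicator Ω f) ⊆ K ∧
      HasCompactSupport (indicator Ω f) := by
  have hzero : ∀ x ∉ K, indicator Ω f x = 0 := by
    intro x hx
    by_cases hxΩ : x ∈ Ω
    · rw [indicator_of_mem hxΩ]; exact h0 x ⟨hxΩ, hx⟩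
    · simp [hxΩ]
  have hts : tsupport (indicator Ω f) ⊆ K := by
    apply closure_minimal _ hK.isClosed
    intro x hx
    by_contra hxK
    exact hx (hzero x hxK)
  refine ⟨?_, hts, hK.of_isClosed_subset (isClosed_tsupport _) hts⟩
  rw [contDiff_iff_contDiffAt]
  intro x
  by_cases hxK : x ∈ K
  · refine (hf.contDiffAt (hΩ.mem_nhds (hKΩ hxK))).congr_of_eventuallyEq ?_
    filter_upwards [hΩ.mem_nhds (hKΩ hxK)] with y hy
    simp [hy]
  · refine (contDiffAt_const (c := (0:ℝ))).congr_of_eventuallyEq ?_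
    filter_upwards [hK.isClosed.isOpen_compl.mem_nhds hxK] with y hy
    exact hzero y hy

lemma lap_ind (hΩ : IsOpen Ω) {f : Eu N → ℝ} {x : Eu N} (hx : x ∈ Ω) :
    laplacian (indicator Ω f) x = laplacian f x := by
  apply lap_congr
  filter_upwards [hΩ.mem_nhds hx] with y hy
  simp [hy]

variable {T b : Eu N → ℝ} {CT CB : ℝ}

lemma flux (h : Sys Ω U V B) (hb : HBd Ω T (fun x => Real.exp (WW Ω U x)) b CT CB)
    {Kb : Set (Eu N)} (hKb : IsCompact Kb) (hKbΩ : Kb ⊆ Ω) (hb0 : ∀ x ∉ Kb, b x = 0)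
    {g : Eu N → ℝ} (hgm : Measurable g) (hgb : ∀ x ∈ Ω, 0 ≤ g x ∧ g x ≤ T x)
    (hag : Integrable (fun x => Real.exp (WW Ω U x) * g x) (volume.restrict Ω))
    (hg : ∀ Ψ, Adm Ω Ψ → ∫ x in Ω, Real.exp (WW Ω U x) * g x * Ψ x ≤ (∫ x in Ω, b x * Ψ x) +
      ∫ x in Ω, g x * laplacian Ψ x) :
    Integrable (fun x => Real.exp (WW Ω U x) * g x * (WW Ω U x + B)) (volume.restrict Ω) ∧
    ∀ φ, ContDiff ℝ 2 φ → HasCompactSupport φ →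
      ∫ x in Ω, g x * laplacian φ x =
        (∫ x in Ω, Real.exp (WW Ω U x) * g x * φ x) - ∫ x in Ω, b x * φ x := by
  have hfin := hb.fin
  set μ := volume.restrict Ω with hμ
  set ag : Eu N → ℝ := fun x => Real.exp (WW Ω U x) * g x with hagd
  have hagnn : ∀ x ∈ Ω, 0 ≤ ag x := fun x hx => mul_nonneg (Real.exp_pos _).le (hgb x hx).1
  set P := ∫ x in Ω, b x * 1 with hP
  set A := ∫ x in Ω, ag x with hA
  have hone : Adm Ω (fun _ => (1:ℝ)) := ⟨contDiff_const, ∅, by simp, isCompact_empty, by simp⟩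
  have hAP : A ≤ P := by
    have := hg _ hone
    simpa only [mul_one, lap_const, mul_zero, integral_zero, add_zero, hP, hA] using this
  have hA0 : 0 ≤ A := setIntegral_nonneg h.op.measurableSet hagnn
  have bint : ∀ f : Eu N → ℝ, ContinuousOn f Ω → Integrable (fun x => b x * f x) μ := by
    intro f hf
    obtain ⟨C, hC⟩ := hKb.exists_bound_of_continuousOn (hf.mono hKbΩ)
    refine Integrable.of_bound (hb.bm.aestronglyMeasurable.mul
      (hf.aestronglyMeasurable h.op.measurableSet)) (CB * max C 0) ?_
    refine Eventually.of_forall fun x => ?_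
    by_cases hx : x ∈ Kb
    · rw [norm_mul, Real.norm_of_nonneg (hb.bnn x)]
      exact mul_le_mul (hb.ble x) ((hC x hx).trans (le_max_left _ _)) (norm_nonneg _) ((hb.bnn x).trans (hb.ble x))
    · rw [hb0 x hx, zero_mul, norm_zero]
      exact mul_nonneg ((hb.bnn x).trans (hb.ble x)) (le_max_right _ _)
  have agint : ∀ f : Eu N → ℝ, ContinuousOn f Ω → ∀ C, (∀ x ∈ Ω, |f x| ≤ C) →
      Integrable (fun x => ag x * f x) μ := by
    intro f hf C hC
    refine hag.mul_bdd (c := C) (hf.aestronglyMeasurable h.op.measurableSet) ?_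
    filter_upwards [ae_restrict_mem h.op.measurableSet] with x hx using hC x hx
  have gint : ∀ f : Eu N → ℝ, ContinuousOn f Ω → ∀ C, (∀ x ∈ Ω, |f x| ≤ C) →
      Integrable (fun x => g x * f x) μ := by
    intro f hf C hC
    refine Integrable.of_bound (hgm.aestronglyMeasurable.mul
      (hf.aestronglyMeasurable h.op.measurableSet)) (CT * C) ?_
    filter_upwards [ae_restrict_mem h.op.measurableSet] with x hx
    rw [norm_mul, Real.norm_of_nonneg (hgb x hx).1]
    have h1 := (hgb x hx).2.trans (hb.Tle x hx)
    exact mul_le_mul h1 (hC x hx) (norm_nonneg _) ((hgb x hx).1.trans h1)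
  have Ubd : ∀ n, ∀ x ∈ Ω, |U n x| ≤ n + B := fun n x hx => by
    rw [abs_le]
    have := h.Uge n x hx
    have := h.Ule n x hx
    have : (0:ℝ) ≤ n := Nat.cast_nonneg n
    have := h.Bpos
    constructor <;> linarith
  set C := (∫ x in Ω, b x * V x) + P + A with hC
  have main : ∀ n : ℕ, n * (P - A) + ∫ x in Ω, ag x * U n x ≤ C := by
    intro n
    obtain ⟨K, hKΩ, hK, hKb'⟩ := bd_of_cont h.op h.bdd (f := fun x => n - U n x)
      (continuousOn_const.sub (h.Ucont n)) (fun x hx => by rw [h.Ufr n x hx]; simp) (1/2) (by norm_num)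
    have hhalf : (0:ℝ) < 1/2 := by norm_num
    set f0 : Eu N → ℝ := fun x => (n - 1/2 : ℝ) - U n x with hf0
    have hf0c : ContDiffOn ℝ 2 f0 Ω := contDiffOn_const.sub (h.Ucd n)
    obtain ⟨φc, φt, φs⟩ := ind_contDiff h.op (f := fun x => Ths (1/2) (f0 x))
      ((Ths_contDiff hhalf).comp_contDiffOn hf0c) hK hKΩ (fun x hx => by
        apply Ths_zero hhalf
        have := hKb' x hx
        simp only [hf0]; linarith)
    set φ := indicator Ω (fun x => Ths (1/2) (f0 x)) with hφ
    have hφ0 : ∀ x ∉ K, φ x = 0 := fun x hx => by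
      by_contra hne
      exact hx (φt (subset_tsupport _ hne))
    have adm1 : Adm Ω (fun x => (-1) * φ x) :=
      ⟨contDiff_const.mul φc, K, hKΩ, hK, fun x hx => by show 0 ≤ -1 * φ x; rw [hφ0 x hx.2]; simp⟩
    have e1 := hg _ adm1
    have e2 : ∀ x, laplacian (fun x => (-1) * φ x) x = (-1) * laplacian φ x := fun x =>
      lap_cmul _ φc.contDiffAt
    simp only [e2] at e1
    have e3 : ∀ k : Eu N → ℝ, ∫ x in Ω, k x * (-1 * φ x) = - ∫ x in Ω, k x * φ x := by
      intro k; rw [← integral_neg]; congr 1; ext x; ring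
    have e4 : ∀ k : Eu N → ℝ, ∫ x in Ω, k x * (-1 * laplacian φ x) = - ∫ x in Ω, k x * laplacian φ x := by
      intro k; rw [← integral_neg]; congr 1; ext x; ring
    rw [e3 b, e4 g, e3 (fun x => Real.exp (WW Ω U x) * g x)] at e1
    obtain ⟨Cl, hCl, hl⟩ := bdd_on h.bdd (lap_continuous φc)
    obtain ⟨Cp, hCp, hp⟩ := bdd_on h.bdd φc.continuous
    have hφx : ∀ x ∈ Ω, n - U n x - 1 ≤ φ x ∧ φ x ≤ n - U n x := by
      intro x hx
      rw [hφ, indicator_of_mem hx]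
      have h1 := Ths_ge hhalf (f0 x)
      have h2 := Ths_le hhalf (f0 x)
      have h3 := le_max_left (f0 x) 0
      have h4 : max (f0 x) 0 ≤ n - U n x := max_le (by simp only [hf0]; linarith)
        (by linarith [h.Ule n x hx])
      simp only [hf0] at *
      constructor <;> linarith
    have f1 : -A ≤ ∫ x in Ω, g x * laplacian φ x := by
      rw [hA, ← integral_neg]
      refine setIntegral_mono_on hag.neg (gint _ (lap_continuous φc).continuousOn Cl hl)
        h.op.measurableSet fun x hx => ?_
      have hfx := hf0c.contDiffAt (h.op.mem_nhds hx)
      have l1 : laplacian f0 x = - Real.exp (U n x) := by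
        rw [hf0, lap_sub (u := fun _ => (n - 1/2 : ℝ)) contDiffAt_const ((h.Ucd n).contDiffAt (h.op.mem_nhds hx)), lap_const, h.Ueq n x hx]; ring
      rw [hφ, lap_ind h.op hx, lap_Ths hhalf hfx, l1]
      have h2 : 0 ≤ Th2 (f0 x/(1/2))/(1/2) * gradSq f0 x :=
        mul_nonneg (div_nonneg (Th2_nonneg _) hhalf.le) (gradSq_nonneg)
      have h4 := Th1_nonneg (f0 x/(1/2))
      have h5 := Th1_le_one (f0 x/(1/2))
      have h6 : Real.exp (U n x) ≤ Real.exp (WW Ω U x) := Real.exp_le_exp.2 (U_le_WW h hx n)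
      have h7 := (Real.exp_pos (U n x)).le
      have h8 : Th1 (f0 x/(1/2)) * Real.exp (U n x) ≤ Real.exp (WW Ω U x) := by nlinarith
      have := mul_le_mul_of_nonneg_left h8 (hgb x hx).1
      have := mul_nonneg (hgb x hx).1 h2
      simp only [hagd]
      nlinarith
    have f2 : ∫ x in Ω, ag x * φ x ≤ ∫ x in Ω, (n * ag x - ag x * U n x) := by
      refine setIntegral_mono_on (agint _ φc.continuous.continuousOn Cp hp)
        ((hag.const_mul _).sub (agint _ (h.Ucd n).continuousOn _ (Ubd n))) h.op.measurableSet fun x hx => ?_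
      have := mul_le_mul_of_nonneg_left (hφx x hx).2 (hagnn x hx)
      linarith
    rw [integral_sub (hag.const_mul _) (agint _ (h.Ucd n).continuousOn _ (Ubd n)), integral_const_mul] at f2
    have f3 : ∫ x in Ω, (((n:ℝ) - 1) * (b x * 1) - b x * V x) ≤ ∫ x in Ω, b x * φ x := by
      refine setIntegral_mono_on (((bint (fun _ => 1) continuousOn_const).const_mul _).sub (bint _ h.Vcd.continuousOn))
        (bint _ φc.continuous.continuousOn) h.op.measurableSet fun x hx => ?_
      have := mul_le_mul_of_nonneg_left ((hφx x hx).1) (hb.bnn x)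
      have := mul_le_mul_of_nonneg_left (h.UV n x hx) (hb.bnn x)
      linarith
    rw [integral_sub ((bint (fun _ => 1) continuousOn_const).const_mul _) (bint _ h.Vcd.continuousOn), integral_const_mul] at f3
    simp only [hC]
    linarith
  have hAU : ∀ n, -B * A ≤ ∫ x in Ω, ag x * U n x := by
    intro n
    rw [hA, ← integral_const_mul]
    refine setIntegral_mono_on (hag.const_mul _) (agint _ (h.Ucd n).continuousOn _ (Ubd n)) h.op.measurableSet fun x hx => ?_
    have := mul_le_mul_of_nonneg_left (h.Uge n x hx) (hagnn x hx)
    linarith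
  have hPA : A = P := by
    apply le_antisymm hAP
    by_contra hlt
    push Not at hlt
    obtain ⟨n, hn⟩ := exists_nat_gt ((C + B * A) / (P - A))
    rw [div_lt_iff₀ (by linarith)] at hn
    have := main n
    have := hAU n
    linarith
  constructor
  · refine (fatou_int (f := fun n x => ag x * (U n x + B)) ?_ ?_ ?_ (C := C + B * A) ?_).1
    · intro n
      exact agint _ ((h.Ucd n).continuousOn.add continuousOn_const) (n + B + B) (fun x hx =>
        (abs_add_le _ _).trans (add_le_add (Ubd n x hx) (abs_of_nonneg h.Bpos).le))
    · intro n
      filter_upwards [ae_restrict_mem h.op.measurableSet] with x hx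
      exact mul_nonneg (hagnn x hx) (by linarith [h.Uge n x hx])
    · filter_upwards [ae_restrict_mem h.op.measurableSet] with x hx
      exact ((WW_tendsto' h hx).add_const B).const_mul _
    · intro n
      have := main n
      rw [← hPA, sub_self, mul_zero, zero_add] at this
      have e : ∫ x in Ω, ag x * (U n x + B) = (∫ x in Ω, ag x * U n x) + B * A := by
        rw [hA, ← integral_const_mul, ← integral_add (agint _ (h.Ucd n).continuousOn _ (Ubd n)) (hag.const_mul _)]
        congr 1; ext x; ring
      rw [e]; linarith
  · intro φ φc φs
    obtain ⟨Cl, hCl, hl⟩ := bdd_on h.bdd (lap_continuous φc)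
    obtain ⟨Cp, hCp, hp⟩ := bdd_on h.bdd φc.continuous
    have key : ∀ σ : ℝ, |σ| ≤ 1 → σ * (∫ x in Ω, ag x * φ x) ≤
        σ * (∫ x in Ω, b x * φ x) + σ * ∫ x in Ω, g x * laplacian φ x := by
      intro σ hσ
      have adm : Adm Ω (fun x => Cp + σ * φ x) := by
        refine ⟨contDiff_const.add (contDiff_const.mul φc), ∅, by simp, isCompact_empty, fun x hx => ?_⟩
        have h1 : |σ * φ x| ≤ 1 * Cp := by
          rw [abs_mul]; exact mul_le_mul hσ (hp x hx.1) (abs_nonneg _) (by norm_num)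
        have := (abs_le.1 h1).1
        linarith
      have e1 := hg _ adm
      have e2 : ∀ x, laplacian (fun x => Cp + σ * φ x) x = σ * laplacian φ x := fun x => by
        rw [lap_add (u := fun _ => Cp) (v := fun x => σ * φ x) contDiffAt_const (contDiffAt_const.mul φc.contDiffAt), lap_const, lap_cmul _ φc.contDiffAt]; ring
      simp only [e2] at e1
      have a1 : ∫ x in Ω, ag x * (Cp + σ * φ x) = Cp * A + σ * ∫ x in Ω, ag x * φ x := by
        rw [hA, ← integral_const_mul, ← integral_const_mul, ← integral_add (hag.const_mul _) ((agint _ φc.continuous.continuousOn Cp hp).const_mul _)]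
        congr 1; ext x; ring
      have a2 : ∫ x in Ω, b x * (Cp + σ * φ x) = Cp * P + σ * ∫ x in Ω, b x * φ x := by
        rw [hP, ← integral_const_mul, ← integral_const_mul, ← integral_add ((bint (fun _ => 1) continuousOn_const).const_mul _) ((bint _ φc.continuous.continuousOn).const_mul _)]
        congr 1; ext x; ring
      have a3 : ∫ x in Ω, g x * (σ * laplacian φ x) = σ * ∫ x in Ω, g x * laplacian φ x := by
        rw [← integral_const_mul]; congr 1; ext x; ring
      rw [a2, a3] at e1
      have a1' := a1.symm.le.trans e1
      rw [hPA] at a1'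
      linarith
    have k1 := key 1 (by simp)
    have k2 := key (-1) (by simp)
    simp only [hagd] at k1 k2
    linarith

end flux

structure GD {N : ℕ} (Ω : Set (Eu N)) (w g b : Eu N → ℝ) (x0 : Eu N)
    (B Cg CB D cg r0 cb : ℝ) : Prop where
  op : IsOpen Ω
  bdd : Bornology.IsBounded Ω
  wm : Measurable w
  wB : ∀ x, -B ≤ w x
  wloc : ∀ K, IsCompact K → K ⊆ Ω → ∃ M, 0 ≤ M ∧ ∀ x ∈ K, Real.exp (w x) ≤ M
  Bnn : 0 ≤ B
  gm : Measurable g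
  gnn : ∀ x, 0 ≤ g x
  gle : ∀ x, g x ≤ Cg
  goff : ∀ x ∉ Ω, g x = 0
  gcpt : ∀ ε > (0:ℝ), ∃ Q, Q ⊆ Ω ∧ IsCompact Q ∧ ∀ x ∉ Q, g x ≤ ε
  fint : Integrable (fun x => Real.exp (w x) * g x)
  Fint : Integrable (fun x => Real.exp (w x) * g x * (w x + B + 1))
  bm : Measurable b
  bnn : ∀ x, 0 ≤ b x
  ble : ∀ x, b x ≤ CB
  boff : ∀ x ∉ Ω, b x = 0
  bg : ∀ x z, b x ≠ 0 → dist z x ≤ D → cg ≤ g z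
  bx0 : ∀ x, dist x x0 < r0 → cb ≤ b x
  Dpos : 0 < D
  cgpos : 0 < cg
  r0pos : 0 < r0
  cbpos : 0 < cb
  eqn : ∀ φ, ContDiff ℝ 2 φ → HasCompactSupport φ →
      ∫ x, g x * laplacian φ x = (∫ x, Real.exp (w x) * g x * φ x) - ∫ x, b x * φ x

section ex
variable {N : ℕ} {Ω : Set (Eu N)} {U : ℕ → Eu N → ℝ} {V : Eu N → ℝ} {B : ℝ}

lemma setint_eq {h : Eu N → ℝ} (h0 : ∀ x ∉ Ω, h x = 0) : ∫ x in Ω, h x = ∫ x, h x :=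
  setIntegral_eq_integral_of_forall_compl_eq_zero h0

lemma int_of_restrict (_ : IsOpen Ω) {h : Eu N → ℝ} (h0 : ∀ x ∉ Ω, h x = 0)
    (hi : Integrable h (volume.restrict Ω)) : Integrable h := by
  rw [← integrableOn_univ]
  refine IntegrableOn.of_forall_sdiff_eq_zero (s := Ω) hi MeasurableSet.univ ?_
  intro x hx; exact h0 x hx.2

set_option maxHeartbeats 1600000 in
lemma GD_exists (h : Sys Ω U V B) {x0 : Eu N} (hx0 : x0 ∈ Ω) (hN : 1 ≤ N) :
    ∃ g b Cg CB D cg r0 cb, GD Ω (WW Ω U) g b x0 B Cg CB D cg r0 cb := by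
  obtain ⟨R, hR, hball⟩ := Metric.nhds_basis_closedBall.mem_iff.1 (h.op.mem_nhds hx0)
  set Kb := Metric.closedBall x0 R with hKb
  have hKc : IsCompact Kb := isCompact_closedBall _ _
  obtain ⟨M, hM0, hM⟩ := WW_loc h hKc hball
  set w := WW Ω U with hw
  set a : Eu N → ℝ := fun x => Real.exp (w x) with ha
  have hwm : Measurable w := WW_meas h
  have ham : Measurable a := hwm.exp
  set ψ : Eu N → ℝ := fun y => pw 4 (qd (R^2) 1 x0 y) with hψ
  have hψc : ContDiff ℝ 2 ψ := (pw_contDiff 1).comp (qd_contDiff _ _ _)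
  have hψnn : ∀ x, 0 ≤ ψ x := fun x => pw_nonneg _ _
  have hqd : ∀ x, qd (R^2) 1 x0 x = R^2 - (dist x x0)^2 := fun x => by
    simp [qd, dist_eq_norm]
  have hqoff : ∀ x ∉ Kb, qd (R^2) 1 x0 x ≤ 0 := by
    intro x hx
    have : R < dist x x0 := by simpa [hKb] using hx
    rw [hqd]; nlinarith
  have hψ0 : ∀ x ∉ Kb, ψ x = 0 := fun x hx => pw_of_nonpos 3 (hqoff x hx)
  have hψlap : ∀ y, laplacian ψ y = 48 * pw 2 (qd (R^2) 1 x0 y) * (dist y x0)^2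
       - 8 * N * pw 3 (qd (R^2) 1 x0 y) := by
    intro y
    have := lap_pw 1 (R^2) 1 x0 y
    rw [dist_eq_norm]
    convert this using 1
    norm_num; ring
  have hlap0 : ∀ x ∉ Kb, laplacian ψ x = 0 := fun x hx => by
    rw [hψlap, pw_of_nonpos 1 (hqoff x hx), pw_of_nonpos 2 (hqoff x hx)]; ring
  have hψcs : HasCompactSupport ψ := by
    refine HasCompactSupport.intro hKc hψ0
  set L : Eu N → ℝ := fun x => LL a ψ x with hL
  have hLm : Measurable L := by
    simp only [hL, LL]
    exact ((lap_continuous hψc).measurable.neg).add (ham.mul hψc.continuous.measurable)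
  have hL0 : ∀ x ∉ Kb, L x = 0 := fun x hx => by simp [hL, LL, hlap0 x hx, hψ0 x hx]
  obtain ⟨Cl, hCl0, hCl⟩ := bdd_on h.bdd (lap_continuous hψc)
  obtain ⟨Cp, hCp0, hCp⟩ := bdd_on h.bdd hψc.continuous
  set CB := Cl + M * Cp with hCB
  have hCB0 : 0 ≤ CB := by positivity
  have hLb : ∀ x, |L x| ≤ CB := by
    intro x
    by_cases hx : x ∈ Kb
    · have h1 := hCl x (hball hx)
      have h2 := hCp x (hball hx)
      have h3 := hM x hx
      have h4 : |a x * ψ x| ≤ M * Cp := by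
        rw [abs_mul, abs_of_nonneg (Real.exp_pos _).le]
        exact mul_le_mul h3 h2 (abs_nonneg _) hM0
      calc |L x| ≤ |-laplacian ψ x| + |a x * ψ x| := abs_add_le _ _
        _ ≤ CB := by rw [abs_neg]; linarith
    · rw [hL0 x hx]; simpa using hCB0
  set b' : Eu N → ℝ := fun x => max (-L x) 0 with hb'
  set b : Eu N → ℝ := fun x => max (L x) 0 with hb
  set c0 := Real.exp (-B) with hc0
  have hc0p : 0 < c0 := Real.exp_pos _
  set T : Eu N → ℝ := fun x => (-(CB / c0)) * U 0 x with hT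
  have hU0 : ∀ x ∈ Ω, -B ≤ U 0 x ∧ U 0 x ≤ 0 := fun x hx => ⟨h.Uge 0 x hx, by simpa using h.Ule 0 x hx⟩
  have hk : 0 ≤ CB / c0 := by positivity
  have HB : HBd Ω T a b' (CB / c0 * B) CB :=
    { op := h.op, bdd := h.bdd
      Tcd := contDiffOn_const.mul (h.Ucd 0)
      Tnn := fun x hx => by have := (hU0 x hx).2; simp only [hT]; nlinarith
      Tle := fun x hx => by
        have := mul_le_mul_of_nonneg_left (hU0 x hx).1 hk
        simp only [hT]; linarith
      am := ham
      ann := fun x => (Real.exp_pos _).le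
      aloc := fun K hK hKΩ => WW_loc h hK hKΩ
      bm := hLm.neg.max measurable_const
      bnn := fun x => le_max_right _ _
      ble := fun x => max_le (by have := (abs_le.1 (hLb x)).1; linarith) hCB0
      bT := fun x hx => by
        rw [hT, lap_cmul _ ((h.Ucd 0).contDiffAt (h.op.mem_nhds hx)), h.Ueq 0 x hx]
        have h1 : b' x ≤ CB := max_le (by have := (abs_le.1 (hLb x)).1; linarith) hCB0
        have h2 : c0 ≤ Real.exp (U 0 x) := Real.exp_le_exp.2 (hU0 x hx).1
        have h3 : CB / c0 * c0 = CB := by field_simp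
        have := mul_le_mul_of_nonneg_left h2 hk
        linarith }
  obtain ⟨g', hgm, hgb, hg0, hgi, hg⟩ := HB.exists_g2
  have hb'0 : ∀ x ∉ Kb, b' x = 0 := fun x hx => by simp [hb', hL0 x hx]
  obtain ⟨hFi, hflux⟩ := flux h HB hKc hball hb'0 hgm hgb hgi hg
  have hxoff : ∀ x ∉ Ω, x ∉ Kb := fun x hx hxK => hx (hball hxK)
  have hg'nn : ∀ x, 0 ≤ g' x := fun x => by
    by_cases hx : x ∈ Ω
    · exact (hgb x hx).1
    · rw [hg0 x hx]
  set u1 := 24 * R^2 / (8 * N + M * R^2 + 48) with hu1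
  have hden : 0 < 8 * N + M * R^2 + 48 := by positivity
  have hu1p : 0 < u1 := by positivity
  have hu1R : 2 * u1 ≤ R^2 := by
    rw [hu1, ← mul_div_assoc, div_le_iff₀ hden]
    have : 0 ≤ R^2 * (8 * N + M * R^2) := by positivity
    nlinarith
  -- b = 0 where qd ≤ u1
  have hbz : ∀ x, qd (R^2) 1 x0 x ≤ u1 → b x = 0 := by
    intro x hx
    by_cases hxK : x ∈ Kb
    · have hq : 0 ≤ qd (R^2) 1 x0 x := by
        have : dist x x0 ≤ R := hxK
        rw [hqd]; nlinarith [dist_nonneg (x := x) (y := x0)]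
      have : L x ≤ 0 := by
        simp only [hL, LL, hψlap]
        simp only [hψ]
        set q := qd (R^2) 1 x0 x with hqq
        rw [pw_of_nonneg _ hq, pw_of_nonneg _ hq, pw_of_nonneg _ hq]
        have hd : dist x x0 ^2 = R^2 - q := by rw [hqq, hqd]; ring
        rw [hd]
        have haM := hM x hxK
        have ha0 : 0 ≤ a x := (Real.exp_pos _).le
        have hqR : q ≤ R^2 := by linarith
        have e1 : q * (8 * N + M * R^2 + 48) ≤ 24 * R^2 := by
          rw [hu1, le_div_iff₀ hden] at hx; exact hx
        have e2 : a x * q * q ≤ M * R^2 * q := by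
          have : a x * q ≤ M * R^2 := mul_le_mul haM hqR hq hM0
          nlinarith
        have e3 : -(48 * (R^2 - q)) + 8 * N * q + a x * q * q ≤ 0 := by nlinarith [sq_nonneg R]
        have := mul_nonneg (sq_nonneg q) (neg_nonneg.2 e3)
        nlinarith
      simp [hb, this]
    · simp [hb, hL0 x hxK]
  set D := min R (u1 / (6 * R)) with hD
  have hDp : 0 < D := lt_min hR (by positivity)
  have hDR : D ≤ R := min_le_left _ _
  have hDu : 6 * R * D ≤ u1 := by
    have := min_le_right R (u1 / (6 * R))
    rw [← hD, le_div_iff₀ (by positivity)] at this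
    linarith
  set g : Eu N → ℝ := fun x => ψ x + g' x with hgdef
  have hψoff : ∀ x ∉ Ω, ψ x = 0 := fun x hx => hψ0 x (hxoff x hx)
  have hψi : Integrable (fun x => a x * ψ x) (volume.restrict Ω) := by
    have := HB.fin
    refine Integrable.of_bound (ham.mul hψc.continuous.measurable).aestronglyMeasurable (M * Cp) ?_
    refine Eventually.of_forall fun x => ?_
    by_cases hx : x ∈ Kb
    · rw [norm_mul, Real.norm_of_nonneg (Real.exp_pos _).le]
      exact mul_le_mul (hM x hx) (hCp x (hball hx)) (abs_nonneg _) hM0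
    · rw [hψ0 x hx]; simp; positivity
  have hwM : ∀ x ∈ Kb, |w x| ≤ 2 * B + V x := by
    intro x hx
    have h1 := WW_ge h x
    have h2 := WW_le h (hball hx)
    have h3 := h.UV 0 x (hball hx)
    have h4 := h.Uge 0 x (hball hx)
    have := h.Bpos
    rw [abs_le]; constructor
    · linarith
    · linarith
  obtain ⟨CV, hCV⟩ := hKc.exists_bound_of_continuousOn (h.Vcd.continuousOn.mono hball)
  have hψFi : Integrable (fun x => a x * ψ x * (w x + B + 1)) (volume.restrict Ω) := by
    have := HB.fin
    have hCV0 : 0 ≤ CV := (norm_nonneg _).trans (hCV x0 (Metric.mem_closedBall_self hR.le))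
    have hBp := h.Bpos
    refine Integrable.of_bound ((ham.mul hψc.continuous.measurable).mul ((hwm.add_const _).add_const _)).aestronglyMeasurable (M * Cp * (2 * B + CV + B + 1)) ?_
    refine Eventually.of_forall fun x => ?_
    by_cases hx : x ∈ Kb
    · rw [norm_mul, norm_mul, Real.norm_of_nonneg (Real.exp_pos _).le]
      refine mul_le_mul (mul_le_mul (hM x hx) (hCp x (hball hx)) (abs_nonneg _) hM0) ?_ (abs_nonneg _) (by positivity)
      have h1 := hwM x hx
      have h2 := (le_abs_self _).trans (hCV x hx)
      have h3 := abs_le.1 h1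
      rw [Real.norm_eq_abs, abs_le]
      constructor <;> linarith
    · rw [hψ0 x hx]; simp; positivity
  have hBp := h.Bpos
  refine ⟨g, b, Cp + CB / c0 * B, CB, D, (u1/2)^4, R/4, (2 * R^6 : ℝ), ?_⟩
  exact
  { op := h.op, bdd := h.bdd, wm := hwm, wB := fun x => WW_ge h x
    wloc := fun K hK hKΩ => WW_loc h hK hKΩ
    Bnn := h.Bpos
    gm := hψc.continuous.measurable.add hgm
    gnn := fun x => add_nonneg (hψnn x) (hg'nn x)
    gle := fun x => by
      by_cases hx : x ∈ Ω
      · exact add_le_add ((le_abs_self _).trans (hCp x hx)) ((hgb x hx).2.trans (HB.Tle x hx))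
      · simp only [hgdef, hψoff x hx, hg0 x hx, add_zero]; positivity
    goff := fun x hx => by simp [hgdef, hψoff x hx, hg0 x hx]
    gcpt := fun ε hε => by
      obtain ⟨K, hKΩ, hK, hKT⟩ := bd_of_cont h.op h.bdd (f := T)
        (continuousOn_const.mul (h.Ucont 0)) (fun x hx => by simp [hT, h.Ufr 0 x hx]) ε hε
      refine ⟨K ∪ Kb, union_subset hKΩ hball, hK.union hKc, fun x hx => ?_⟩
      have h1 : x ∉ K := fun hh => hx (Or.inl hh)
      have h2 : x ∉ Kb := fun hh => hx (Or.inr hh)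
      simp only [hgdef, hψ0 x h2, zero_add]
      by_cases hxΩ : x ∈ Ω
      · exact (hgb x hxΩ).2.trans (hKT x ⟨hxΩ, h1⟩)
      · rw [hg0 x hxΩ]; exact hε.le
    fint := by
      refine int_of_restrict h.op (fun x hx => by simp [hgdef, hψoff x hx, hg0 x hx]) ?_
      refine (hψi.add hgi).congr (Eventually.of_forall fun x => ?_)
      simp [hgdef, ha]; ring
    Fint := by
      refine int_of_restrict h.op (fun x hx => by simp [hgdef, hψoff x hx, hg0 x hx]) ?_
      refine ((hψFi.add hFi).add hgi).congr (Eventually.of_forall fun x => ?_)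
      simp [hgdef, ha]; ring
    bm := hLm.max measurable_const
    bnn := fun x => le_max_right _ _
    ble := fun x => max_le ((abs_le.1 (hLb x)).2) hCB0
    boff := fun x hx => by simp [hb, hL0 x (hxoff x hx)]
    bg := fun x z hbx hz => by
      have h1 : u1 < qd (R^2) 1 x0 x := by
        by_contra hcon
        exact hbx (hbz x (not_lt.1 hcon))
      have hq := hqd x
      have hqz := hqd z
      have htri := dist_triangle z x x0
      have hxR : dist x x0 ≤ R := by
        by_contra hcon
        have := hqoff x (by simpa [hKb] using hcon)
        linarith
      have h2 : u1 / 2 ≤ qd (R^2) 1 x0 z := by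
        have d1 := dist_nonneg (x := x) (y := x0)
        have d2 := dist_nonneg (x := z) (y := x0)
        have h5 : dist z x0 ≤ dist x x0 + D := by linarith
        have h6 : dist z x0 ^2 ≤ (dist x x0 + D)^2 := by
          exact pow_le_pow_left₀ d2 h5 2
        rw [hqz]
        nlinarith
      have h3 : (u1/2)^4 ≤ ψ z := by
        simp only [hψ]
        rw [pw_of_nonneg _ (by linarith)]
        exact pow_le_pow_left₀ (by linarith) h2 4
      have := hg'nn z
      simp only [hgdef]; linarith
    bx0 := fun x hx => by
      refine le_trans ?_ (le_max_left _ _)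
      simp only [hL, LL, hψlap]
      have d1 := dist_nonneg (x := x) (y := x0)
      have hd : dist x x0 ^2 ≤ R^2/16 := by nlinarith
      have hq : R^2 * (15/16) ≤ qd (R^2) 1 x0 x := by rw [hqd]; linarith
      have hq0 : 0 ≤ qd (R^2) 1 x0 x := le_trans (by positivity) hq
      have h3 : 0 ≤ a x * ψ x := mul_nonneg (Real.exp_pos _).le (hψnn x)
      rw [pw_of_nonneg _ hq0, pw_of_nonneg _ hq0]
      set q := qd (R^2) 1 x0 x with hqq
      have hN' : (1:ℝ) ≤ N := by exact_mod_cast hN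
      have h4 : 8 * (N:ℝ) * q ^ 3 ≥ 8 * q^3 := by
        have : 0 ≤ q^3 := by positivity
        nlinarith
      have h5 : 48 * q^2 * dist x x0^2 ≤ 48 * q^2 * (R^2/16) :=
        mul_le_mul_of_nonneg_left hd (by positivity)
      have h6 : q^2 * (R^2 * (15/16)) ≤ q^2 * q := mul_le_mul_of_nonneg_left hq (by positivity)
      have h7 : (R^2 * (15/16))^2 ≤ q^2 := pow_le_pow_left₀ (by positivity) hq 2
      have h8 : (R^2 * (15/16))^2 * R^2 ≤ q^2 * R^2 := mul_le_mul_of_nonneg_right h7 (by positivity)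
      nlinarith [pow_pos hR 6]
    Dpos := hDp
    cgpos := by positivity
    r0pos := by positivity
    cbpos := by positivity
    eqn := fun φ φc φs => by
      have hfin := HB.fin
      have e1 := hflux φ φc φs
      have e2 := green isOpen_univ hψc.contDiffOn φc φs (subset_univ _)
      rw [setint_eq (fun x hx => by simp [hg0 x hx]), setint_eq (fun x hx => by simp [hg0 x hx]),
        setint_eq (fun x hx => by simp [hb'0 x (hxoff x hx)])] at e1
      have iA : ∀ k : Eu N → ℝ, Integrable k (volume.restrict Ω) → (∀ x ∉ Ω, k x = 0) →
          ∀ h : Eu N → ℝ, Continuous h → Integrable (fun x => k x * h x) := by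
        intro k hk hk0 hh hhc
        obtain ⟨C, hC0, hC⟩ := bdd_on h.bdd hhc
        refine int_of_restrict h.op (fun x hx => by simp [hk0 x hx]) ?_
        refine hk.mul_bdd (c := C) hhc.aestronglyMeasurable ?_
        filter_upwards [ae_restrict_mem h.op.measurableSet] with x hx using hC x hx
      have bd : ∀ k : Eu N → ℝ, Measurable k → ∀ C, (∀ x, |k x| ≤ C) → Integrable k (volume.restrict Ω) :=
        fun k hk C hC => Integrable.of_bound hk.aestronglyMeasurable C (Eventually.of_forall hC)
      have i1 := iA ψ (hψc.continuous.integrable_of_hasCompactSupport hψcs).integrableOn hψoff _ (lap_continuous φc)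
      have i2 := iA g' (Integrable.of_bound hgm.aestronglyMeasurable (CB / c0 * B) (by
        filter_upwards [ae_restrict_mem h.op.measurableSet] with x hx
        rw [Real.norm_of_nonneg (hg'nn x)]
        exact (hgb x hx).2.trans (HB.Tle x hx))) hg0 _ (lap_continuous φc)
      have i3 := iA _ hψi (fun x hx => by simp [hψoff x hx]) _ φc.continuous
      have i4 := iA _ hgi (fun x hx => by simp [hg0 x hx]) _ φc.continuous
      have i5 := iA b' (bd b' HB.bm CB (fun x => by rw [abs_of_nonneg (HB.bnn x)]; exact HB.ble x)) (fun x hx => hb'0 x (hxoff x hx)) _ φc.continuous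
      have i6 := iA b (bd b (hLm.max measurable_const) CB (fun x => by
        rw [abs_of_nonneg (le_max_right _ _)]; exact max_le ((abs_le.1 (hLb x)).2) hCB0)) (fun x hx => by simp [hb, hL0 x (hxoff x hx)]) _ φc.continuous
      have i7 := iA (laplacian ψ) (bd _ (lap_continuous hψc).measurable Cl (fun x => by
        by_cases hx : x ∈ Kb
        · exact hCl x (hball hx)
        · rw [hlap0 x hx]; simpa using hCl0)) (fun x hx => hlap0 x (hxoff x hx)) _ φc.continuous
      have j1 : ∫ x, g x * laplacian φ x = (∫ x, ψ x * laplacian φ x) + ∫ x, g' x * laplacian φ x := by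
        rw [← integral_add i1 i2]; congr 1; ext x; simp only [hgdef]; ring
      have j2 : ∫ x, Real.exp (w x) * g x * φ x = (∫ x, a x * ψ x * φ x) + ∫ x, Real.exp (w x) * g' x * φ x := by
        rw [← integral_add i3 i4]; congr 1; ext x; simp only [hgdef, ha]; ring
      have j3 : (∫ x, b x * φ x) + ∫ x, laplacian ψ x * φ x = (∫ x, a x * ψ x * φ x) + ∫ x, b' x * φ x := by
        rw [← integral_add i6 i7, ← integral_add i3 i5]; congr 1; ext x
        have : b x - b' x = L x := by
          simp only [hb, hb']
          rcases le_total (L x) 0 with hh | hh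
          · rw [max_eq_right hh, max_eq_left (by linarith)]; ring
          · rw [max_eq_left hh, max_eq_right (by linarith)]; ring
        have hLx : L x = -laplacian ψ x + a x * ψ x := rfl
        linear_combination (this + hLx) * φ x
      rw [j1, j2, e1, e2]
      linarith }

end ex

section conv
variable {N : ℕ}

noncomputable def cv (g κ : Eu N → ℝ) (z : Eu N) : ℝ := ∫ y, g y * κ (z - y)

lemma cv_eq (g κ : Eu N → ℝ) : cv g κ = convolution g κ (ContinuousLinearMap.mul ℝ ℝ) volume := by
  ext z; simp [cv, convolution]

lemma cv_contDiff {g κ : Eu N → ℝ} (hg : Integrable g) (hκ : ContDiff ℝ 2 κ)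
    (hc : HasCompactSupport κ) : ContDiff ℝ 2 (cv g κ) := by
  rw [cv_eq]
  exact hc.contDiff_convolution_right (n := 2) _ hg.locallyIntegrable hκ

lemma pd_cv {g κ : Eu N → ℝ} (hg : Integrable g) (hκ : ContDiff ℝ 1 κ)
    (hc : HasCompactSupport κ) (i : Fin N) : pd i (cv g κ) = cv g (pd i κ) := by
  ext z
  have h := hc.hasFDerivAt_convolution_right (ContinuousLinearMap.mul ℝ ℝ) hg.locallyIntegrable hκ z
  rw [cv_eq, cv_eq, pd, h.fderiv]
  rw [convolution_precompR_apply _ hg.locallyIntegrable (hc.fderiv ℝ) (hκ.continuous_fderiv (by norm_num))]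
  rfl

lemma lap_cv {g κ : Eu N → ℝ} (hg : Integrable g) (hκ : ContDiff ℝ 2 κ)
    (hc : HasCompactSupport κ) (z : Eu N) : laplacian (cv g κ) z = cv g (laplacian κ) z := by
  rw [lap_eq (cv_contDiff hg hκ hc).contDiffAt]
  have h1 : ∀ i : Fin N, ContDiff ℝ 1 (pd i κ) := fun i =>
    contDiff_iff_contDiffAt.2 fun x => pd_contDiffAt hκ.contDiffAt
  have h2 : ∀ i : Fin N, HasCompactSupport (pd i κ) := fun i =>
    hc.of_isClosed_subset (isClosed_tsupport _) tsupport_pd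
  have h3 : ∀ i : Fin N, pd i (pd i (cv g κ)) z = cv g (pd i (pd i κ)) z := fun i => by
    rw [pd_cv hg (hκ.of_le (by norm_num)) hc, pd_cv hg (h1 i) (h2 i)]
  simp only [h3]
  have h4 : ∀ i : Fin N, Continuous (pd i (pd i κ)) := fun i => by
    have := (h1 i).continuous_fderiv (by norm_num)
    exact this.clm_apply continuous_const
  have h5 : ∀ i : Fin N, HasCompactSupport (pd i (pd i κ)) := fun i =>
    (h2 i).of_isClosed_subset (isClosed_tsupport _) tsupport_pd
  unfold cv
  rw [← integral_finsetSum]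
  · congr 1; ext y
    rw [lap_eq hκ.contDiffAt, Finset.mul_sum]
  · intro i _
    obtain ⟨C, hC⟩ := (h5 i).exists_bound_of_continuous (h4 i)
    exact hg.mul_bdd (c := C) ((h4 i).comp (continuous_const.sub continuous_id)).aestronglyMeasurable
      (Eventually.of_forall fun y => hC _)

/-- unnormalised average -/
noncomputable def ph (g : Eu N → ℝ) (t : ℝ) (z : Eu N) : ℝ :=
  (t^N)⁻¹ * ∫ y, g y * pw 3 (qd 1 ((t^2)⁻¹) z y)

noncomputable def dph (i : Fin N) (g : Eu N → ℝ) (t : ℝ) (z : Eu N) : ℝ :=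
  ∫ y, g y * ((t^N)⁻¹ * (6 * (t^2)⁻¹ * (y i - z i) * pw 2 (qd 1 ((t^2)⁻¹) z y)))

noncomputable def kap (N : ℕ) (t : ℝ) (x : Eu N) : ℝ := (t^N)⁻¹ * pw 3 (qd 1 ((t^2)⁻¹) 0 x)

lemma qd_symm (c s : ℝ) (z y : Eu N) : qd c s z y = qd c s 0 (z - y) := by
  simp [qd, norm_sub_rev]

lemma qd_nonpos {t : ℝ} (ht : 0 < t) {z y : Eu N} (h : t ≤ dist y z) : qd 1 ((t^2)⁻¹) z y ≤ 0 := by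
  rw [dist_eq_norm] at h
  have : t^2 ≤ ‖y - z‖^2 := pow_le_pow_left₀ ht.le h 2
  have h2 : 1 ≤ (t^2)⁻¹ * ‖y - z‖^2 := by
    rw [inv_mul_eq_div, le_div_iff₀ (by positivity)]; linarith
  unfold qd; linarith

lemma qd_le_one {t : ℝ} (z y : Eu N) : qd 1 ((t^2)⁻¹) z y ≤ 1 := by
  have : 0 ≤ (t^2)⁻¹ * ‖y - z‖^2 := by positivity
  unfold qd; linarith

lemma qd_ge {t : ℝ} (ht : 0 < t) {z y : Eu N} (h : dist y z ≤ t / 2) : 3/4 ≤ qd 1 ((t^2)⁻¹) z y := by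
  rw [dist_eq_norm] at h
  have : ‖y - z‖^2 ≤ (t/2)^2 := pow_le_pow_left₀ (norm_nonneg _) h 2
  have h2 : (t^2)⁻¹ * ‖y - z‖^2 ≤ 1/4 := by
    rw [inv_mul_eq_div, div_le_iff₀ (by positivity)]; linarith
  unfold qd; linarith

lemma pw_le_one {k : ℕ} {t : ℝ} (h : t ≤ 1) : pw k t ≤ 1 := by
  unfold pw
  exact pow_le_one₀ (le_max_right _ _) (max_le h zero_le_one)

lemma pwq_cont (k : ℕ) (s : ℝ) (z : Eu N) : Continuous (fun y => pw k (qd 1 s z y)) :=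
  (pw_continuous k).comp (qd_contDiff 1 s z).continuous

lemma kap_contDiff (t : ℝ) : ContDiff ℝ 2 (kap N t) :=
  contDiff_const.mul ((pw_contDiff 0).comp (qd_contDiff _ _ _))

lemma pwq_hcs (k : ℕ) {t : ℝ} (ht : 0 < t) (z : Eu N) :
    HasCompactSupport (fun y => pw (k+1) (qd 1 ((t^2)⁻¹) z y)) := by
  refine HasCompactSupport.intro (isCompact_closedBall z t) fun x hx => ?_
  apply pw_of_nonpos
  apply qd_nonpos ht
  rw [Metric.mem_closedBall, not_le] at hx
  exact hx.le

lemma kap_hcs {t : ℝ} (ht : 0 < t) : HasCompactSupport (kap N t) :=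
  (pwq_hcs 2 ht 0).mul_left

lemma ph_eq (g : Eu N → ℝ) (t : ℝ) : ph g t = cv g (kap N t) := by
  ext z
  unfold ph cv kap
  rw [← integral_const_mul]
  congr 1; ext y; rw [qd_symm]; ring

lemma ph_contDiff {g : Eu N → ℝ} (hg : Integrable g) {t : ℝ} (ht : 0 < t) : ContDiff ℝ 2 (ph g t) := by
  rw [ph_eq]; exact cv_contDiff hg (kap_contDiff t) (kap_hcs ht)

lemma pd_ph {g : Eu N → ℝ} (hg : Integrable g) {t : ℝ} (ht : 0 < t) (i : Fin N) (z : Eu N) :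
    pd i (ph g t) z = dph i g t z := by
  rw [ph_eq, pd_cv hg ((kap_contDiff t).of_le (by norm_num)) (kap_hcs ht)]
  unfold cv dph
  congr 1; ext y
  have : pd i (kap N t) (z - y) = (t^N)⁻¹ * (-2 * (t^2)⁻¹ * 3 * ((z - y) i) * pw 2 (qd 1 ((t^2)⁻¹) 0 (z - y))) := by
    have h1 := pd_pw 1 1 ((t^2)⁻¹) 0 (z - y) i
    have h2 := pd_cmul (i := i) ((t^N)⁻¹) (u := fun y => pw 3 (qd 1 ((t^2)⁻¹) 0 y)) (x := z - y)
      (((pw_contDiff 0).comp (qd_contDiff _ _ _)).differentiable (by norm_num)).differentiableAt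
    unfold kap
    rw [h2]
    norm_num at h1 ⊢
    rw [h1]; ring
  rw [this, ← qd_symm]; simp; ring

lemma bdd_int {g h : Eu N → ℝ} (hg : Integrable g) (hh : Continuous h) (hc : HasCompactSupport h) :
    Integrable (fun y => g y * h y) := by
  obtain ⟨C, hC⟩ := hc.exists_bound_of_continuous hh
  exact hg.mul_bdd (c := C) hh.aestronglyMeasurable (Eventually.of_forall hC)

lemma deriv_int {g : Eu N → ℝ} (hg : Integrable g) {k k' : ℝ → Eu N → ℝ} {t C C0 : ℝ} (ht : 0 < t)
    (hk : ∀ τ, Continuous (k τ)) (hk0 : ∀ y, |k t y| ≤ C0) (hk' : Continuous (k' t))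
    (hd : ∀ τ, t/2 < τ → ∀ y, HasDerivAt (fun τ => k τ y) (k' τ y) τ)
    (hb : ∀ τ, t/2 < τ → ∀ y, |k' τ y| ≤ C) :
    HasDerivAt (fun τ => ∫ y, g y * k τ y) (∫ y, g y * k' t y) t := by
  refine (hasDerivAt_integral_of_dominated_loc_of_deriv_le (s := Ioi (t/2))
    (bound := fun y => |g y| * C) (F := fun τ y => g y * k τ y) (F' := fun τ y => g y * k' τ y)
    (Ioi_mem_nhds (by linarith)) ?_ ?_ ?_ ?_ ?_ ?_).2
  · exact Eventually.of_forall fun τ => hg.aestronglyMeasurable.mul (hk τ).aestronglyMeasurable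
  · exact hg.mul_bdd (c := C0) (hk t).aestronglyMeasurable (Eventually.of_forall hk0)
  · exact hg.aestronglyMeasurable.mul hk'.aestronglyMeasurable
  · refine Eventually.of_forall fun y τ hτ => ?_
    rw [norm_mul, Real.norm_eq_abs]
    exact mul_le_mul_of_nonneg_left (hb τ hτ y) (abs_nonneg _)
  · exact hg.abs.mul_const C
  · exact Eventually.of_forall fun y τ hτ => (hd τ hτ y).const_mul _

lemma qd_deriv {τ : ℝ} (hτ : 0 < τ) (z y : Eu N) :
    HasDerivAt (fun τ => qd 1 ((τ^2)⁻¹) z y) (2 * (τ^3)⁻¹ * ‖y - z‖^2) τ := by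
  unfold qd
  have h1 : HasDerivAt (fun τ : ℝ => (τ^2)⁻¹) (-(2 * τ) / (τ^2)^2) τ := by
    have := (hasDerivAt_pow 2 τ).fun_inv (by positivity)
    simpa using this
  refine ((h1.mul_const (‖y - z‖^2)).const_sub 1).congr_deriv ?_
  field_simp

lemma invpow_deriv (m : ℕ) {τ : ℝ} (hτ : 0 < τ) :
    HasDerivAt (fun τ : ℝ => (τ^m)⁻¹) (-(m * (τ^(m+1))⁻¹)) τ := by
  refine ((hasDerivAt_pow m τ).fun_inv (by positivity)).congr_deriv ?_
  cases m with
  | zero => simp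
  | succ m =>
    simp only [Nat.add_sub_cancel]
    field_simp
    ring

/-- the radius bound: `ρ² pw ≤ τ²` -/
lemma rho_pw {τ : ℝ} (hτ : 0 < τ) (k : ℕ) (z y : Eu N) :
    ‖y - z‖ * pw (k+1) (qd 1 ((τ^2)⁻¹) z y) ≤ τ * pw (k+1) (qd 1 ((τ^2)⁻¹) z y) := by
  rcases le_total τ (dist y z) with h | h
  · rw [pw_of_nonpos k (qd_nonpos hτ h)]; simp
  · rw [dist_eq_norm] at h
    exact mul_le_mul_of_nonneg_right h (pw_nonneg _ _)

end conv

section d1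
variable {N : ℕ} {Ω : Set (Eu N)} {w g b : Eu N → ℝ} {x0 : Eu N} {B Cg CB D cg r0 cb : ℝ}

/-- the source `f = e^w g` -/
noncomputable def ff (w g : Eu N → ℝ) (x : Eu N) : ℝ := Real.exp (w x) * g x

noncomputable def pq (f : Eu N → ℝ) (t : ℝ) (z : Eu N) : ℝ := (t^N)⁻¹ * ∫ y in Metric.ball z t, f y

lemma GD.fi (h : GD Ω w g b x0 B Cg CB D cg r0 cb) : Integrable (ff w g) := h.fint

lemma GD.ffnn (h : GD Ω w g b x0 B Cg CB D cg r0 cb) (x : Eu N) : 0 ≤ ff w g x :=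
  mul_nonneg (Real.exp_pos _).le (h.gnn x)

lemma bdd_meas_int (hΩ : IsOpen Ω) (hb : Bornology.IsBounded Ω) {k : Eu N → ℝ} (hk : Measurable k)
    {C : ℝ} (hC : ∀ x, |k x| ≤ C) (h0 : ∀ x ∉ Ω, k x = 0) : Integrable k := by
  have : IsFiniteMeasure (volume.restrict Ω) := ⟨by
    rw [Measure.restrict_apply_univ]; exact hb.measure_lt_top⟩
  exact int_of_restrict hΩ h0 (Integrable.of_bound hk.aestronglyMeasurable C (Eventually.of_forall hC))

lemma GD.gi (h : GD Ω w g b x0 B Cg CB D cg r0 cb) : Integrable g :=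
  bdd_meas_int h.op h.bdd h.gm (C := Cg) (fun x => by rw [abs_of_nonneg (h.gnn x)]; exact h.gle x) h.goff

lemma GD.bi (h : GD Ω w g b x0 B Cg CB D cg r0 cb) : Integrable b :=
  bdd_meas_int h.op h.bdd h.bm (C := CB) (fun x => by rw [abs_of_nonneg (h.bnn x)]; exact h.ble x) h.boff

lemma GD.lap_ph (h : GD Ω w g b x0 B Cg CB D cg r0 cb) {t : ℝ} (ht : 0 < t) (z : Eu N) :
    laplacian (ph g t) z = ph (ff w g) t z - ph b t z := by
  rw [ph_eq, lap_cv h.gi (kap_contDiff t) (kap_hcs ht)]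
  set Φ : Eu N → ℝ := fun y => (t^N)⁻¹ * pw 3 (qd 1 ((t^2)⁻¹) z y) with hΦ
  have hΦc : ContDiff ℝ 2 Φ := contDiff_const.mul ((pw_contDiff 0).comp (qd_contDiff _ _ _))
  have hΦs : HasCompactSupport Φ := (pwq_hcs 2 ht z).mul_left
  have e := h.eqn Φ hΦc hΦs
  have hl : ∀ y, laplacian (kap N t) (z - y) = laplacian Φ y := by
    intro y
    have c1 : ∀ z y : Eu N, ContDiffAt ℝ 2 (fun y => pw 3 (qd 1 ((t^2)⁻¹) z y)) y := fun z y =>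
      ((pw_contDiff 0).comp (qd_contDiff _ _ _)).contDiffAt
    have h1 := lap_cmul (u := fun y => pw 3 (qd 1 ((t^2)⁻¹) 0 y)) ((t^N)⁻¹) (c1 0 (z - y))
    have h2 := lap_cmul (u := fun y => pw 3 (qd 1 ((t^2)⁻¹) z y)) ((t^N)⁻¹) (c1 z y)
    have h3 := lap_pw 0 1 ((t^2)⁻¹) z y
    have h4 := lap_pw 0 1 ((t^2)⁻¹) 0 (z - y)
    rw [hΦ, h2]
    unfold kap
    rw [h1]
    simp only [zero_add, Nat.cast_zero] at h3 h4
    rw [h3, h4, ← qd_symm, sub_zero, norm_sub_rev]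
  have e1 : cv g (laplacian (kap N t)) z = ∫ y, g y * laplacian Φ y := by
    unfold cv; congr 1; ext y; rw [hl]
  rw [e1, e]
  unfold ph ff
  rw [← integral_const_mul, ← integral_const_mul]
  congr 1
  · congr 1; ext y; simp only [hΦ]; ring
  · congr 1; ext y; simp only [hΦ]; ring

lemma inv_anti {m : ℕ} {t τ : ℝ} (ht : 0 < t) (h : t < τ) : (τ^m)⁻¹ ≤ (t^m)⁻¹ := by
  apply inv_anti₀ (by positivity)
  exact pow_le_pow_left₀ ht.le h.le m

lemma GD.ph_deriv (h : GD Ω w g b x0 B Cg CB D cg r0 cb) {t : ℝ} (ht : 0 < t) {z : Eu N}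
    (hz : ∀ y, dist y z < t → b y = 0) :
    HasDerivAt (fun τ => ph g τ z)
      (t * (t^N)⁻¹ / 8 * ∫ y, ff w g y * pw 4 (qd 1 ((t^2)⁻¹) z y)) t := by
  have hd := deriv_int h.gi (k := fun τ y => (τ^N)⁻¹ * pw 3 (qd 1 ((τ^2)⁻¹) z y))
    (k' := fun τ y => -(N * (τ^(N+1))⁻¹) * pw 3 (qd 1 ((τ^2)⁻¹) z y) +
      (τ^N)⁻¹ * (3 * pw 2 (qd 1 ((τ^2)⁻¹) z y) * (2 * (τ^3)⁻¹ * ‖y - z‖^2)))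
    (t := t) (C := (N + 6) * ((t/2)^(N+1))⁻¹) (C0 := (t^N)⁻¹) ht
    (fun τ => continuous_const.mul (pwq_cont _ _ _)) ?_ ?_ ?_ ?_
  · have e1 : (fun τ => ph g τ z) = fun τ => ∫ y, g y * ((τ^N)⁻¹ * pw 3 (qd 1 ((τ^2)⁻¹) z y)) := by
      ext τ; unfold ph; rw [← integral_const_mul]; congr 1; ext y; ring
    rw [e1]
    refine hd.congr_deriv ?_
    set Φ : Eu N → ℝ := fun y => (t * (t^N)⁻¹ / 8) * pw 4 (qd 1 ((t^2)⁻¹) z y) with hΦ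
    have c1 : ContDiff ℝ 2 (fun y => pw 4 (qd 1 ((t^2)⁻¹) z y)) := (pw_contDiff 1).comp (qd_contDiff _ _ _)
    have hΦc : ContDiff ℝ 2 Φ := contDiff_const.mul c1
    have hΦs : HasCompactSupport Φ := (pwq_hcs 3 ht z).mul_left
    have e := h.eqn Φ hΦc hΦs
    have e2 : ∀ y, b y * Φ y = 0 := by
      intro y
      rcases lt_or_ge (dist y z) t with hy | hy
      · rw [hz y hy, zero_mul]
      · simp only [hΦ]; rw [pw_of_nonpos 3 (qd_nonpos ht hy)]; ring
    simp only [e2, integral_zero, sub_zero] at e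
    rw [← integral_const_mul]
    have e3 : ∫ y, t * (t^N)⁻¹ / 8 * (ff w g y * pw 4 (qd 1 ((t^2)⁻¹) z y)) = ∫ y, Real.exp (w y) * g y * Φ y := by
      congr 1; ext y; simp only [hΦ, ff]; ring
    rw [e3, ← e]
    congr 1; ext y
    have h3 := lap_pw 1 1 ((t^2)⁻¹) z y
    rw [hΦ, lap_cmul (u := fun y => pw 4 (qd 1 ((t^2)⁻¹) z y)) _ c1.contDiffAt]
    norm_num at h3
    rw [h3]
    field_simp
    ring
  · intro y
    rw [abs_of_nonneg (mul_nonneg (by positivity) (pw_nonneg _ _))]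
    exact mul_le_of_le_one_right (by positivity) (pw_le_one (qd_le_one _ _))
  · have := pwq_cont (N := N) 3 ((t^2)⁻¹) z
    have := pwq_cont (N := N) 2 ((t^2)⁻¹) z
    fun_prop
  · intro τ hτ y
    have hτ0 : 0 < τ := by linarith
    refine ((invpow_deriv N hτ0).mul ((pw_hasDerivAt 1 _).comp τ (qd_deriv hτ0 z y))).congr_deriv ?_
    norm_num
  · intro τ hτ y
    have hτ0 : 0 < τ := by linarith
    have h1 := pw_nonneg 3 (qd 1 ((τ^2)⁻¹) z y)
    have h2 : pw 3 (qd 1 ((τ^2)⁻¹) z y) ≤ 1 := pw_le_one (qd_le_one _ _)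
    have h3 := pw_nonneg 2 (qd 1 ((τ^2)⁻¹) z y)
    have h4 : pw 2 (qd 1 ((τ^2)⁻¹) z y) ≤ 1 := pw_le_one (qd_le_one _ _)
    have h5 := rho_pw hτ0 1 z y
    norm_num at h5
    set p3 := pw 3 (qd 1 ((τ^2)⁻¹) z y)
    set p2 := pw 2 (qd 1 ((τ^2)⁻¹) z y)
    have h6 : ‖y - z‖^2 * p2 ≤ τ^2 := by nlinarith [norm_nonneg (y - z)]
    have h7 := inv_anti (m := N + 1) (by linarith : 0 < t/2) hτ
    have h8 : 0 < (τ^(N+1))⁻¹ := by positivity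
    have h9 : (τ^N)⁻¹ * (3 * p2 * (2 * (τ^3)⁻¹ * ‖y - z‖^2)) ≤ 6 * (τ^(N+1))⁻¹ := by
      have : (τ^N)⁻¹ * (3 * p2 * (2 * (τ^3)⁻¹ * ‖y - z‖^2)) = 6 * (τ^(N+1))⁻¹ * ((τ^2)⁻¹ * (‖y - z‖^2 * p2)) := by
        field_simp
        ring
      rw [this]
      apply mul_le_of_le_one_right (by positivity)
      rw [inv_mul_eq_div, div_le_one (by positivity)]
      exact h6
    have h10 : 0 ≤ (τ^N)⁻¹ * (3 * p2 * (2 * (τ^3)⁻¹ * ‖y - z‖^2)) := by positivity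
    have h11 : 0 ≤ (N * (τ^(N+1))⁻¹) * p3 := by positivity
    have h12 : (N * (τ^(N+1))⁻¹) * p3 ≤ N * (τ^(N+1))⁻¹ := mul_le_of_le_one_right (by positivity) h2
    have h13 : (N + 6) * (τ^(N+1))⁻¹ ≤ (N + 6) * ((t/2)^(N+1))⁻¹ :=
      mul_le_mul_of_nonneg_left h7 (by positivity)
    have h14 : 0 ≤ N * (τ^(N+1))⁻¹ := by positivity
    rw [abs_le]
    constructor <;> nlinarith

end d1

section d2
variable {N : ℕ} {Ω : Set (Eu N)} {w g b : Eu N → ℝ} {x0 : Eu N} {B Cg CB D cg r0 cb : ℝ}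

lemma coord_le (x : Eu N) (i : Fin N) : |x i| ≤ ‖x‖ := PiLp.norm_apply_le x i

lemma coordsub_le (y z : Eu N) (i : Fin N) : |y i - z i| ≤ ‖y - z‖ := by
  simpa using coord_le (y - z) i

lemma GD.dph_deriv (h : GD Ω w g b x0 B Cg CB D cg r0 cb) {t : ℝ} (ht : 0 < t) {z : Eu N} (i : Fin N)
    (hz : ∀ y, dist y z < t → b y = 0) :
    HasDerivAt (fun τ => dph i g τ z)
      (t * (t^(N+2))⁻¹ * ∫ y, ff w g y * ((y i - z i) * pw 3 (qd 1 ((t^2)⁻¹) z y))) t := by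
  have hci : Continuous (fun y : Eu N => y i - z i) := (coord_contDiff (n := 2) i).continuous.sub continuous_const
  have hd := deriv_int h.gi (k := fun τ y => (τ^N)⁻¹ * (6 * (τ^2)⁻¹ * (y i - z i) * pw 2 (qd 1 ((τ^2)⁻¹) z y)))
    (k' := fun τ y => 6 * (y i - z i) * (-((N+2:ℕ) * (τ^(N+3))⁻¹) * pw 2 (qd 1 ((τ^2)⁻¹) z y) +
      (τ^(N+2))⁻¹ * (2 * pw 1 (qd 1 ((τ^2)⁻¹) z y) * (2 * (τ^3)⁻¹ * ‖y - z‖^2))))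
    (t := t) (C := (6 * (N + 2) + 24) * ((t/2)^(N+2))⁻¹) (C0 := (t^N)⁻¹ * (6 * (t^2)⁻¹ * t)) ht
    (fun τ => continuous_const.mul ((continuous_const.mul hci).mul (pwq_cont _ _ _))) ?_ ?_ ?_ ?_
  · refine hd.congr_deriv ?_
    set p3 : Eu N → ℝ := fun y => pw 3 (qd 1 ((t^2)⁻¹) z y) with hp3
    have c1 : ContDiff ℝ 2 p3 := (pw_contDiff 0).comp (qd_contDiff _ _ _)
    have c2 : ContDiff ℝ 2 (fun y : Eu N => y i - z i) := (coord_contDiff i).sub contDiff_const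
    set Φ : Eu N → ℝ := fun y => (t * (t^(N+2))⁻¹) * ((y i - z i) * p3 y) with hΦ
    have c3 : ContDiff ℝ 2 (fun y : Eu N => (y i - z i) * p3 y) := c2.mul c1
    have hΦc : ContDiff ℝ 2 Φ := contDiff_const.mul c3
    have hΦs : HasCompactSupport Φ := ((pwq_hcs 2 ht z).mul_left (f := fun y : Eu N => y i - z i)).mul_left
    have e := h.eqn Φ hΦc hΦs
    have e2 : ∀ y, b y * Φ y = 0 := by
      intro y
      rcases lt_or_ge (dist y z) t with hy | hy
      · rw [hz y hy, zero_mul]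
      · simp only [hΦ, hp3]; rw [pw_of_nonpos 2 (qd_nonpos ht hy)]; ring
    simp only [e2, integral_zero, sub_zero] at e
    rw [← integral_const_mul]
    have e3 : ∫ y, t * (t^(N+2))⁻¹ * (ff w g y * ((y i - z i) * p3 y)) = ∫ y, Real.exp (w y) * g y * Φ y := by
      congr 1; ext y; simp only [hΦ, ff]; ring
    rw [e3, ← e]
    congr 1; ext y
    have h3 := lap_pw 0 1 ((t^2)⁻¹) z y
    have h5 : laplacian (fun y : Eu N => y i - z i) y = 0 := by
      rw [lap_sub (u := fun y : Eu N => y i) (v := fun _ => z i) (coord_contDiff i).contDiffAt contDiffAt_const, lap_const, sub_zero,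
        lap_eq (coord_contDiff i).contDiffAt]
      refine Finset.sum_eq_zero fun j _ => ?_
      have : pd j (fun y : Eu N => y i) = fun _ => if j = i then 1 else 0 := funext fun x => pd_coord j i x
      rw [this, pd_const]
    have h6 : ∑ j, pd j (fun y : Eu N => y i - z i) y * pd j p3 y = pd i p3 y := by
      rw [Finset.sum_eq_single i]
      · rw [pd_sub (u := fun y : Eu N => y i) (v := fun _ => z i) ((coord_contDiff (n := 2) i).differentiable (by norm_num)).differentiableAt (differentiableAt_const _), pd_coord, pd_const]
        simp
      · intro j _ hj
        rw [pd_sub (u := fun y : Eu N => y i) (v := fun _ => z i) ((coord_contDiff (n := 2) i).differentiable (by norm_num)).differentiableAt (differentiableAt_const _), pd_coord, pd_const]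
        simp [hj]
      · simp
    rw [hΦ, lap_cmul (u := fun y => (y i - z i) * p3 y) _ c3.contDiffAt, lap_mul c2.contDiffAt c1.contDiffAt, h5, h6]
    have h7 := pd_pw 1 1 ((t^2)⁻¹) z y i
    norm_num at h3 h7
    rw [hp3, h3, h7]
    push_cast
    field_simp
    ring
  · intro y
    rw [abs_mul, abs_mul, abs_mul, abs_of_nonneg (by positivity : 0 ≤ (t^N)⁻¹), abs_of_nonneg (by positivity : 0 ≤ 6 * (t^2)⁻¹),
      abs_of_nonneg (pw_nonneg 2 _), mul_assoc (6 * (t^2)⁻¹)]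
    refine mul_le_mul_of_nonneg_left (mul_le_mul_of_nonneg_left ?_ (by positivity)) (by positivity)
    have h1 := coordsub_le y z i
    have h2 := rho_pw ht 1 z y
    norm_num at h2
    have h3 := pw_nonneg 2 (qd 1 ((t^2)⁻¹) z y)
    have h4 : pw 2 (qd 1 ((t^2)⁻¹) z y) ≤ 1 := pw_le_one (qd_le_one _ _)
    nlinarith
  · have := pwq_cont (N := N) 1 ((t^2)⁻¹) z
    have := pwq_cont (N := N) 2 ((t^2)⁻¹) z
    fun_prop
  · intro τ hτ y
    have hτ0 : 0 < τ := by linarith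
    have e : ∀ᶠ τ in 𝓝 τ, (τ^N)⁻¹ * (6 * (τ^2)⁻¹ * (y i - z i) * pw 2 (qd 1 ((τ^2)⁻¹) z y)) =
        6 * (y i - z i) * ((τ^(N+2))⁻¹ * pw 2 (qd 1 ((τ^2)⁻¹) z y)) := by
      refine Eventually.of_forall fun s => ?_
      rw [pow_add, mul_inv]; ring
    refine HasDerivAt.congr_of_eventuallyEq ?_ e
    refine (((invpow_deriv (N+2) hτ0).mul ((pw_hasDerivAt 0 _).comp τ (qd_deriv hτ0 z y))).const_mul (6 * (y i - z i))).congr_deriv ?_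
    norm_num
  · intro τ hτ y
    have hτ0 : 0 < τ := by linarith
    have h3 := pw_nonneg 2 (qd 1 ((τ^2)⁻¹) z y)
    have h4 : pw 2 (qd 1 ((τ^2)⁻¹) z y) ≤ 1 := pw_le_one (qd_le_one _ _)
    have h5 := rho_pw hτ0 1 z y
    have h3' := pw_nonneg 1 (qd 1 ((τ^2)⁻¹) z y)
    have h4' : pw 1 (qd 1 ((τ^2)⁻¹) z y) ≤ 1 := pw_le_one (qd_le_one _ _)
    have h5' := rho_pw hτ0 0 z y
    norm_num at h5 h5'
    set p1 := pw 1 (qd 1 ((τ^2)⁻¹) z y)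
    set p2 := pw 2 (qd 1 ((τ^2)⁻¹) z y)
    have hr := norm_nonneg (y - z)
    have hx := coordsub_le y z i
    have h6 : ‖y - z‖^3 * p1 ≤ τ^3 := by
      have a1 : ‖y - z‖ * (‖y - z‖ * p1) ≤ ‖y - z‖ * (τ * p1) := mul_le_mul_of_nonneg_left h5' hr
      have a2 : ‖y - z‖ * (‖y - z‖ * (‖y - z‖ * p1)) ≤ ‖y - z‖ * (‖y - z‖ * (τ * p1)) :=
        mul_le_mul_of_nonneg_left a1 hr
      have a3 : τ * (‖y - z‖ * (‖y - z‖ * p1)) ≤ τ * (‖y - z‖ * (τ * p1)) := mul_le_mul_of_nonneg_left a1 hτ0.le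
      have a4 : τ * τ * (‖y - z‖ * p1) ≤ τ * τ * (τ * p1) := mul_le_mul_of_nonneg_left h5' (by positivity)
      have a5 : τ^3 * p1 ≤ τ^3 := mul_le_of_le_one_right (by positivity) h4'
      nlinarith
    have h6' : ‖y - z‖ * p2 ≤ τ := h5.trans (mul_le_of_le_one_right hτ0.le h4)
    have h7 := inv_anti (m := N + 2) (by linarith : 0 < t/2) hτ
    have h8 : 0 < (τ^(N+2))⁻¹ := by positivity
    have h9 : |6 * (y i - z i) * (-((N+2:ℕ) * (τ^(N+3))⁻¹) * p2)| ≤ 6 * (N + 2) * (τ^(N+2))⁻¹ := by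
      have : |6 * (y i - z i) * (-((N+2:ℕ) * (τ^(N+3))⁻¹) * p2)| = 6 * (N+2) * (τ^(N+3))⁻¹ * (|y i - z i| * p2) := by
        rw [abs_mul, abs_mul, abs_mul, abs_neg, abs_of_nonneg h3, abs_of_nonneg (by positivity : (0:ℝ) ≤ (N+2:ℕ) * (τ^(N+3))⁻¹)]
        push_cast; norm_num; ring
      rw [this]
      have q1 : |y i - z i| * p2 ≤ τ := (mul_le_mul_of_nonneg_right hx h3).trans h6'
      have q2 := mul_le_mul_of_nonneg_left q1 (by positivity : 0 ≤ 6 * ((N:ℝ)+2) * (τ^(N+3))⁻¹)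
      refine q2.trans (le_of_eq ?_)
      field_simp
      ring
    have h10 : |6 * (y i - z i) * ((τ^(N+2))⁻¹ * (2 * p1 * (2 * (τ^3)⁻¹ * ‖y - z‖^2)))| ≤ 24 * (τ^(N+2))⁻¹ := by
      have : |6 * (y i - z i) * ((τ^(N+2))⁻¹ * (2 * p1 * (2 * (τ^3)⁻¹ * ‖y - z‖^2)))| = 24 * (τ^(N+2))⁻¹ * (τ^3)⁻¹ * (|y i - z i| * (‖y - z‖^2 * p1)) := by
        rw [abs_mul, abs_mul, abs_of_nonneg (by positivity : 0 ≤ (τ^(N+2))⁻¹ * (2 * p1 * (2 * (τ^3)⁻¹ * ‖y - z‖^2)))]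
        norm_num; ring
      rw [this]
      have q1 : |y i - z i| * (‖y - z‖^2 * p1) ≤ τ^3 := by
        have := mul_le_mul_of_nonneg_right hx (by positivity : 0 ≤ ‖y - z‖^2 * p1)
        linarith
      have q2 := mul_le_mul_of_nonneg_left q1 (by positivity : 0 ≤ 24 * (τ^(N+2))⁻¹ * (τ^3)⁻¹)
      refine q2.trans (le_of_eq ?_)
      field_simp
    have h13 : (6 * (N + 2) + 24) * (τ^(N+2))⁻¹ ≤ (6 * (N + 2) + 24) * ((t/2)^(N+2))⁻¹ :=
      mul_le_mul_of_nonneg_left h7 (by positivity)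
    rw [mul_add]
    refine (abs_add_le _ _).trans ?_
    linarith

end d2

section d3
variable {N : ℕ} {Ω : Set (Eu N)} {w g b : Eu N → ℝ} {x0 : Eu N} {B Cg CB D cg r0 cb : ℝ}

lemma pq_nonneg {f : Eu N → ℝ} (hf : ∀ x, 0 ≤ f x) {t : ℝ} (ht : 0 < t) (z : Eu N) : 0 ≤ pq f t z :=
  mul_nonneg (by positivity) (integral_nonneg hf)

lemma ph_nonneg {f : Eu N → ℝ} (hf : ∀ x, 0 ≤ f x) {t : ℝ} (ht : 0 < t) (z : Eu N) : 0 ≤ ph f t z :=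
  mul_nonneg (by positivity) (integral_nonneg fun y => mul_nonneg (hf y) (pw_nonneg _ _))

lemma kint_le {f k : Eu N → ℝ} (hf : Integrable f) (hfn : ∀ x, 0 ≤ f x) {t : ℝ} {z : Eu N} {C : ℝ}
    (hkc : Continuous k) (hks : HasCompactSupport k)
    (h0 : ∀ y, t ≤ dist y z → k y ≤ 0) (h1 : ∀ y, k y ≤ C) :
    ∫ y, f y * k y ≤ C * ∫ y in Metric.ball z t, f y := by
  rw [← integral_const_mul, ← integral_indicator Metric.isOpen_ball.measurableSet]
  refine integral_mono (bdd_int hf hkc hks) ((hf.const_mul C).indicator Metric.isOpen_ball.measurableSet) fun y => ?_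
  by_cases hy : y ∈ Metric.ball z t
  · simp only [indicator_of_mem hy]
    rw [mul_comm]
    exact mul_le_mul_of_nonneg_right (h1 y) (hfn y)
  · simp only [indicator_of_notMem hy]
    exact mul_nonpos_of_nonneg_of_nonpos (hfn y) (h0 y (by simpa using hy))

lemma kint_ge {f k : Eu N → ℝ} (hf : Integrable f) (hfn : ∀ x, 0 ≤ f x) {t : ℝ} {z : Eu N} {c : ℝ}
    (hkc : Continuous k) (hks : HasCompactSupport k)
    (h0 : ∀ y, 0 ≤ k y) (h1 : ∀ y, dist y z < t → c ≤ k y) :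
    c * ∫ y in Metric.ball z t, f y ≤ ∫ y, f y * k y := by
  rw [← integral_const_mul, ← integral_indicator Metric.isOpen_ball.measurableSet]
  refine integral_mono ((hf.const_mul c).indicator Metric.isOpen_ball.measurableSet) (bdd_int hf hkc hks) fun y => ?_
  by_cases hy : y ∈ Metric.ball z t
  · simp only [indicator_of_mem hy]
    rw [mul_comm]
    exact mul_le_mul_of_nonneg_left (h1 y hy) (hfn y)
  · simp only [indicator_of_notMem hy]
    exact mul_nonneg (hfn y) (h0 y)

lemma ball_mono_int {f : Eu N → ℝ} (hf : Integrable f) (hfn : ∀ x, 0 ≤ f x) {t s : ℝ} {z y : Eu N}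
    (h : Metric.ball z t ⊆ Metric.ball y s) :
    ∫ x in Metric.ball z t, f x ≤ ∫ x in Metric.ball y s, f x :=
  setIntegral_mono_set hf.integrableOn (Eventually.of_forall hfn) h.eventuallyLE

lemma ph_ge {f : Eu N → ℝ} (hf : Integrable f) (hfn : ∀ x, 0 ≤ f x) {t : ℝ} (ht : 0 < t) (z : Eu N) :
    27/64 * (2^N)⁻¹ * pq f (t/2) z ≤ ph f t z := by
  have h := kint_ge hf hfn (t := t/2) (z := z) (c := 27/64) (pwq_cont 3 ((t^2)⁻¹) z) (pwq_hcs 2 ht z)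
    (fun y => pw_nonneg _ _) (fun y hy => by
      have := qd_ge ht hy.le
      rw [pw_of_nonneg _ (by linarith)]
      calc (27/64:ℝ) = (3/4)^3 := by norm_num
        _ ≤ _ := pow_le_pow_left₀ (by norm_num) this 3)
  have h2 := mul_le_mul_of_nonneg_left h (by positivity : 0 ≤ (t^N)⁻¹)
  unfold ph pq
  refine le_trans (le_of_eq ?_) h2
  rw [div_pow]; field_simp

lemma ph_le {f : Eu N → ℝ} (hf : Integrable f) (hfn : ∀ x, 0 ≤ f x) {t : ℝ} (ht : 0 < t) (z : Eu N) :
    ph f t z ≤ pq f t z := by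
  have h := kint_le hf hfn (t := t) (z := z) (C := 1) (pwq_cont 3 ((t^2)⁻¹) z) (pwq_hcs 2 ht z)
    (fun y hy => (pw_of_nonpos 2 (qd_nonpos ht hy)).le) (fun y => pw_le_one (qd_le_one _ _))
  rw [one_mul] at h
  exact mul_le_mul_of_nonneg_left h (by positivity)

set_option maxHeartbeats 1000000 in
lemma dph_bound {f : Eu N → ℝ} (hf : Integrable f) (hfn : ∀ x, 0 ≤ f x) {t : ℝ} (ht : 0 < t) (z : Eu N) (i : Fin N) :
    |dph i f t z| ≤ 15 * 2^N * (ph f (2*t) z / t) := by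
  have hci : Continuous (fun y : Eu N => y i - z i) := (coord_contDiff (n := 2) i).continuous.sub continuous_const
  have h2 := ph_ge hf hfn (t := 2*t) (by linarith) z
  have e : 2*t/2 = t := by ring
  rw [e] at h2
  have h1 : |dph i f t z| ≤ 6 / t * pq f t z := by
    unfold dph
    have hk := kint_le hf hfn (t := t) (z := z) (C := (t^N)⁻¹ * (6 * (t^2)⁻¹ * t))
      (k := fun y => |(t^N)⁻¹ * (6 * (t^2)⁻¹ * (y i - z i) * pw 2 (qd 1 ((t^2)⁻¹) z y))|)
      (continuous_const.mul ((continuous_const.mul hci).mul (pwq_cont _ _ _))).abs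
      (HasCompactSupport.intro (isCompact_closedBall z t) fun y hy => by
        have hy' : t ≤ dist y z := le_of_lt (by simpa using hy)
        simp only [pw_of_nonpos 1 (qd_nonpos ht hy'), mul_zero, abs_zero])
      (fun y hy => by rw [pw_of_nonpos 1 (qd_nonpos ht hy)]; simp) (fun y => by
        rw [abs_mul, abs_mul, abs_mul, abs_of_nonneg (by positivity : 0 ≤ (t^N)⁻¹), abs_of_nonneg (by positivity : 0 ≤ 6 * (t^2)⁻¹),
          abs_of_nonneg (pw_nonneg 2 _), mul_assoc (6 * (t^2)⁻¹)]
        refine mul_le_mul_of_nonneg_left (mul_le_mul_of_nonneg_left ?_ (by positivity)) (by positivity)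
        have h1 := coordsub_le y z i
        have h2 := rho_pw ht 1 z y
        norm_num at h2
        have h3 := pw_nonneg 2 (qd 1 ((t^2)⁻¹) z y)
        have h4 : pw 2 (qd 1 ((t^2)⁻¹) z y) ≤ 1 := pw_le_one (qd_le_one _ _)
        nlinarith)
    calc |∫ y, f y * ((t^N)⁻¹ * (6 * (t^2)⁻¹ * (y i - z i) * pw 2 (qd 1 ((t^2)⁻¹) z y)))|
        ≤ ∫ y, |f y * ((t^N)⁻¹ * (6 * (t^2)⁻¹ * (y i - z i) * pw 2 (qd 1 ((t^2)⁻¹) z y)))| := abs_integral_le_integral_abs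
      _ = ∫ y, f y * |(t^N)⁻¹ * (6 * (t^2)⁻¹ * (y i - z i) * pw 2 (qd 1 ((t^2)⁻¹) z y))| := by
          congr 1; ext y; rw [abs_mul, abs_of_nonneg (hfn y)]
      _ ≤ _ := hk
      _ = 6 / t * pq f t z := by unfold pq; field_simp
  refine h1.trans ?_
  have h3 : 15 * 2^N * (27/64 * (2^N)⁻¹ * pq f t z) ≤ 15 * 2^N * ph f (2*t) z :=
    mul_le_mul_of_nonneg_left h2 (by positivity)
  have h4 : (6:ℝ) * pq f t z ≤ 15 * 2^N * (27/64 * (2^N)⁻¹ * pq f t z) := by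
    have := pq_nonneg hfn ht z
    have e2 : (15:ℝ) * 2^N * (27/64 * (2^N)⁻¹ * pq f t z) = 15 * 27 / 64 * pq f t z := by field_simp
    rw [e2]; linarith
  rw [div_mul_eq_mul_div, mul_div_assoc', div_le_div_iff_of_pos_right ht]
  linarith

set_option maxHeartbeats 1000000 in
lemma GD.D1 (h : GD Ω w g b x0 B Cg CB D cg r0 cb) {t : ℝ} (ht : 0 < t) {z : Eu N}
    (hz : ∀ y, dist y z < t → b y = 0) :
    (4^N)⁻¹/128 * t^2 * pq (ff w g) (t/4) z ≤ ph g t z - ph g (t/2) z ∧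
    ph g t z - ph g (t/2) z ≤ 2^N * t^2 * pq (ff w g) t z := by
  obtain ⟨ξ, ⟨hξ1, hξ2⟩, hξ⟩ := exists_hasDerivAt_eq_slope (fun τ => ph g τ z)
    (fun t => t * (t^N)⁻¹ / 8 * ∫ y, ff w g y * pw 4 (qd 1 ((t^2)⁻¹) z y)) (a := t/2) (b := t) (by linarith)
    (fun τ hτ => (h.ph_deriv (by linarith [hτ.1]) (fun y hy => hz y (hy.trans_le hτ.2))).continuousAt.continuousWithinAt)
    (fun τ hτ => h.ph_deriv (by linarith [hτ.1]) (fun y hy => hz y (hy.trans hτ.2)))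
  have hξ0 : 0 < ξ := by linarith
  have e : ph g t z - ph g (t/2) z = t/2 * (ξ * (ξ^N)⁻¹ / 8 * ∫ y, ff w g y * pw 4 (qd 1 ((ξ^2)⁻¹) z y)) := by
    rw [hξ]; field_simp; ring
  rw [e]
  have hu := kint_le h.fi h.ffnn (t := t) (z := z) (C := 1) (pwq_cont 4 ((ξ^2)⁻¹) z) (pwq_hcs 3 hξ0 z)
    (fun y hy => (pw_of_nonpos 3 (qd_nonpos hξ0 (hξ2.le.trans hy))).le) (fun y => pw_le_one (qd_le_one _ _))
  have hl := kint_ge h.fi h.ffnn (t := t/4) (z := z) (c := 81/256) (pwq_cont 4 ((ξ^2)⁻¹) z) (pwq_hcs 3 hξ0 z)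
    (fun y => pw_nonneg _ _) (fun y hy => by
      have := qd_ge hξ0 (z := z) (y := y) (by linarith)
      rw [pw_of_nonneg _ (by linarith)]
      calc (81/256:ℝ) = (3/4)^4 := by norm_num
        _ ≤ _ := pow_le_pow_left₀ (by norm_num) this 4)
  set I := ∫ y, ff w g y * pw 4 (qd 1 ((ξ^2)⁻¹) z y)
  have i1 : (ξ^N)⁻¹ ≤ ((t/2)^N)⁻¹ := inv_anti (by linarith) hξ1
  have i2 : (t^N)⁻¹ ≤ (ξ^N)⁻¹ := inv_anti hξ0 hξ2
  have j1 : 0 ≤ ∫ y in Metric.ball z t, ff w g y := integral_nonneg h.ffnn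
  have j2 : 0 ≤ ∫ y in Metric.ball z (t/4), ff w g y := integral_nonneg h.ffnn
  have hI : 0 ≤ I := integral_nonneg fun y => mul_nonneg (h.ffnn y) (pw_nonneg _ _)
  constructor
  · unfold pq
    calc (4^N)⁻¹/128 * t^2 * (((t/4)^N)⁻¹ * ∫ y in Metric.ball z (t/4), ff w g y)
        = t/2 * ((t/2) * (t^N)⁻¹/8 * ((1/4) * ∫ y in Metric.ball z (t/4), ff w g y)) := by
          rw [div_pow]; field_simp; norm_num; try ring
      _ ≤ _ := by
          gcongr
          linarith
  · unfold pq
    calc t/2 * (ξ * (ξ^N)⁻¹ / 8 * I) ≤ t/2 * (t * ((t/2)^N)⁻¹ / 8 * (1 * ∫ y in Metric.ball z t, ff w g y)) := by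
          gcongr
      _ = 1/16 * (2^N * t^2 * ((t^N)⁻¹ * ∫ y in Metric.ball z t, ff w g y)) := by
          rw [div_pow]; field_simp; norm_num; try ring
      _ ≤ _ := by
          have : 0 ≤ 2^N * t^2 * ((t^N)⁻¹ * ∫ y in Metric.ball z t, ff w g y) := by positivity
          linarith

set_option maxHeartbeats 1000000 in
lemma GD.D2 (h : GD Ω w g b x0 B Cg CB D cg r0 cb) {t : ℝ} (ht : 0 < t) {z : Eu N} (i : Fin N)
    (hz : ∀ y, dist y z < t → b y = 0) :
    |dph i g t z - dph i g (t/2) z| ≤ 2^N * t * pq (ff w g) t z := by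
  have hci : Continuous (fun y : Eu N => y i - z i) := (coord_contDiff (n := 2) i).continuous.sub continuous_const
  obtain ⟨ξ, ⟨hξ1, hξ2⟩, hξ⟩ := exists_hasDerivAt_eq_slope (fun τ => dph i g τ z)
    (fun t => t * (t^(N+2))⁻¹ * ∫ y, ff w g y * ((y i - z i) * pw 3 (qd 1 ((t^2)⁻¹) z y))) (a := t/2) (b := t) (by linarith)
    (fun τ hτ => (h.dph_deriv (by linarith [hτ.1]) i (fun y hy => hz y (hy.trans_le hτ.2))).continuousAt.continuousWithinAt)
    (fun τ hτ => h.dph_deriv (by linarith [hτ.1]) i (fun y hy => hz y (hy.trans hτ.2)))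
  have hξ0 : 0 < ξ := by linarith
  have e : dph i g t z - dph i g (t/2) z = t/2 * (ξ * (ξ^(N+2))⁻¹ * ∫ y, ff w g y * ((y i - z i) * pw 3 (qd 1 ((ξ^2)⁻¹) z y))) := by
    rw [hξ]; field_simp; ring
  have hu := kint_le h.fi h.ffnn (t := t) (z := z) (C := ξ) (k := fun y => |(y i - z i) * pw 3 (qd 1 ((ξ^2)⁻¹) z y)|)
    (hci.mul (pwq_cont 3 ((ξ^2)⁻¹) z)).abs (HasCompactSupport.intro (isCompact_closedBall z ξ) fun y hy => by
        have hy' : ξ ≤ dist y z := le_of_lt (by simpa using hy)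
        simp only [pw_of_nonpos 2 (qd_nonpos hξ0 hy'), mul_zero, abs_zero])
    (fun y hy => by rw [pw_of_nonpos 2 (qd_nonpos hξ0 (hξ2.le.trans hy))]; simp) (fun y => by
      rw [abs_mul, abs_of_nonneg (pw_nonneg 3 _)]
      have h1 := coordsub_le y z i
      have h2 := rho_pw hξ0 2 z y
      norm_num at h2
      have h3 := pw_nonneg 3 (qd 1 ((ξ^2)⁻¹) z y)
      have h4 : pw 3 (qd 1 ((ξ^2)⁻¹) z y) ≤ 1 := pw_le_one (qd_le_one _ _)
      nlinarith)
  have hI : |∫ y, ff w g y * ((y i - z i) * pw 3 (qd 1 ((ξ^2)⁻¹) z y))| ≤ ξ * ∫ y in Metric.ball z t, ff w g y := by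
    refine (abs_integral_le_integral_abs).trans (le_trans (le_of_eq ?_) hu)
    congr 1; ext y; rw [abs_mul, abs_of_nonneg (h.ffnn y)]
  have i1 : (ξ^N)⁻¹ ≤ ((t/2)^N)⁻¹ := inv_anti (by linarith) hξ1
  have j1 : 0 ≤ ∫ y in Metric.ball z t, ff w g y := integral_nonneg h.ffnn
  rw [e, abs_mul, abs_mul, abs_of_nonneg (by positivity : 0 ≤ t/2), abs_of_nonneg (by positivity : 0 ≤ ξ * (ξ^(N+2))⁻¹)]
  unfold pq
  calc t/2 * (ξ * (ξ^(N+2))⁻¹ * |∫ y, ff w g y * ((y i - z i) * pw 3 (qd 1 ((ξ^2)⁻¹) z y))|)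
      ≤ t/2 * (ξ * (ξ^(N+2))⁻¹ * (ξ * ∫ y in Metric.ball z t, ff w g y)) := by gcongr
    _ = t/2 * ((ξ^N)⁻¹ * ∫ y in Metric.ball z t, ff w g y) := by
        rw [pow_add]; field_simp
    _ ≤ t/2 * (((t/2)^N)⁻¹ * ∫ y in Metric.ball z t, ff w g y) := by gcongr
    _ = 1/2 * (2^N * t * ((t^N)⁻¹ * ∫ y in Metric.ball z t, ff w g y)) := by
        rw [div_pow]; field_simp
    _ ≤ _ := by
        have : 0 ≤ 2^N * t * ((t^N)⁻¹ * ∫ y in Metric.ball z t, ff w g y) := by positivity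
        linarith

end d3

section seqlem

lemma sum_sq_le (p : ℕ → ℝ) (hp : ∀ j, 0 ≤ p j) (M : ℕ) : ∀ m k, k + m = M →
    (∑ i ∈ Finset.Ico k M, p i)^2 ≤ 2 * ∑ j ∈ Finset.Ico k M, p j * ∑ i ∈ Finset.Ico j M, p i := by
  intro m
  induction m with
  | zero => intro k hk; simp at hk; subst hk; simp
  | succ m ih =>
    intro k hk
    have hkM : k < M := by omega
    have h1 := ih (k+1) (by omega)
    rw [Finset.sum_eq_sum_Ico_succ_bot hkM (fun j => p j * ∑ i ∈ Finset.Ico j M, p i)]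
    rw [Finset.sum_eq_sum_Ico_succ_bot hkM p]
    nlinarith [sq_nonneg (p k)]

set_option maxHeartbeats 1000000 in
lemma seq_main (C : ℝ) (hC : 1 ≤ C) (k0 : ℕ) : ∃ CH : ℝ, 0 ≤ CH ∧ ∀ (φ p ρ : ℕ → ℝ) (n : ℕ) (η d : ℝ),
    k0 ≤ n → 0 < η → η ≤ 1 →
    (∀ k, 0 ≤ φ k) → (∀ k, k0 ≤ k → φ (k+1) ≤ φ k) → (∀ k, φ k ≤ C) → (∀ k, 0 ≤ p k) →
    (∀ k, 1 ≤ ρ k) → (∀ k, ρ k^4 = 1 + φ k/η^4) →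
    φ (n+5) ≤ 2*η^4 → φ n ≤ 4*η^4 →
    (∀ k, k0 ≤ k → k ≤ n → φ (k+5) - φ (n+5) ≤ C * (1/2)^k * ∑ i ∈ Finset.Ico k (n+1), p i) →
    0 ≤ d →
    (∀ k, k0 ≤ k → k ≤ n → d ≤ C * (φ k * 2^k + ∑ i ∈ Finset.Ico k (n+1), p i)) →
    d^2 ≤ CH * ((∑ j ∈ Finset.Ico k0 (n+1), p j * (ρ j^7)⁻¹ * ∑ i ∈ Finset.Ico j (n+1), p i) + η^7) := by
  set A : ℝ := 1024 * 8 * C^2 * 2^82 + C * 2^(2*(k0+5)) + 4^k0 with hA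
  refine ⟨2*C^2*(64*A + 256), by positivity, ?_⟩
  intro φ p ρ n η d hk0n hη hη1 hφ0 hφa hφC hp hρ1 hρ4 hG hφn hsum hd hdk
  set S : ℕ → ℝ := fun k => ∑ i ∈ Finset.Ico k (n+1), p i with hS
  set Bz := ∑ j ∈ Finset.Ico k0 (n+1), p j * (ρ j^7)⁻¹ * S j with hBz
  have hS0 : ∀ k, 0 ≤ S k := fun k => Finset.sum_nonneg fun i _ => hp i
  have hρ0 : ∀ k, 0 < ρ k := fun k => lt_of_lt_of_le one_pos (hρ1 k)
  have hη4 : 0 < η^4 := by positivity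
  have hanti : ∀ k l, k0 ≤ k → k ≤ l → φ l ≤ φ k := by
    intro k l hk hl
    induction l, hl using Nat.le_induction with
    | base => exact le_rfl
    | succ l hl ih => exact (hφa l (by omega)).trans ih
  have hρanti : ∀ k l, k0 ≤ k → k ≤ l → ρ l ≤ ρ k := by
    intro k l hk hl
    have : ρ l^4 ≤ ρ k^4 := by
      rw [hρ4, hρ4]; have := hanti k l hk hl; gcongr
    exact le_of_pow_le_pow_left₀ (by norm_num) (hρ0 k).le this
  have hB0 : 0 ≤ Bz := Finset.sum_nonneg fun j _ => by
    have := hρ0 j; have := hp j; have := hS0 j; positivity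
  have hBk : ∀ k, k0 ≤ k → k ≤ n → S k^2 ≤ 2 * ρ k^7 * Bz := by
    intro k hk hkn
    have h1 := sum_sq_le p hp (n+1) (n+1-k) k (by omega)
    have h2 : ∑ j ∈ Finset.Ico k (n+1), p j * S j ≤ ρ k^7 * Bz := by
      calc ∑ j ∈ Finset.Ico k (n+1), p j * S j ≤ ∑ j ∈ Finset.Ico k (n+1), ρ k^7 * (p j * (ρ j^7)⁻¹ * S j) := by
            refine Finset.sum_le_sum fun j hj => ?_
            have hj' := (Finset.mem_Ico.1 hj).1
            have h3 := hρanti k j hk hj'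
            have h4 : 1 ≤ ρ k^7 * (ρ j^7)⁻¹ := by
              rw [← div_eq_mul_inv, one_le_div (pow_pos (hρ0 j) 7)]
              exact pow_le_pow_left₀ (hρ0 j).le h3 7
            have h5 : 0 ≤ p j * S j := mul_nonneg (hp j) (hS0 j)
            calc p j * S j ≤ (ρ k^7 * (ρ j^7)⁻¹) * (p j * S j) := le_mul_of_one_le_left h5 h4
              _ = _ := by ring
        _ = ρ k^7 * ∑ j ∈ Finset.Ico k (n+1), (p j * (ρ j^7)⁻¹ * S j) := by rw [Finset.mul_sum]
        _ ≤ _ := by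
            have := hρ0 k
            refine mul_le_mul_of_nonneg_left ?_ (by positivity)
            refine Finset.sum_le_sum_of_subset_of_nonneg (Finset.Ico_subset_Ico hk le_rfl) fun j _ _ => ?_
            have := hρ0 j; have := hp j; have := hS0 j; positivity
    simp only [hS] at h1 h2 ⊢
    linarith
  have hex : ∃ k, k0 ≤ k ∧ φ k ≤ 4*η^4 := ⟨n, hk0n, hφn⟩
  classical
  obtain ⟨hk1a, hk1b⟩ := Nat.find_spec hex
  have hk1min := fun k => Nat.find_min hex (m := k)
  have hk1n : Nat.find hex ≤ n := Nat.find_min' hex ⟨hk0n, hφn⟩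
  set k1 := Nat.find hex with hk1
  have hρk1 : ρ k1 ≤ 2 := by
    have : ρ k1^4 ≤ 2^4 := by
      rw [hρ4]
      have : φ k1/η^4 ≤ 4 := by rw [div_le_iff₀ hη4]; exact hk1b
      linarith
    exact le_of_pow_le_pow_left₀ (by norm_num) (by norm_num) this
  have hSk1 : S k1^2 ≤ 256 * Bz := by
    have h1 := hBk k1 hk1a hk1n
    have h2 : ρ k1^7 ≤ 2^7 := pow_le_pow_left₀ (hρ0 k1).le hρk1 7
    nlinarith
  have key : (η^4*2^k1)^2 ≤ 4*A*(Bz+η^7) := by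
    have hη7 : 0 < η^7 := by positivity
    have hη87 : η^8 ≤ η^7 := by
      calc η^8 = η^7*η := by ring
        _ ≤ η^7*1 := by gcongr
        _ = _ := by ring
    rcases Nat.eq_or_lt_of_le hk1a with hc | hc
    · rw [← hc]
      have hA1 : (4:ℝ)^k0 ≤ A := by rw [hA]; have : 0 ≤ 1024 * 8 * C^2 * 2^82 + C * 2^(2*(k0+5)) := by positivity
                                    linarith
      have e : (η^4*2^k0)^2 = 4^k0 * η^8 := by
        rw [mul_pow, ← pow_mul, ← pow_mul, mul_comm k0 2, pow_mul 2 2 k0]; norm_num; ring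
      rw [e]
      have h4 : (0:ℝ) < 4^k0 := by positivity
      calc (4:ℝ)^k0*η^8 ≤ A*η^7 := by gcongr
        _ ≤ 4*A*(Bz+η^7) := by
          have : 0 ≤ A * Bz := by positivity
          have : 0 ≤ A * η^7 := by positivity
          linarith
    · obtain ⟨k2, hk2⟩ : ∃ k2, k1 = k2+1 := ⟨k1-1, by omega⟩
      have hk2a : k0 ≤ k2 := by omega
      have hφk2 : 4*η^4 < φ k2 := by
        have := hk1min k2 (by omega)
        push Not at this
        exact this hk2a
      obtain ⟨m', hm'mem, hm'max⟩ := Finset.exists_max_image (Finset.Icc k0 k2) (fun k => φ k * (2^k)^8)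
        ⟨k0, by simp; exact hk2a⟩
      have hm'1 := (Finset.mem_Icc.1 hm'mem).1
      have hm'2 := (Finset.mem_Icc.1 hm'mem).2
      have hmk2 := hm'max k2 (Finset.mem_Icc.2 ⟨hk2a, le_rfl⟩)
      have ek : (η^4*2^k1)^2 = 4*(η^4*2^k2)^2 := by rw [hk2, pow_succ]; ring
      rw [ek, mul_assoc]
      refine mul_le_mul_of_nonneg_left ?_ (by norm_num)
      by_cases hc5 : k0 + 5 ≤ m'
      · obtain ⟨m, rfl⟩ : ∃ m, m' = m+5 := ⟨m'-5, by omega⟩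
        have hmm := hm'max m (Finset.mem_Icc.2 ⟨by omega, by omega⟩)
        have h1 : φ m ≤ 2^40 * φ (m+5) := by
          have e : φ (m+5) * ((2:ℝ)^(m+5))^8 = (2^40*φ (m+5)) * (2^m)^8 := by rw [pow_add]; ring
          rw [e] at hmm
          exact le_of_mul_le_mul_right hmm (by positivity)
        have h2 : φ k2 ≤ φ (m+5) := hanti _ _ (by omega) hm'2
        have h3 := hsum m (by omega) (by omega)
        have h3' : φ (m+5)/2 ≤ C * (1/2)^m * S m := by linarith
        set X := φ (m+5)/η^4 with hX
        have hXe : φ (m+5) = X*η^4 := by rw [hX]; field_simp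
        have hX4 : 4 ≤ X := by rw [hX, le_div_iff₀ hη4]; linarith
        have h4 : ρ m^4 ≤ 2^41*X := by
          rw [hρ4]
          have : φ m/η^4 ≤ 2^40*X := by rw [hX, ← mul_div_assoc]; gcongr
          linarith
        have h5 : X ≤ ρ m^4 := by
          rw [hρ4]
          have := hanti m (m+5) (by omega) (by omega)
          have : X ≤ φ m/η^4 := by rw [hX]; gcongr
          linarith
        have h6 : (2^k2)^8 ≤ X * ((2:ℝ)^(m+5))^8 := by
          have : 4*η^4 * (2^k2)^8 ≤ φ (m+5) * ((2:ℝ)^(m+5))^8 :=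
            le_trans (mul_le_mul_of_nonneg_right hφk2.le (by positivity)) hmk2
          rw [hXe] at this
          have h8 : η^4 * (4*(2^k2)^8) ≤ η^4 * (X * ((2:ℝ)^(m+5))^8) := by linarith
          have := le_of_mul_le_mul_left h8 hη4
          have : (0:ℝ) ≤ (2^k2)^8 := by positivity
          linarith
        have h7 : ((2:ℝ)^k2)^2 ≤ ρ m * (2^(m+5))^2 := by
          have : (((2:ℝ)^k2)^2)^4 ≤ (ρ m * (2^(m+5))^2)^4 := by
            calc (((2:ℝ)^k2)^2)^4 = (2^k2)^8 := by rw [← pow_mul]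
              _ ≤ X * ((2:ℝ)^(m+5))^8 := h6
              _ ≤ ρ m^4 * ((2:ℝ)^(m+5))^8 := by gcongr
              _ = _ := by rw [mul_pow]; rw [← pow_mul ((2:ℝ)^(m+5)) 2 4]
          exact le_of_pow_le_pow_left₀ (by norm_num) (by have := hρ0 m; positivity) this
        -- S lower bound
        have h9 := hBk m (by omega) (by omega)
        have h10 : X*η^4*2^m ≤ 2*C*S m := by
          have : (0:ℝ) < 2^m := by positivity
          have e : C * (1/2)^m * S m * 2^m = C * S m := by
            rw [one_div, inv_pow]; field_simp
          have := mul_le_mul_of_nonneg_right h3' this.le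
          rw [e, hXe] at this
          linarith
        have h11 : (X*η^4*2^m)^2 ≤ (2*C*S m)^2 := pow_le_pow_left₀ (by positivity) h10 2
        have h12 : X^2*(η^4*2^m)^2 ≤ 8*C^2*ρ m^7*Bz := by
          calc X^2*(η^4*2^m)^2 = (X*η^4*2^m)^2 := by ring
            _ ≤ (2*C*S m)^2 := h11
            _ = 4*C^2*S m^2 := by ring
            _ ≤ 4*C^2*(2 * ρ m^7 * Bz) := by gcongr
            _ = _ := by ring
        have h13 : ρ m^8 ≤ 2^82*X^2 := by
          calc ρ m^8 = (ρ m^4)^2 := by ring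
            _ ≤ (2^41*X)^2 := by gcongr
            _ = _ := by ring
        have h14 : ρ m^7*(ρ m*(η^4*2^m)^2) ≤ ρ m^7*(8*C^2*2^82*Bz) := by
          calc ρ m^7*(ρ m*(η^4*2^m)^2) = ρ m^8*(η^4*2^m)^2 := by ring
            _ ≤ 2^82*X^2*(η^4*2^m)^2 := by gcongr
            _ = 2^82*(X^2*(η^4*2^m)^2) := by ring
            _ ≤ 2^82*(8*C^2*ρ m^7*Bz) := by gcongr
            _ = _ := by ring
        have h15 := le_of_mul_le_mul_left h14 (pow_pos (hρ0 m) 7)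
        calc (η^4*2^k2)^2 = η^8*(2^k2)^2 := by ring
          _ ≤ η^8*(ρ m * (2^(m+5))^2) := by gcongr
          _ = 1024*(ρ m*(η^4*2^m)^2) := by rw [pow_add]; ring
          _ ≤ 1024*(8*C^2*2^82*Bz) := by gcongr
          _ = (1024*8*C^2*2^82)*Bz := by ring
          _ ≤ A*(Bz+η^7) := by
            gcongr
            · rw [hA]; have : (0:ℝ) ≤ C * 2^(2*(k0+5)) := by positivity
              have : (0:ℝ) ≤ 4^k0 := by positivity
              linarith
            · linarith
      · push Not at hc5
        have h1 : 4*η^4*(2^k2)^8 ≤ C * (2^(k0+5))^8 := by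
          refine le_trans (mul_le_mul_of_nonneg_right hφk2.le (by positivity)) (hmk2.trans ?_)
          have : (2:ℝ)^m' ≤ 2^(k0+5) := pow_le_pow_right₀ (by norm_num) hc5.le
          have := hφC m'
          gcongr
        have h2 : η*(2^k2)^2 ≤ C*2^(2*(k0+5)) := by
          have : (η*(2^k2)^2)^4 ≤ (C*2^(2*(k0+5)))^4 := by
            calc (η*(2^k2)^2)^4 = η^4*(2^k2)^8 := by ring
              _ ≤ 4*η^4*(2^k2)^8 := by
                have : 0 ≤ η^4*(2^k2)^8 := by positivity
                linarith
              _ ≤ C * (2^(k0+5))^8 := h1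
              _ ≤ C^4 * (2^(k0+5))^8 := by
                gcongr
                exact le_self_pow₀ hC (by norm_num)
              _ = _ := by rw [mul_comm 2 (k0+5), pow_mul, mul_pow, ← pow_mul ((2:ℝ)^(k0+5)) 2 4]
          exact le_of_pow_le_pow_left₀ (by norm_num) (by positivity) this
        calc (η^4*2^k2)^2 = η^7*(η*(2^k2)^2) := by ring
          _ ≤ η^7*(C*2^(2*(k0+5))) := by gcongr
          _ = (C*2^(2*(k0+5)))*η^7 := by ring
          _ ≤ A*(Bz+η^7) := by
            gcongr
            · rw [hA]; have : (0:ℝ) ≤ 1024*8*C^2*2^82 := by positivity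
              have : (0:ℝ) ≤ 4^k0 := by positivity
              linarith
            · linarith
  have hd1 := hdk k1 hk1a hk1n
  have hd2 : d ≤ C*(4*(η^4*2^k1) + S k1) := by
    refine hd1.trans ?_
    have : φ k1*2^k1 ≤ 4*(η^4*2^k1) := by
      have := mul_le_mul_of_nonneg_right hk1b (by positivity : (0:ℝ) ≤ 2^k1)
      linarith
    gcongr
  have hη7 : 0 < η^7 := by positivity
  calc d^2 ≤ (C*(4*(η^4*2^k1) + S k1))^2 := pow_le_pow_left₀ hd hd2 2
    _ = C^2*(4*(η^4*2^k1) + S k1)^2 := by ring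
    _ ≤ C^2*(2*(16*(η^4*2^k1)^2 + S k1^2)) := by
      gcongr
      nlinarith [sq_nonneg (4*(η^4*2^k1) - S k1)]
    _ ≤ C^2*(2*(16*(4*A*(Bz+η^7)) + 256*Bz)) := by gcongr
    _ ≤ C^2*(2*(16*(4*A*(Bz+η^7)) + 256*(Bz+η^7))) := by gcongr; linarith
    _ = _ := by ring

section happ
variable {N : ℕ} {Ω : Set (Eu N)} {w g b : Eu N → ℝ} {x0 : Eu N} {B Cg CB D cg r0 cb : ℝ}

noncomputable def tk (k : ℕ) : ℝ := (1/2:ℝ)^k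
lemma tk_pos (k : ℕ) : 0 < tk k := by unfold tk; positivity
lemma tk_succ (k : ℕ) : tk (k+1) = tk k / 2 := by unfold tk; rw [pow_succ]; ring
lemma tk_anti {k l : ℕ} (h : k ≤ l) : tk l ≤ tk k := pow_le_pow_of_le_one (by norm_num) (by norm_num) h
lemma tk_le_one (k : ℕ) : tk k ≤ 1 := pow_le_one₀ (by norm_num) (by norm_num)
lemma tk_add (k : ℕ) (m : ℕ) : tk (k+m) = tk k * tk m := by unfold tk; rw [pow_add]
lemma tk_inv (k : ℕ) : tk k * 2^k = 1 := by unfold tk; rw [← mul_pow]; norm_num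
lemma tk_tendsto : Tendsto tk atTop (𝓝 0) := tendsto_pow_atTop_nhds_zero_of_lt_one (by norm_num) (by norm_num)

noncomputable def v1 (N : ℕ) : ℝ := (volume (Metric.ball (0 : Eu N) 1)).toReal
lemma v1_pos : 0 < v1 N := ENNReal.toReal_pos (Metric.measure_ball_pos _ _ one_pos).ne' measure_ball_lt_top.ne

lemma vol_ball (z : Eu N) {t : ℝ} (ht : 0 < t) : (volume (Metric.ball z t)).toReal = t^N * v1 N := by
  rw [Measure.addHaar_ball_of_pos volume z ht, ENNReal.toReal_mul, finrank_euclideanSpace_fin,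
    ENNReal.toReal_ofReal (by positivity), v1]

lemma pq_le_of {f : Eu N → ℝ} (hf : Integrable f) {t : ℝ} (ht : 0 < t) (z : Eu N) {M : ℝ}
    (h : ∀ y ∈ Metric.ball z t, f y ≤ M) : pq f t z ≤ M * v1 N := by
  unfold pq
  have h1 : ∫ y in Metric.ball z t, f y ≤ ∫ y in Metric.ball z t, M :=
    setIntegral_mono_on hf.integrableOn (integrableOn_const measure_ball_lt_top.ne) Metric.isOpen_ball.measurableSet h
  rw [setIntegral_const, Measure.real, vol_ball z ht, smul_eq_mul] at h1
  have := mul_le_mul_of_nonneg_left h1 (by positivity : 0 ≤ (t^N)⁻¹)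
  refine this.trans (le_of_eq ?_)
  field_simp

lemma pq_ge_of {f : Eu N → ℝ} (hf : Integrable f) {t : ℝ} (ht : 0 < t) (z : Eu N) {M : ℝ}
    (h : ∀ y ∈ Metric.ball z t, M ≤ f y) : M * v1 N ≤ pq f t z := by
  unfold pq
  have h1 : ∫ y in Metric.ball z t, M ≤ ∫ y in Metric.ball z t, f y :=
    setIntegral_mono_on (integrableOn_const measure_ball_lt_top.ne) hf.integrableOn Metric.isOpen_ball.measurableSet h
  rw [setIntegral_const, Measure.real, vol_ball z ht, smul_eq_mul] at h1
  have := mul_le_mul_of_nonneg_left h1 (by positivity : 0 ≤ (t^N)⁻¹)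
  refine le_trans (le_of_eq ?_) this
  field_simp

noncomputable def c3 (N : ℕ) : ℝ := ∫ y : Eu N, pw 3 (qd 1 1 0 y)

lemma c3_eq {t : ℝ} (ht : 0 < t) (z : Eu N) : (t^N)⁻¹ * ∫ y, pw 3 (qd 1 ((t^2)⁻¹) z y) = c3 N := by
  have h1 : ∫ y, pw 3 (qd 1 ((t^2)⁻¹) z y) = ∫ y : Eu N, pw 3 (qd 1 1 0 (t⁻¹ • (y - z))) := by
    congr 1; ext y; congr 1
    unfold qd
    rw [sub_zero, norm_smul, mul_pow, norm_inv, Real.norm_eq_abs, inv_pow, sq_abs]; ring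
  have h2 : ∫ y : Eu N, pw 3 (qd 1 1 0 (t⁻¹ • (y - z))) = ∫ y : Eu N, pw 3 (qd 1 1 0 (t⁻¹ • y)) :=
    integral_sub_right_eq_self (fun y : Eu N => pw 3 (qd 1 1 0 (t⁻¹ • y))) z
  rw [h1, h2, Measure.integral_comp_inv_smul_of_nonneg volume (fun y : Eu N => pw 3 (qd 1 1 0 y)) ht.le,
    finrank_euclideanSpace_fin, smul_eq_mul, c3]
  field_simp

lemma c3_nonneg : 0 ≤ c3 N := integral_nonneg fun y => pw_nonneg _ _

lemma ph_sub {f : Eu N → ℝ} (hf : Integrable f) {t : ℝ} (ht : 0 < t) (z : Eu N) :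
    |ph f t z - c3 N * f z| ≤ (t^N)⁻¹ * ∫ y in Metric.ball z t, |f y - f z| := by
  have hkc := pwq_cont 3 ((t^2)⁻¹) z
  have hks := pwq_hcs 2 ht z
  have hki : Integrable (fun y => pw 3 (qd 1 ((t^2)⁻¹) z y)) := hkc.integrable_of_hasCompactSupport hks
  rw [← c3_eq ht z]
  unfold ph
  have e : ((t^N)⁻¹ * ∫ y, f y * pw 3 (qd 1 ((t^2)⁻¹) z y)) - (t^N)⁻¹ * (∫ y, pw 3 (qd 1 ((t^2)⁻¹) z y)) * f z
      = (t^N)⁻¹ * ∫ y, (f y - f z) * pw 3 (qd 1 ((t^2)⁻¹) z y) := by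
    rw [mul_assoc, ← mul_sub, ← integral_mul_const, ← integral_sub (bdd_int hf hkc hks) (hki.mul_const _)]
    congr 2; ext y; ring
  rw [e, abs_mul, abs_of_nonneg (by positivity : 0 ≤ (t^N)⁻¹)]
  refine mul_le_mul_of_nonneg_left ?_ (by positivity)
  refine abs_integral_le_integral_abs.trans ?_
  rw [← integral_indicator Metric.isOpen_ball.measurableSet]
  have hi : Integrable (fun y => (f y - f z) * pw 3 (qd 1 ((t^2)⁻¹) z y)) :=
    ((bdd_int hf hkc hks).sub (hki.const_mul (f z))).congr (Eventually.of_forall fun y => by simp only [Pi.sub_apply]; ring)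
  have hj : IntegrableOn (fun y => |f y - f z|) (Metric.ball z t) :=
    (hf.integrableOn.sub (integrableOn_const measure_ball_lt_top.ne)).abs
  refine integral_mono hi.abs ((integrable_indicator_iff Metric.isOpen_ball.measurableSet).2 hj) fun y => ?_
  by_cases hy : y ∈ Metric.ball z t
  · simp only [indicator_of_mem hy]
    rw [abs_mul, abs_of_nonneg (pw_nonneg 3 _)]
    exact mul_le_of_le_one_right (abs_nonneg _) (pw_le_one (qd_le_one _ _))
  · simp only [indicator_of_notMem hy]
    rw [pw_of_nonpos 2 (qd_nonpos ht (by simpa using hy))]; simp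

noncomputable def rr (e x : ℝ) : ℝ := √(√(1 + x/e))
lemma rr_pow {e x : ℝ} (he : 0 < e) (hx : 0 ≤ x) : rr e x^4 = 1 + x/e := by
  have h : 0 ≤ 1 + x/e := by positivity
  have : rr e x^4 = ((√(√(1 + x/e)))^2)^2 := by unfold rr; ring
  rw [this, Real.sq_sqrt (Real.sqrt_nonneg _), Real.sq_sqrt h]
lemma rr_nonneg (e x : ℝ) : 0 ≤ rr e x := Real.sqrt_nonneg _
lemma rr_ge {e x : ℝ} (he : 0 < e) (hx : 0 ≤ x) : 1 ≤ rr e x := by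
  have h : 1 ≤ 1 + x/e := by have : 0 ≤ x/e := by positivity
                             linarith
  unfold rr
  rw [Real.one_le_sqrt, Real.one_le_sqrt]; exact h
lemma rr_mono {e x y : ℝ} (he : 0 < e) (h : x ≤ y) : rr e x ≤ rr e y := by
  unfold rr; gcongr

noncomputable def pj (w g : Eu N → ℝ) (j : ℕ) (z : Eu N) : ℝ := tk j * pq (ff w g) (tk (j+5)) z

noncomputable def Bz (w g : Eu N → ℝ) (e : ℝ) (k0 n : ℕ) (z : Eu N) : ℝ :=
  ∑ j ∈ Finset.Ico k0 (n+1), pj w g j z * (rr e (ph g (tk j) z)^7)⁻¹ * ∑ i ∈ Finset.Ico j (n+1), pj w g i z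

lemma GD.pj_nonneg (h : GD Ω w g b x0 B Cg CB D cg r0 cb) (j : ℕ) (z : Eu N) : 0 ≤ pj w g j z :=
  mul_nonneg (tk_pos j).le (pq_nonneg h.ffnn (tk_pos _) z)

lemma GD.ph_anti (h : GD Ω w g b x0 B Cg CB D cg r0 cb) {k : ℕ} {z : Eu N}
    (hz : ∀ y, dist y z < tk k → b y = 0) : ph g (tk (k+1)) z ≤ ph g (tk k) z := by
  have h1 := (h.D1 (tk_pos k) hz).1
  rw [tk_succ]
  have h2 := pq_nonneg h.ffnn (t := tk k/4) (by have := tk_pos k; linarith) z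
  have : 0 ≤ (4^N)⁻¹/128 * tk k^2 * pq (ff w g) (tk k/4) z := by positivity
  linarith

lemma hzmono {k0 k : ℕ} {z : Eu N} (hz : ∀ y, dist y z < tk k0 → b y = 0) (h : k0 ≤ k) :
    ∀ y, dist y z < tk k → b y = 0 := fun y hy => hz y (hy.trans_le (tk_anti h))

lemma GD.ph_anti' (h : GD Ω w g b x0 B Cg CB D cg r0 cb) {k l : ℕ} (hkl : k ≤ l) {z : Eu N}
    (hz : ∀ y, dist y z < tk k → b y = 0) : ph g (tk l) z ≤ ph g (tk k) z := by
  induction l, hkl using Nat.le_induction with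
  | base => exact le_rfl
  | succ l hl ih => exact (h.ph_anti (hzmono hz hl)).trans ih

set_option maxHeartbeats 1000000 in
lemma GD.H (h : GD Ω w g b x0 B Cg CB D cg r0 cb) (k0 : ℕ) : ∃ CH : ℝ, 0 ≤ CH ∧ ∀ (n : ℕ) (η : ℝ) (z : Eu N),
    k0 ≤ n → 0 < η → η ≤ 1 → (∀ y, dist y z < tk k0 → b y = 0) →
    ph g (tk (n+5)) z ≤ 2*η^4 → ph g (tk n) z ≤ 4*η^4 →
    gradSq (ph g (tk (n+5))) z ≤ CH * (Bz w g (η^4) k0 n z + η^7) := by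
  have hN1 : (1:ℝ) ≤ 2^N := one_le_pow₀ (by norm_num)
  have hCg : 0 ≤ Cg := (h.gnn 0).trans (h.gle 0)
  set C : ℝ := 15*2^N*32 + Cg * v1 N with hC
  have hv := v1_pos (N := N)
  have hCv : 0 ≤ Cg * v1 N := by positivity
  have hC1 : 1 ≤ C := by linarith
  have hC2 : (15:ℝ)*2^N*32 ≤ C := by linarith
  have hC3 : (2:ℝ)^N ≤ C := by linarith
  obtain ⟨CH, hCH, H⟩ := seq_main C hC1 k0
  refine ⟨N * CH, by positivity, ?_⟩
  intro n η z hn hη hη1 hz hG hφn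
  have hη4 : 0 < η^4 := by positivity
  have hph0 : ∀ k, 0 ≤ ph g (tk k) z := fun k => ph_nonneg h.gnn (tk_pos k) z
  have hi : ∀ i : Fin N, (pd i (ph g (tk (n+5))) z)^2 ≤ CH * (Bz w g (η^4) k0 n z + η^7) := by
    intro i
    rw [← sq_abs, pd_ph h.gi (tk_pos _)]
    refine H (fun k => ph g (tk k) z) (fun j => pj w g j z) (fun k => rr (η^4) (ph g (tk k) z)) n η _ hn hη hη1
      hph0 (fun k hk => h.ph_anti (hzmono hz hk)) ?_ (fun j => h.pj_nonneg j z)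
      (fun k => rr_ge hη4 (hph0 k)) (fun k => rr_pow hη4 (hph0 k)) hG hφn ?_ (abs_nonneg _) ?_
    · intro k
      have := (ph_le h.gi h.gnn (tk_pos k) z).trans (pq_le_of h.gi (tk_pos k) z (M := Cg) (fun y _ => h.gle y))
      have : (0:ℝ) ≤ 15*2^N*32 := by positivity
      linarith
    · intro k hk hkn
      have hstep : ∀ j, k ≤ j → ph g (tk (j+5)) z - ph g (tk (j+6)) z ≤ C * tk k * pj w g j z := by
        intro j hj
        have h1 := (h.D1 (tk_pos (j+5)) (hzmono hz (by omega : k0 ≤ j+5))).2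
        rw [← tk_succ] at h1
        refine h1.trans ?_
        unfold pj
        have h2 := pq_nonneg h.ffnn (tk_pos (j+5)) z
        have h3 : tk (j+5) ≤ tk k := tk_anti (by omega)
        have h4 : tk (j+5) ≤ tk j := tk_anti (by omega)
        have := tk_pos (j+5); have := tk_pos j; have := tk_pos k
        calc 2^N * tk (j+5)^2 * pq (ff w g) (tk (j+5)) z = 2^N * (tk (j+5) * tk (j+5)) * pq (ff w g) (tk (j+5)) z := by ring
          _ ≤ C * (tk k * tk j) * pq (ff w g) (tk (j+5)) z := by gcongr
          _ = _ := by ring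
      have hall : ∀ l, k ≤ l → ph g (tk (k+5)) z - ph g (tk (l+5)) z ≤ C * tk k * ∑ i ∈ Finset.Ico k l, pj w g i z := by
        intro l hl
        induction l, hl using Nat.le_induction with
        | base => simp
        | succ l hl ih =>
          rw [Finset.sum_Ico_succ_top hl, mul_add]
          have := hstep l hl
          have e : l + 1 + 5 = l + 6 := by ring
          rw [e]; linarith
      have h1 := hall (n+1) (by omega)
      have h2 : ph g (tk (n+1+5)) z ≤ ph g (tk (n+5)) z := h.ph_anti (hzmono hz (by omega : k0 ≤ n+5))
      have h3 := hall n hkn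
      refine h3.trans ?_
      have h4 : ∑ i ∈ Finset.Ico k n, pj w g i z ≤ ∑ i ∈ Finset.Ico k (n+1), pj w g i z :=
        Finset.sum_le_sum_of_subset_of_nonneg (Finset.Ico_subset_Ico le_rfl (by omega)) fun j _ _ => h.pj_nonneg j z
      have := tk_pos k
      exact mul_le_mul_of_nonneg_left h4 (by positivity)
    · intro k hk hkn
      have hstep : ∀ j, k ≤ j → |dph i g (tk (j+6)) z| ≤ |dph i g (tk (j+5)) z| + C * pj w g j z := by
        intro j hj
        have h1 := h.D2 (tk_pos (j+5)) i (hzmono hz (by omega : k0 ≤ j+5))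
        rw [← tk_succ] at h1
        have h2 := pq_nonneg h.ffnn (tk_pos (j+5)) z
        have h4 : tk (j+5) ≤ tk j := tk_anti (by omega)
        have := tk_pos (j+5)
        have h5 : 2^N * tk (j+5) * pq (ff w g) (tk (j+5)) z ≤ C * pj w g j z := by
          unfold pj; rw [← mul_assoc]; gcongr
        have h6 := abs_sub_abs_le_abs_sub (dph i g (tk (j+6)) z) (dph i g (tk (j+5)) z)
        rw [abs_sub_comm] at h6
        have e : j+5+1 = j+6 := by ring
        rw [e] at h1
        linarith
      have hall : ∀ l, k ≤ l → |dph i g (tk (l+5)) z| ≤ |dph i g (tk (k+5)) z| + C * ∑ i ∈ Finset.Ico k l, pj w g i z := by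
        intro l hl
        induction l, hl using Nat.le_induction with
        | base => simp
        | succ l hl ih =>
          rw [Finset.sum_Ico_succ_top hl, mul_add]
          have := hstep l hl
          have e : l + 1 + 5 = l + 6 := by ring
          rw [e]; linarith
      have h3 := hall n hkn
      have h4 : ∑ i ∈ Finset.Ico k n, pj w g i z ≤ ∑ i ∈ Finset.Ico k (n+1), pj w g i z :=
        Finset.sum_le_sum_of_subset_of_nonneg (Finset.Ico_subset_Ico le_rfl (by omega)) fun j _ _ => h.pj_nonneg j z
      have h5 := dph_bound h.gi h.gnn (tk_pos (k+5)) z i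
      have e : 2 * tk (k+5) = tk (k+4) := by rw [tk_succ (k+4)]; ring
      rw [e] at h5
      have h6 : ph g (tk (k+4)) z ≤ ph g (tk k) z := h.ph_anti' (by omega) (hzmono hz hk)
      have h7 : 15*2^N*(ph g (tk (k+4)) z / tk (k+5)) ≤ C * (ph g (tk k) z * 2^k) := by
        have e2 : (1:ℝ) / tk (k+5) = 32 * 2^k := by
          have := tk_inv (k+5); have h8 := tk_pos (k+5)
          rw [div_eq_iff h8.ne', ← this, pow_add]; ring
        calc 15*2^N*(ph g (tk (k+4)) z / tk (k+5)) = 15*2^N*(ph g (tk (k+4)) z * (1/tk (k+5))) := by ring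
          _ = 15*2^N*32*(ph g (tk (k+4)) z * 2^k) := by rw [e2]; ring
          _ ≤ C * (ph g (tk k) z * 2^k) := by
            have := hph0 (k+4)
            gcongr
      have h8 := mul_le_mul_of_nonneg_left h4 (by linarith : 0 ≤ C)
      rw [mul_add]
      linarith
  unfold gradSq
  calc ∑ i, (pd i (ph g (tk (n+5))) z)^2 ≤ ∑ i : Fin N, CH * (Bz w g (η^4) k0 n z + η^7) := Finset.sum_le_sum fun i _ => hi i
    _ = _ := by simp; ring

end happ

section west
variable {N : ℕ} {Ω : Set (Eu N)} {w g b : Eu N → ℝ} {x0 : Eu N} {B Cg CB D cg r0 cb : ℝ}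

lemma ballset_meas (t : ℝ) : MeasurableSet {q : Eu N × Eu N | dist q.2 q.1 < t} :=
  (isOpen_lt (continuous_snd.dist continuous_fst) continuous_const).measurableSet

lemma pq_meas {f : Eu N → ℝ} (hf : Measurable f) (t : ℝ) : Measurable (pq f t) := by
  have h1 : StronglyMeasurable (fun q : Eu N × Eu N => indicator {q : Eu N × Eu N | dist q.2 q.1 < t} (fun q => f q.2) q) :=
    ((hf.comp measurable_snd).indicator (ballset_meas t)).stronglyMeasurable
  have h2 := (StronglyMeasurable.integral_prod_right' (ν := volume) h1).measurable
  have e : pq f t = fun z => (t^N)⁻¹ * ∫ y, indicator {q : Eu N × Eu N | dist q.2 q.1 < t} (fun q => f q.2) (z, y) := by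
    ext z
    unfold pq
    rw [← integral_indicator Metric.isOpen_ball.measurableSet]
    congr 1
  rw [e]
  exact h2.const_mul _

lemma pq_bdd {f : Eu N → ℝ} (hf : Integrable f) (hfn : ∀ x, 0 ≤ f x) {t : ℝ} (ht : 0 < t) (z : Eu N) :
    pq f t z ≤ (t^N)⁻¹ * ∫ y, f y :=
  mul_le_mul_of_nonneg_left (setIntegral_le_integral hf (Eventually.of_forall hfn)) (by positivity)

lemma pq_shift {f : Eu N → ℝ} (hf : Integrable f) (hfn : ∀ x, 0 ≤ f x) {t : ℝ} (ht : 0 < t) {z y : Eu N} (hd : dist y z < t) :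
    pq f t z ≤ 2^N * pq f (2*t) y := by
  unfold pq
  have h1 : ∫ x in Metric.ball z t, f x ≤ ∫ x in Metric.ball y (2*t), f x :=
    ball_mono_int hf hfn (Metric.ball_subset_ball' (by rw [dist_comm] at hd; linarith))
  have h2 := mul_le_mul_of_nonneg_left h1 (by positivity : 0 ≤ (t^N)⁻¹)
  refine h2.trans (le_of_eq ?_)
  rw [mul_pow]; field_simp

lemma fub {F H hh : Eu N → ℝ} (hF : Integrable F) (hFn : ∀ x, 0 ≤ F x) (hH : Integrable H) (hHn : ∀ x, 0 ≤ H x) {t : ℝ} (ht : 0 < t)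
    (hhn : ∀ y, 0 ≤ hh y) (hFh : Integrable (fun y => F y * hh y))
    (hb : ∀ y z, dist y z < t → H z ≤ hh y) :
    ∫ z, H z * pq F t z ≤ v1 N * ∫ y, F y * hh y := by
  set S : Set (Eu N × Eu N) := {q | dist q.2 q.1 < t} with hS
  have hSm : MeasurableSet S := ballset_meas t
  have hi : Integrable (fun q : Eu N × Eu N => S.indicator (fun q => H q.1 * F q.2) q) (volume.prod volume) :=
    (hH.mul_prod hF).indicator hSm
  have e1 : ∀ z, H z * pq F t z = (t^N)⁻¹ * ∫ y, S.indicator (fun q => H q.1 * F q.2) (z, y) := by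
    intro z
    unfold pq
    rw [← integral_indicator Metric.isOpen_ball.measurableSet, mul_left_comm, ← integral_const_mul]
    congr 2; ext y
    by_cases hy : dist y z < t
    · rw [indicator_of_mem (by exact hy), indicator_of_mem (show (z,y) ∈ S from hy)]
    · rw [indicator_of_notMem (by simpa using hy), indicator_of_notMem (show (z,y) ∉ S from hy), mul_zero]
  simp_rw [e1]
  rw [integral_const_mul, integral_integral_swap hi, ← integral_const_mul, ← integral_const_mul]
  refine integral_mono (hi.integral_prod_right.const_mul _) (hFh.const_mul _) fun y => ?_
  have h1 : ∫ z, S.indicator (fun q => H q.1 * F q.2) (z, y) ≤ ∫ z, (Metric.ball y t).indicator (fun _ => hh y * F y) z := by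
    refine integral_mono_of_nonneg (Eventually.of_forall fun z => indicator_nonneg (fun q _ => mul_nonneg (hHn _) (hFn _)) _)
      ((integrable_indicator_iff Metric.isOpen_ball.measurableSet).2 (integrableOn_const measure_ball_lt_top.ne)) (Eventually.of_forall fun z => ?_)
    by_cases hy : dist y z < t
    · simp only
      rw [indicator_of_mem (show (z,y) ∈ S from hy), indicator_of_mem (by rw [Metric.mem_ball, dist_comm]; exact hy)]
      exact mul_le_mul_of_nonneg_right (hb y z hy) (hFn y)
    · simp only
      rw [indicator_of_notMem (show (z,y) ∉ S from hy)]
      exact indicator_nonneg (fun q _ => mul_nonneg (hhn _) (hFn _)) _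
  rw [integral_indicator Metric.isOpen_ball.measurableSet, setIntegral_const, Measure.real, vol_ball y ht, smul_eq_mul] at h1
  have := mul_le_mul_of_nonneg_left h1 (by positivity : 0 ≤ (t^N)⁻¹)
  refine this.trans (le_of_eq ?_)
  field_simp

noncomputable def FF (w g : Eu N → ℝ) (B : ℝ) (y : Eu N) : ℝ := Real.exp (w y) * g y * (w y + B + 1)

lemma GD.FFnn (h : GD Ω w g b x0 B Cg CB D cg r0 cb) (x : Eu N) : 0 ≤ FF w g B x :=
  mul_nonneg (h.ffnn x) (by linarith [h.wB x])
lemma GD.FFi (h : GD Ω w g b x0 B Cg CB D cg r0 cb) : Integrable (FF w g B) := h.Fint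
lemma GD.ff_le_FF (h : GD Ω w g b x0 B Cg CB D cg r0 cb) (x : Eu N) : ff w g x ≤ FF w g B x :=
  le_mul_of_one_le_right (h.ffnn x) (by linarith [h.wB x])
lemma GD.ffm (h : GD Ω w g b x0 B Cg CB D cg r0 cb) : Measurable (ff w g) := (h.wm.exp).mul h.gm
lemma GD.FFm (h : GD Ω w g b x0 B Cg CB D cg r0 cb) : Measurable (FF w g B) :=
  h.ffm.mul ((h.wm.add_const _).add_const _)

lemma rr_meas {φ : Eu N → ℝ} (hφ : Continuous φ) (e : ℝ) : Measurable (fun z => rr e (φ z)) :=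
  (((continuous_const.add (hφ.div_const e)).sqrt).sqrt).measurable

noncomputable def c2 (N : ℕ) : ℝ := 27/64 * (4^N)⁻¹
lemma c2_pos : 0 < c2 N := by unfold c2; positivity
lemma rr_scale (e x : ℝ) : rr e (c2 N * x) = rr (e/c2 N) x := by
  unfold rr; congr 3
  have := c2_pos (N := N)
  field_simp

lemma ph_shift {g : Eu N → ℝ} (hg : Integrable g) (hgn : ∀ x, 0 ≤ g x) {t : ℝ} (ht : 0 < t) {z y : Eu N} (hd : dist y z < t/4) :
    c2 N * ph g (t/4) y ≤ ph g t z := by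
  have h1 := ph_ge hg hgn ht z
  have h2 := ph_le hg hgn (t := t/4) (by linarith) y
  have h3 := pq_shift hg hgn (t := t/4) (by linarith) (z := y) (y := z) (by rw [dist_comm]; exact hd)
  have e : 2*(t/4) = t/2 := by ring
  rw [e] at h3
  refine le_trans ?_ h1
  unfold c2
  calc 27/64*(4^N)⁻¹*ph g (t/4) y ≤ 27/64*(4^N)⁻¹*(2^N*pq g (t/2) z) := by gcongr; exact h2.trans h3
    _ = 27/64*(2^N)⁻¹*pq g (t/2) z := by
      have : (4:ℝ)^N = 2^N*2^N := by rw [← mul_pow]; norm_num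
      rw [this]; field_simp

lemma tele_step {R R' : ℝ} (h1 : 1 ≤ R') (h2 : R' ≤ R) : (R^4 - R'^4)*(R^6)⁻¹ ≤ 2*((R'^2)⁻¹ - (R^2)⁻¹) := by
  have hR' : 0 < R' := by linarith
  have hR : 0 < R := by linarith
  have e : 2*((R'^2)⁻¹ - (R^2)⁻¹) = 2*(R^2-R'^2)*R^4/R'^2*(R^6)⁻¹ := by field_simp
  rw [e]
  refine mul_le_mul_of_nonneg_right ?_ (by positivity)
  rw [le_div_iff₀ (by positivity)]
  have h3 : R'^2 ≤ R^2 := by gcongr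
  have h4 : 0 ≤ R^2 - R'^2 := by linarith
  have h5 : (R^2+R'^2)*R'^2 ≤ 2*R^4 := by nlinarith [sq_nonneg R, sq_nonneg R']
  calc (R^4-R'^4)*R'^2 = (R^2-R'^2)*((R^2+R'^2)*R'^2) := by ring
    _ ≤ (R^2-R'^2)*(2*R^4) := by gcongr
    _ = _ := by ring

lemma tk_sum (j n : ℕ) : ∑ i ∈ Finset.Ico j n, tk i ≤ 2 * tk j := by
  rcases le_total n j with h | h
  · rw [Finset.Ico_eq_empty (by omega)]; simp [(tk_pos j).le]
  · have : ∑ i ∈ Finset.Ico j n, tk i = 2*tk j - 2*tk n := by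
      induction n, h using Nat.le_induction with
      | base => simp
      | succ n hn ih => rw [Finset.sum_Ico_succ_top hn, ih, tk_succ]; ring
    have := tk_pos n; linarith

/-- Pointwise sum bound at `y`. -/
lemma GD.Wpt (h : GD Ω w g b x0 B Cg CB D cg r0 cb) {e : ℝ} (he : 0 < e) {k0 n : ℕ} (hn : k0 ≤ n) {y : Eu N}
    (hy : ∀ x, dist x y < tk (k0+2) → b x = 0) :
    ∑ j ∈ Finset.Ico k0 (n+1), (∑ i ∈ Finset.Ico j (n+1), tk i) *
      (tk j * 2^N * pq (ff w g) (tk (j+4)) y * (rr (e/c2 N) (ph g (tk (j+2)) y)^6)⁻¹)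
      ≤ 2^13*8^N/c2 N*e*(rr (e/c2 N) (ph g (tk (n+5)) y)^2)⁻¹ := by
  have hc2 := c2_pos (N := N)
  set e' := e/c2 N with he'
  have he0 : 0 < e' := by positivity
  have hph0 : ∀ k, 0 ≤ ph g (tk k) y := fun k => ph_nonneg h.gnn (tk_pos k) y
  set R : ℕ → ℝ := fun k => rr e' (ph g (tk k) y) with hR
  have hR1 : ∀ k, 1 ≤ R k := fun k => rr_ge he0 (hph0 k)
  have hR4 : ∀ k, R k^4 = 1 + ph g (tk k) y/e' := fun k => rr_pow he0 (hph0 k)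
  have hRa : ∀ k l, k0+2 ≤ k → k ≤ l → R l ≤ R k := fun k l hk hl => rr_mono he0 (h.ph_anti' hl (hzmono hy hk))
  have hstep : ∀ j, k0 ≤ j → (∑ i ∈ Finset.Ico j (n+1), tk i) * (tk j * 2^N * pq (ff w g) (tk (j+4)) y * (R (j+2)^6)⁻¹)
      ≤ 2^13*8^N*e'*((R (j+3)^2)⁻¹ - (R (j+2)^2)⁻¹) := by
    intro j hj
    have h1 := (h.D1 (tk_pos (j+2)) (hzmono hy (by omega : k0+2 ≤ j+2))).1
    have e1 : tk (j+2)/4 = tk (j+4) := by rw [tk_succ (j+3), tk_succ (j+2)]; ring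
    have e2 : tk j = 4*tk (j+2) := by rw [tk_succ (j+1), tk_succ j]; ring
    rw [e1, ← tk_succ] at h1
    have h2 := tele_step (hR1 (j+3)) (hRa (j+2) (j+3) (by omega) (by omega))
    have hq := pq_nonneg h.ffnn (tk_pos (j+4)) y
    have ht := tk_pos (j+2)
    have e3 : ph g (tk (j+2)) y - ph g (tk (j+2+1)) y = e' * (R (j+2)^4 - R (j+3)^4) := by
      rw [hR4, hR4]; field_simp; ring
    rw [e3] at h1
    have h3 : tk (j+2)^2*pq (ff w g) (tk (j+4)) y ≤ 128*4^N*(e' * (R (j+2)^4 - R (j+3)^4)) := by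
      have := mul_le_mul_of_nonneg_left h1 (by positivity : (0:ℝ) ≤ 128*4^N)
      refine le_trans (le_of_eq ?_) this
      field_simp
    have hRp : 0 < R (j+2) := by have := hR1 (j+2); linarith
    calc (∑ i ∈ Finset.Ico j (n+1), tk i) * (tk j * 2^N * pq (ff w g) (tk (j+4)) y * (R (j+2)^6)⁻¹)
        ≤ (2*tk j) * (tk j * 2^N * pq (ff w g) (tk (j+4)) y * (R (j+2)^6)⁻¹) := by
          have := tk_pos j
          refine mul_le_mul_of_nonneg_right (tk_sum j _) (by positivity)
      _ = 32*2^N*(tk (j+2)^2*pq (ff w g) (tk (j+4)) y)*(R (j+2)^6)⁻¹ := by rw [e2]; ring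
      _ ≤ 32*2^N*(128*4^N*(e' * (R (j+2)^4 - R (j+3)^4)))*(R (j+2)^6)⁻¹ := by gcongr
      _ = 32*128*(2^N*4^N)*e'*((R (j+2)^4 - R (j+3)^4)*(R (j+2)^6)⁻¹) := by ring
      _ ≤ 32*128*(2^N*4^N)*e'*(2*((R (j+3)^2)⁻¹ - (R (j+2)^2)⁻¹)) := by gcongr
      _ = _ := by rw [← mul_pow]; norm_num; ring
  have hsum : ∀ m, k0 ≤ m → ∑ j ∈ Finset.Ico k0 m, ((R (j+3)^2)⁻¹ - (R (j+2)^2)⁻¹) ≤ (R (m+2)^2)⁻¹ := by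
    intro m hm
    have : ∑ j ∈ Finset.Ico k0 m, ((R (j+3)^2)⁻¹ - (R (j+2)^2)⁻¹) = (R (m+2)^2)⁻¹ - (R (k0+2)^2)⁻¹ := by
      induction m, hm using Nat.le_induction with
      | base => simp
      | succ m hm ih => rw [Finset.sum_Ico_succ_top hm, ih]; ring_nf
    have h5 : 0 ≤ (R (k0+2)^2)⁻¹ := by positivity
    linarith
  calc _ ≤ ∑ j ∈ Finset.Ico k0 (n+1), 2^13*8^N*e'*((R (j+3)^2)⁻¹ - (R (j+2)^2)⁻¹) :=
        Finset.sum_le_sum fun j hj => hstep j (Finset.mem_Ico.1 hj).1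
    _ = 2^13*8^N*e'*∑ j ∈ Finset.Ico k0 (n+1), ((R (j+3)^2)⁻¹ - (R (j+2)^2)⁻¹) := by rw [Finset.mul_sum]
    _ ≤ 2^13*8^N*e'*(R (n+5)^2)⁻¹ := by
        refine mul_le_mul_of_nonneg_left ((hsum (n+1) (by omega)).trans ?_) (by positivity)
        have h6 := hRa (n+1+2) (n+5) (by omega) (by omega)
        have h7 := hR1 (n+5)
        gcongr
    _ = _ := by rw [he']; ring

end west

section west2
variable {N : ℕ} {Ω : Set (Eu N)} {w g b : Eu N → ℝ} {x0 : Eu N} {B Cg CB D cg r0 cb : ℝ}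

noncomputable def WS (w g : Eu N → ℝ) (B e : ℝ) (k0 n : ℕ) (z : Eu N) : ℝ :=
  ∑ j ∈ Finset.Ico k0 (n+1), ∑ i ∈ Finset.Ico j (n+1),
    pj w g j z * (rr e (ph g (tk j) z)^6)⁻¹ * (tk i * pq (FF w g B) (tk (i+5)) z)

noncomputable def hj (w g : Eu N → ℝ) (e : ℝ) (j : ℕ) (z : Eu N) : ℝ := pj w g j z * (rr e (ph g (tk j) z)^6)⁻¹

lemma GD.phc (h : GD Ω w g b x0 B Cg CB D cg r0 cb) (k : ℕ) : Continuous (ph g (tk k)) :=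
  (ph_contDiff h.gi (tk_pos k)).continuous

lemma GD.hj_meas (h : GD Ω w g b x0 B Cg CB D cg r0 cb) (e : ℝ) (j : ℕ) : Measurable (hj w g e j) :=
  ((pq_meas h.ffm _).const_mul _).mul (((rr_meas (h.phc j) e).pow_const 6).inv)

lemma GD.hj_nonneg (h : GD Ω w g b x0 B Cg CB D cg r0 cb) (e : ℝ) (j : ℕ) (z : Eu N) : 0 ≤ hj w g e j z :=
  mul_nonneg (h.pj_nonneg j z) (inv_nonneg.2 (pow_nonneg (rr_nonneg _ _) 6))

lemma rr_inv_le {e x : ℝ} (he : 0 < e) (hx : 0 ≤ x) (m : ℕ) : (rr e x^m)⁻¹ ≤ 1 :=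
  inv_le_one_of_one_le₀ (one_le_pow₀ (rr_ge he hx))

lemma GD.hj_le (h : GD Ω w g b x0 B Cg CB D cg r0 cb) {e : ℝ} (he : 0 < e) (j : ℕ) (z : Eu N) :
    hj w g e j z ≤ (tk (j+5)^N)⁻¹ * ∫ y, ff w g y := by
  have h1 := pq_bdd h.fi h.ffnn (tk_pos (j+5)) z
  have h2 := rr_inv_le he (ph_nonneg h.gnn (tk_pos j) z) 6
  have h3 := h.pj_nonneg j z
  have h4 := pq_nonneg h.ffnn (tk_pos (j+5)) z
  calc hj w g e j z ≤ pj w g j z := mul_le_of_le_one_right h3 h2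
    _ ≤ pq (ff w g) (tk (j+5)) z := mul_le_of_le_one_left h4 (tk_le_one j)
    _ ≤ _ := h1

lemma ind_int {L : Set (Eu N)} (hL : MeasurableSet L) (hLv : volume L < ⊤) {k : Eu N → ℝ} (hk : Measurable k)
    {M : ℝ} (h0 : ∀ x, 0 ≤ k x) (hM : ∀ x, k x ≤ M) : Integrable (L.indicator k) := by
  rw [integrable_indicator_iff hL]
  exact Measure.integrableOn_of_bounded (M := M) hLv.ne hk.aestronglyMeasurable
    (Eventually.of_forall fun x => by rw [Real.norm_eq_abs, abs_of_nonneg (h0 x)]; exact hM x)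

lemma GD.WS_int (h : GD Ω w g b x0 B Cg CB D cg r0 cb) {e : ℝ} (he : 0 < e) (k0 n : ℕ) {L : Set (Eu N)}
    (hL : MeasurableSet L) (hLv : volume L < ⊤) (j i : ℕ) :
    Integrable (fun z => L.indicator (hj w g e j) z * pq (FF w g B) (tk (i+5)) z) := by
  refine (ind_int hL hLv (h.hj_meas e j) (h.hj_nonneg e j) (h.hj_le he j)).mul_bdd
    (c := (tk (i+5)^N)⁻¹ * ∫ y, FF w g B y) (pq_meas h.FFm _).aestronglyMeasurable (Eventually.of_forall fun z => ?_)
  rw [Real.norm_eq_abs, abs_of_nonneg (pq_nonneg h.FFnn (tk_pos _) z)]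
  exact pq_bdd h.FFi h.FFnn (tk_pos _) z

lemma WS_eq (e : ℝ) (k0 n : ℕ) (L : Set (Eu N)) (z : Eu N) : L.indicator (WS w g B e k0 n) z =
    ∑ j ∈ Finset.Ico k0 (n+1), ∑ i ∈ Finset.Ico j (n+1), tk i * (L.indicator (hj w g e j) z * pq (FF w g B) (tk (i+5)) z) := by
  by_cases hz : z ∈ L
  · simp only [indicator_of_mem hz, WS, hj]
    refine Finset.sum_congr rfl fun j _ => Finset.sum_congr rfl fun i _ => by ring
  · simp only [indicator_of_notMem hz]; simp

lemma GD.WS_integrable (h : GD Ω w g b x0 B Cg CB D cg r0 cb) {e : ℝ} (he : 0 < e) (k0 n : ℕ) {L : Set (Eu N)}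
    (hL : MeasurableSet L) (hLv : volume L < ⊤) : Integrable (L.indicator (WS w g B e k0 n)) := by
  have : L.indicator (WS w g B e k0 n) = fun z => _ := funext fun z => WS_eq e k0 n L z
  rw [this]
  exact integrable_finsetSum _ fun j _ => integrable_finsetSum _ fun i _ => (h.WS_int he k0 n hL hLv j i).const_mul _

set_option maxHeartbeats 1000000 in
lemma GD.W (h : GD Ω w g b x0 B Cg CB D cg r0 cb) {e : ℝ} (he : 0 < e) {k0 n : ℕ} (hn : k0 ≤ n) {L : Set (Eu N)}
    (hL : MeasurableSet L) (hLv : volume L < ⊤) (hLb : ∀ z ∈ L, ∀ y, dist y z < tk k0 → b y = 0) :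
    ∫ z, L.indicator (WS w g B e k0 n) z ≤
      v1 N * (2^13*8^N/c2 N) * e * ∫ y, FF w g B y * (rr (e/c2 N) (ph g (tk (n+5)) y)^2)⁻¹ := by
  have hc2 := c2_pos (N := N)
  have he' : 0 < e/c2 N := by positivity
  set Y : Set (Eu N) := ⋃ z ∈ L, Metric.ball z (tk (k0+5)) with hY
  have hYo : IsOpen Y := isOpen_biUnion fun z _ => Metric.isOpen_ball
  set H0 : ℕ → Eu N → ℝ := fun j y => tk j * 2^N * pq (ff w g) (tk (j+4)) y * (rr (e/c2 N) (ph g (tk (j+2)) y)^6)⁻¹ with hH0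
  have hH0n : ∀ j y, 0 ≤ H0 j y := fun j y => by
    have := pq_nonneg h.ffnn (tk_pos (j+4)) y
    have := tk_pos j
    have := rr_nonneg (e/c2 N) (ph g (tk (j+2)) y)
    simp only [hH0]; positivity
  have hH0m : ∀ j, Measurable (H0 j) := fun j =>
    ((pq_meas h.ffm _).const_mul _).mul (((rr_meas (h.phc (j+2)) (e/c2 N)).pow_const 6).inv)
  have hH0b : ∀ j y, H0 j y ≤ 2^N * ((tk (j+4)^N)⁻¹ * ∫ y, ff w g y) := fun j y => by
    have h1 := pq_bdd h.fi h.ffnn (tk_pos (j+4)) y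
    have h2 := rr_inv_le he' (ph_nonneg h.gnn (tk_pos (j+2)) y) 6
    have h4 := pq_nonneg h.ffnn (tk_pos (j+4)) y
    have h5 := tk_le_one j
    have := tk_pos j
    have := rr_nonneg (e/c2 N) (ph g (tk (j+2)) y)
    simp only [hH0]
    calc tk j * 2^N * pq (ff w g) (tk (j+4)) y * (rr (e/c2 N) (ph g (tk (j+2)) y)^6)⁻¹
        ≤ 1 * 2^N * pq (ff w g) (tk (j+4)) y * 1 := by gcongr
      _ ≤ 1 * 2^N * ((tk (j+4)^N)⁻¹ * ∫ y, ff w g y) * 1 := by gcongr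
      _ = _ := by ring
  have hitg : ∀ j, Integrable (fun y => FF w g B y * Y.indicator (H0 j) y) := fun j => by
    refine h.FFi.mul_bdd (c := 2^N * ((tk (j+4)^N)⁻¹ * ∫ y, ff w g y))
      ((hH0m j).indicator hYo.measurableSet).aestronglyMeasurable (Eventually.of_forall fun y => ?_)
    rw [Real.norm_eq_abs, abs_of_nonneg (indicator_nonneg (fun y _ => hH0n j y) y)]
    exact (indicator_le_self' (fun y _ => hH0n j y) y).trans (hH0b j y)
  have hYb : ∀ y ∈ Y, ∀ x, dist x y < tk (k0+2) → b x = 0 := by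
    intro y hy x hx
    obtain ⟨z, hzL, hz⟩ := mem_iUnion₂.1 hy
    refine hLb z hzL x ?_
    have h1 := dist_triangle x y z
    rw [Metric.mem_ball] at hz
    have h2 : tk (k0+5) ≤ tk (k0+2) := tk_anti (by omega)
    have h3 : tk k0 = 4*tk (k0+2) := by rw [tk_succ (k0+1), tk_succ k0]; ring
    have := tk_pos (k0+2)
    linarith
  have hfub : ∀ j i, k0 ≤ j → j ≤ i → ∫ z, L.indicator (hj w g e j) z * pq (FF w g B) (tk (i+5)) z
      ≤ v1 N * ∫ y, FF w g B y * Y.indicator (H0 j) y := by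
    intro j i hjk hji
    refine fub h.FFi h.FFnn (ind_int hL hLv (h.hj_meas e j) (h.hj_nonneg e j) (h.hj_le he j))
      (fun x => indicator_nonneg (fun z _ => h.hj_nonneg e j z) x) (tk_pos _)
      (fun y => indicator_nonneg (fun y _ => hH0n j y) y) (hitg j) fun y z hyz => ?_
    by_cases hzL : z ∈ L
    · have hyj : dist y z < tk (j+5) := hyz.trans_le (tk_anti (by omega))
      have hyY : y ∈ Y := mem_iUnion₂.2 ⟨z, hzL, hyj.trans_le (tk_anti (by omega))⟩
      rw [indicator_of_mem hzL, indicator_of_mem hyY]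
      have h1 := pq_shift h.fi h.ffnn (tk_pos (j+5)) hyj
      have e1 : 2*tk (j+5) = tk (j+4) := by rw [tk_succ (j+4)]; ring
      have e2 : tk j/4 = tk (j+2) := by rw [tk_succ (j+1), tk_succ j]; ring
      rw [e1] at h1
      have h2 := ph_shift h.gi h.gnn (tk_pos j) (z := z) (y := y) (by rw [e2]; exact hyj.trans_le (tk_anti (by omega)))
      rw [e2] at h2
      have h3 : rr (e/c2 N) (ph g (tk (j+2)) y) ≤ rr e (ph g (tk j) z) := by
        rw [← rr_scale]; exact rr_mono he h2
      have h4 := rr_ge he' (ph_nonneg h.gnn (tk_pos (j+2)) y)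
      have h5 := tk_pos j
      have h6 := pq_nonneg h.ffnn (tk_pos (j+5)) z
      have h7 := pq_nonneg h.ffnn (tk_pos (j+4)) y
      simp only [hj, pj, hH0]
      calc tk j * pq (ff w g) (tk (j+5)) z * (rr e (ph g (tk j) z)^6)⁻¹
          ≤ tk j * (2^N * pq (ff w g) (tk (j+4)) y) * (rr (e/c2 N) (ph g (tk (j+2)) y)^6)⁻¹ := by gcongr
        _ = _ := by ring
    · rw [indicator_of_notMem hzL]
      exact indicator_nonneg (fun y _ => hH0n j y) y
  have hwi := fun j i => h.WS_int he k0 n hL hLv j i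
  simp_rw [WS_eq]
  rw [integral_finsetSum _ fun j _ => integrable_finsetSum _ fun i _ => (hwi j i).const_mul _]
  have hv := v1_pos (N := N)
  calc ∑ j ∈ Finset.Ico k0 (n+1), ∫ z, ∑ i ∈ Finset.Ico j (n+1), tk i * (L.indicator (hj w g e j) z * pq (FF w g B) (tk (i+5)) z)
      = ∑ j ∈ Finset.Ico k0 (n+1), ∑ i ∈ Finset.Ico j (n+1), tk i * ∫ z, (L.indicator (hj w g e j) z * pq (FF w g B) (tk (i+5)) z) := by
        refine Finset.sum_congr rfl fun j _ => ?_
        rw [integral_finsetSum _ fun i _ => (hwi j i).const_mul _]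
        simp_rw [integral_const_mul]
    _ ≤ ∑ j ∈ Finset.Ico k0 (n+1), ∑ i ∈ Finset.Ico j (n+1), tk i * (v1 N * ∫ y, FF w g B y * Y.indicator (H0 j) y) := by
        refine Finset.sum_le_sum fun j hj => Finset.sum_le_sum fun i hi => ?_
        exact mul_le_mul_of_nonneg_left (hfub j i (Finset.mem_Ico.1 hj).1 (Finset.mem_Ico.1 hi).1) (tk_pos i).le
    _ = v1 N * ∑ j ∈ Finset.Ico k0 (n+1), ∫ y, (∑ i ∈ Finset.Ico j (n+1), tk i) * (FF w g B y * Y.indicator (H0 j) y) := by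
        rw [Finset.mul_sum]
        refine Finset.sum_congr rfl fun j _ => ?_
        rw [integral_const_mul, ← Finset.sum_mul]; ring
    _ = v1 N * ∫ y, ∑ j ∈ Finset.Ico k0 (n+1), (∑ i ∈ Finset.Ico j (n+1), tk i) * (FF w g B y * Y.indicator (H0 j) y) := by
        rw [integral_finsetSum _ fun j _ => (hitg j).const_mul _]
    _ ≤ v1 N * ∫ y, (2^13*8^N/c2 N*e) * (FF w g B y * (rr (e/c2 N) (ph g (tk (n+5)) y)^2)⁻¹) := by
        refine mul_le_mul_of_nonneg_left ?_ hv.le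
        refine integral_mono (integrable_finsetSum _ fun j _ => (hitg j).const_mul _) ?_ fun y => ?_
        · refine (h.FFi.mul_bdd (c := 1) ((((rr_meas (h.phc (n+5)) (e/c2 N)).pow_const 2).inv)).aestronglyMeasurable
            (Eventually.of_forall fun y => ?_)).const_mul _
          rw [Real.norm_eq_abs, Pi.inv_apply, abs_of_nonneg (inv_nonneg.2 (pow_nonneg (rr_nonneg (e/c2 N) (ph g (tk (n+5)) y)) 2))]
          exact rr_inv_le he' (ph_nonneg h.gnn (tk_pos _) y) 2
        · have hFy := h.FFnn y
          have hr := rr_nonneg (e/c2 N) (ph g (tk (n+5)) y)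
          by_cases hyY : y ∈ Y
          · have := mul_le_mul_of_nonneg_left (h.Wpt he hn (hYb y hyY)) hFy
            refine le_trans (le_of_eq ?_) (this.trans (le_of_eq (by ring)))
            simp only [indicator_of_mem hyY, hH0]
            rw [Finset.mul_sum]
            refine Finset.sum_congr rfl fun j _ => by ring
          · simp only [indicator_of_notMem hyY]
            simp only [mul_zero, Finset.sum_const_zero]
            positivity
    _ = _ := by rw [integral_const_mul]; ring

end west2

section kato
variable {N : ℕ} {Ω : Set (Eu N)} {U : ℕ → Eu N → ℝ} {V : Eu N → ℝ} {B : ℝ}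

noncomputable def ss (Ω : Set (Eu N)) (U : ℕ → Eu N → ℝ) (V : Eu N → ℝ) (H0 : ℝ) (x : Eu N) : ℝ :=
  max (indicator Ω V x - WW Ω U x - H0) 0

noncomputable def esf (s : ℝ) : ℝ := if 0 < s then Real.exp s else 0

lemma esf_nonneg (s : ℝ) : 0 ≤ esf s := by unfold esf; split_ifs; exacts [(Real.exp_pos _).le, le_rfl]
lemma esf_le (s : ℝ) : esf s ≤ Real.exp s := by unfold esf; split_ifs; exacts [le_rfl, (Real.exp_pos _).le]
lemma esf_meas : Measurable esf := Measurable.ite measurableSet_Ioi Real.measurable_exp measurable_const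

lemma ss_meas (h : Sys Ω U V B) (H0 : ℝ) : Measurable (ss Ω U V H0) :=
  (((meas_indicator h.op h.Vcd.continuousOn).sub (WW_meas h)).sub_const H0).max measurable_const

lemma ss_nonneg (H0 : ℝ) (x : Eu N) : 0 ≤ ss Ω U V H0 x := le_max_right _ _

lemma ss_in {H0 : ℝ} {x : Eu N} (hx : x ∈ Ω) : ss Ω U V H0 x = max (V x - WW Ω U x - H0) 0 := by
  unfold ss; rw [indicator_of_mem hx]

lemma ss_off {H0 : ℝ} (hH : 0 ≤ H0) {x : Eu N} (hx : x ∉ Ω) : ss Ω U V H0 x = 0 := by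
  unfold ss; rw [indicator_of_notMem hx, WW_off hx]; simp [hH]

lemma ss_le (h : Sys Ω U V B) {H0 : ℝ} (hH : 0 ≤ H0) {x : Eu N} (hx : x ∈ Ω) : ss Ω U V H0 x ≤ |V x| + B := by
  rw [ss_in hx]
  have h1 := WW_ge h x
  have h2 := le_abs_self (V x)
  exact max_le (by linarith) (by linarith [abs_nonneg (V x), h.Bpos])

lemma wss_le (h : Sys Ω U V B) {H0 : ℝ} (hH : 0 ≤ H0) {x : Eu N} (hx : x ∈ Ω) : WW Ω U x + ss Ω U V H0 x ≤ V x := by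
  rw [ss_in hx]
  have h1 := WW_le h hx
  rcases max_cases (V x - WW Ω U x - H0) 0 with h2 | h2 <;> rw [h2.1] <;> linarith

lemma Th1_mono : Monotone Th1 := monotone_of_hasDerivAt_nonneg (fun t => Th1_hasDerivAt t) (fun t => Th2_nonneg t)

set_option maxHeartbeats 1000000 in
lemma kato_s (h : Sys Ω U V B) {H0 : ℝ} (hH : 0 ≤ H0) {ζ : Eu N → ℝ} (hζ : ContDiff ℝ 2 ζ) (hc : HasCompactSupport ζ)
    (hs : tsupport ζ ⊆ Ω) (hζ0 : ∀ x, 0 ≤ ζ x) :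
    (Real.exp H0 - 1) * ∫ x, Real.exp (WW Ω U x) * esf (ss Ω U V H0 x) * ζ x ≤ ∫ x, ss Ω U V H0 x * laplacian ζ x := by
  set s := ss Ω U V H0 with hsdef
  set w := WW Ω U with hw
  set C1 := Real.exp H0 - 1 with hC1
  have hC10 : 0 ≤ C1 := by have := Real.one_le_exp hH; linarith
  have hlc : Continuous (laplacian ζ) := lap_continuous hζ
  have hls : HasCompactSupport (laplacian ζ) := hcs_of_tsupport hc tsupport_lap
  have hlt : tsupport (laplacian ζ) ⊆ Ω := tsupport_lap.trans hs
  have hζoff : ∀ x ∉ Ω, ζ x = 0 := fun x hx => image_eq_zero_of_notMem_tsupport (fun h' => hx (hs h'))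
  have hloff : ∀ x ∉ Ω, laplacian ζ x = 0 := fun x hx => image_eq_zero_of_notMem_tsupport (fun h' => hx (hlt h'))
  have hsm := ss_meas h H0
  have hwm := WW_meas h
  set δ : ℕ → ℝ := fun n => 1/((n:ℝ)+1) with hδ
  have hδ0 : ∀ n, 0 < δ n := fun n => by simp only [hδ]; positivity
  have hδt : Tendsto δ atTop (𝓝 0) := tendsto_one_div_add_atTop_nhds_zero_nat
  set S : ℕ → Eu N → ℝ := fun n y => Ths (δ n) (V y - U n y - H0) with hS
  have hScd : ∀ n, ContDiffOn ℝ 2 (S n) Ω := fun n =>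
    (Ths_contDiff (hδ0 n)).comp_contDiffOn ((h.Vcd.sub (h.Ucd n)).sub contDiffOn_const)
  -- the inequality at stage n
  have hexpV : Integrable (fun x => Real.exp (V x) * ζ x) :=
    mul_cs_int h.op (Real.continuous_exp.comp_continuousOn h.Vcd.continuousOn) hζ.continuous.continuousOn hs hc
  have hdomE : ∀ (c : ℝ → ℝ) (_ : Measurable c), (∀ t, 0 ≤ c t ∧ c t ≤ 1) →
      Integrable (fun x => c (s x) * Real.exp (w x + s x) * ζ x) := by
    intro c hcm hc1
    refine hexpV.mono' (((hcm.comp hsm).mul ((hwm.add hsm).exp)).mul hζ.continuous.measurable).aestronglyMeasurable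
      (Eventually.of_forall fun x => ?_)
    rw [Real.norm_eq_abs, abs_of_nonneg (mul_nonneg (mul_nonneg (hc1 _).1 (Real.exp_pos _).le) (hζ0 x))]
    by_cases hx : x ∈ Ω
    · refine mul_le_mul_of_nonneg_right ?_ (hζ0 x)
      calc c (s x) * Real.exp (w x + s x) ≤ 1 * Real.exp (V x) :=
            mul_le_mul (hc1 _).2 (Real.exp_le_exp.2 (wss_le h hH hx)) (Real.exp_pos _).le zero_le_one
        _ = _ := one_mul _
    · rw [hζoff x hx]; simp
  have hstage : ∀ n, C1 * ∫ x, Th1 (s x/δ n) * Real.exp (w x + s x) * ζ x ≤ ∫ x, S n x * laplacian ζ x := by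
    intro n
    rw [green h.op (hScd n) hζ hc hs, ← integral_const_mul]
    refine integral_mono ((hdomE (fun t => Th1 (t/δ n)) (Th1_continuous.measurable.comp (measurable_id.div_const _))
      fun t => ⟨Th1_nonneg _, Th1_le_one _⟩).const_mul _)
      (mul_cs_int h.op (lap_cont h.op (hScd n)) hζ.continuous.continuousOn hs hc) fun x => ?_
    by_cases hx : x ∈ Ω
    · simp only
      rw [← mul_assoc]
      refine mul_le_mul_of_nonneg_right ?_ (hζ0 x)
      have hVx : ContDiffAt ℝ 2 V x := h.Vcd.contDiffAt (h.op.mem_nhds hx)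
      have hUx : ContDiffAt ℝ 2 (U n) x := (h.Ucd n).contDiffAt (h.op.mem_nhds hx)
      have e1 : laplacian (S n) x = Th2 ((V x - U n x - H0) / δ n) / δ n * gradSq (fun y => V y - U n y - H0) x +
          Th1 ((V x - U n x - H0) / δ n) * laplacian (fun y => V y - U n y - H0) x :=
        lap_Ths (hδ0 n) ((hVx.sub hUx).sub contDiffAt_const)
      have e2 : laplacian (fun y => V y - U n y - H0) x = Real.exp (V x) - Real.exp (U n x) := by
        have h1 := lap_sub (u := fun y => V y - U n y) (v := fun _ => H0) (hVx.sub hUx) contDiffAt_const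
        have h2 := lap_sub (u := V) (v := U n) hVx hUx
        rw [h1, h2, lap_const, h.Veq x hx, h.Ueq n x hx, sub_zero]
      rw [e1, e2]
      have p1 : 0 ≤ Th2 ((V x - U n x - H0) / δ n) / δ n * gradSq (fun y => V y - U n y - H0) x :=
        mul_nonneg (div_nonneg (Th2_nonneg _) (hδ0 n).le) gradSq_nonneg
      have p2 : Real.exp (U n x) ≤ Real.exp (w x) := Real.exp_le_exp.2 (U_le_WW h hx n)
      have p3 : 0 ≤ Real.exp (V x) - Real.exp (U n x) := by
        have := Real.exp_le_exp.2 (h.UV n x hx); linarith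
      rcases (ss_nonneg (Ω := Ω) (U := U) (V := V) H0 x).eq_or_lt with h0 | h0
      · rw [hsdef, ← h0, zero_div, (Th_neg le_rfl).2.1]
        have := mul_nonneg (Th1_nonneg ((V x - U n x - H0) / δ n)) p3
        simp only [mul_zero, zero_mul]
        linarith
      · have hsx : s x = V x - w x - H0 := by
          have := ss_in (U := U) (V := V) (H0 := H0) hx
          rw [hsdef]; rw [this] at h0 ⊢
          exact max_eq_left (by by_contra hcon; push Not at hcon; rw [max_eq_right hcon.le] at h0; exact lt_irrefl _ h0)
        have p4 : Th1 (s x/δ n) ≤ Th1 ((V x - U n x - H0) / δ n) := Th1_mono (by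
          have := U_le_WW h hx n
          have := hδ0 n
          gcongr
          rw [hsx]; simp only [hw]; linarith)
        have p5 : C1 * Real.exp (w x + s x) ≤ Real.exp (V x) - Real.exp (U n x) := by
          have e3 : V x = w x + s x + H0 := by rw [hsx]; ring
          have : Real.exp (w x) ≤ Real.exp (w x + s x) := Real.exp_le_exp.2 (by simp only [hsdef]; linarith)
          rw [e3, Real.exp_add _ H0]
          simp only [hC1]
          nlinarith
        have p6 := Th1_nonneg (s x/δ n)
        have p7 : 0 ≤ C1 * Real.exp (w x + s x) := by positivity
        calc C1 * (Th1 (s x/δ n) * Real.exp (w x + s x)) = Th1 (s x/δ n) * (C1 * Real.exp (w x + s x)) := by ring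
          _ ≤ Th1 ((V x - U n x - H0) / δ n) * (Real.exp (V x) - Real.exp (U n x)) := mul_le_mul p4 p5 p7 (Th1_nonneg _)
          _ ≤ _ := by linarith
    · simp only [hζoff x hx, mul_zero, le_refl]
  -- limits
  have hR : Tendsto (fun n => ∫ x, S n x * laplacian ζ x) atTop (𝓝 (∫ x, s x * laplacian ζ x)) := by
    have hb : Integrable (fun x => (|V x| + B) * laplacian ζ x) :=
      mul_cs_int h.op (h.Vcd.continuousOn.abs.add continuousOn_const) hlc.continuousOn hlt hls
    refine tendsto_integral_of_dominated_convergence (fun x => ‖(|V x| + B) * laplacian ζ x‖)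
      (fun n => (mul_cs_int h.op (hScd n).continuousOn hlc.continuousOn hlt hls).aestronglyMeasurable) hb.norm ?_ ?_
    · refine fun n => Eventually.of_forall fun x => ?_
      by_cases hx : x ∈ Ω
      · rw [norm_mul, norm_mul]
        refine mul_le_mul_of_nonneg_right ?_ (norm_nonneg _)
        rw [Real.norm_eq_abs, Real.norm_eq_abs, abs_of_nonneg (Ths_nonneg (hδ0 n) _), abs_of_nonneg (add_nonneg (abs_nonneg _) h.Bpos)]
        refine (Ths_le (hδ0 n) _).trans (max_le ?_ (add_nonneg (abs_nonneg _) h.Bpos))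
        have := h.Uge n x hx
        have := le_abs_self (V x)
        linarith
      · rw [hloff x hx]; simp
    · refine Eventually.of_forall fun x => ?_
      by_cases hx : x ∈ Ω
      · refine Tendsto.mul_const _ ?_
        have hm : Tendsto (fun n => max (V x - U n x - H0) 0) atTop (𝓝 (s x)) := by
          have : s x = max (V x - w x - H0) 0 := ss_in hx
          rw [this]
          exact ((tendsto_const_nhds.sub (WW_tendsto' h hx)).sub_const H0).max tendsto_const_nhds
        have hm' : Tendsto (fun n => max (V x - U n x - H0) 0 - δ n/2) atTop (𝓝 (s x)) := by
          simpa using hm.sub (hδt.div_const 2)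
        exact tendsto_of_tendsto_of_tendsto_of_le_of_le hm' hm (fun n => Ths_ge (hδ0 n) _) (fun n => Ths_le (hδ0 n) _)
      · rw [hloff x hx]; simp
  have hL : Tendsto (fun n => ∫ x, Th1 (s x/δ n) * Real.exp (w x + s x) * ζ x) atTop
      (𝓝 (∫ x, Real.exp (w x) * esf (s x) * ζ x)) := by
    refine tendsto_integral_of_dominated_convergence (fun x => 1 * Real.exp (w x + s x) * ζ x)
      (fun n => (hdomE (fun t => Th1 (t/δ n)) (Th1_continuous.measurable.comp (measurable_id.div_const _))
      fun t => ⟨Th1_nonneg _, Th1_le_one _⟩).aestronglyMeasurable)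
      (hdomE (fun _ => 1) measurable_const fun t => ⟨zero_le_one, le_rfl⟩) ?_ ?_
    · refine fun n => Eventually.of_forall fun x => ?_
      rw [Real.norm_eq_abs, abs_of_nonneg (mul_nonneg (mul_nonneg (Th1_nonneg _) (Real.exp_pos _).le) (hζ0 x))]
      exact mul_le_mul_of_nonneg_right (mul_le_mul_of_nonneg_right (Th1_le_one _) (Real.exp_pos _).le) (hζ0 x)
    · refine Eventually.of_forall fun x => Tendsto.mul_const _ ?_
      rcases (ss_nonneg (Ω := Ω) (U := U) (V := V) H0 x).eq_or_lt with h0 | h0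
      · have h0' : s x = 0 := h0.symm
        simp only [h0', zero_div, (Th_neg le_rfl).2.1, zero_mul, esf, lt_irrefl, if_false, mul_zero]
        exact tendsto_const_nhds
      · have : Real.exp (w x) * esf (s x) = Real.exp (w x + s x) := by
          unfold esf; rw [if_pos h0, Real.exp_add]
        rw [this]
        refine tendsto_const_nhds.congr' ?_
        have := hδt.eventually (gt_mem_nhds h0)
        filter_upwards [this] with n hn
        rw [(Th_big (by rw [one_le_div (hδ0 n)]; exact hn.le)).2.1, one_mul]
  exact le_of_tendsto_of_tendsto' (hL.const_mul C1) hR hstage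

end kato

section pointwise

lemma leg {s α X : ℝ} (hs : 0 ≤ s) (hα : 0 ≤ α) (hX : 0 < X) :
    s * α ≤ X * esf s + α * max (Real.log (α/X)) 0 := by
  have hr : 0 ≤ α * max (Real.log (α/X)) 0 := mul_nonneg hα (le_max_right _ _)
  rcases hs.eq_or_lt with h0 | h0
  · rw [← h0, zero_mul]
    have := mul_nonneg hX.le (esf_nonneg 0)
    linarith
  rcases hα.eq_or_lt with h1 | h1
  · rw [← h1] at hr ⊢
    have := mul_nonneg hX.le (esf_nonneg s)
    simp only [mul_zero, zero_mul, add_zero]; exact this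
  · have e1 : esf s = Real.exp s := by unfold esf; rw [if_pos h0]
    rw [e1]
    set l := Real.log (α/X) with hl
    have e2 : X * Real.exp s = α * Real.exp (s - l) := by
      rw [Real.exp_sub, hl, Real.exp_log (by positivity)]; field_simp
    rw [e2]
    have e3 := Real.add_one_le_exp (s - l)
    have e4 : l ≤ max l 0 := le_max_left _ _
    nlinarith

lemma neglog_le {v : ℝ} (hv : 0 < v) : v * (-Real.log v) ≤ 1 := by
  have := Real.one_sub_inv_le_log_of_pos hv
  have h2 : v * v⁻¹ = 1 := mul_inv_cancel₀ hv.ne'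
  nlinarith

lemma neglog_le' {v : ℝ} (hv : 0 < v) : -Real.log v ≤ 1/v := by
  have := Real.one_sub_inv_le_log_of_pos hv
  rw [one_div]; linarith

lemma I1_pt {e a s G ρ : ℝ} (he : 0 < e) (ha : 0 ≤ a) (hs : 0 ≤ s) (hG : 0 ≤ G) (hρ : 0 ≤ ρ) (hρ' : G ≤ 2*e → 1/2 ≤ ρ) :
    s * Th1 ((G-e)/e) * (a*G) ≤ 12 * (a * esf s * (e * Th ((G-e)/e))) + 12 * (a*G) * ρ := by
  have hes := esf_nonneg s
  have haG : 0 ≤ a*G := mul_nonneg ha hG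
  have hr : 0 ≤ 12 * (a*G) * ρ := by positivity
  set v := (G-e)/e with hv
  have hGv : G = e*(1+v) := by rw [hv]; field_simp; ring
  rcases le_total v 0 with h0 | h0
  · rw [(Th_neg h0).1, (Th_neg h0).2.1]; simp only [mul_zero, zero_mul, zero_add]; exact hr
  have hss : s ≤ esf s := by
    unfold esf; split_ifs with hc
    · linarith [Real.add_one_le_exp s]
    · exact not_lt.1 hc
  rcases le_total v 1 with h1 | h1
  · rcases h0.eq_or_lt with h00 | h00
    · rw [← h00, (Th_neg le_rfl).1, (Th_neg le_rfl).2.1]; simp only [mul_zero, zero_mul, zero_add]; exact hr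
    have t1 : Th1 v ≤ 3*v^2 := by have := Th1_le v; rwa [cl_mid h0 h1] at this
    have t2 : v^3 ≤ 2*Th v := by have := cl_cube_le v; rwa [cl_mid h0 h1] at this
    have hG2 : G ≤ 2*e := by rw [hGv]; nlinarith
    have hρ2 := hρ' hG2
    have hl := leg (s := s) (α := v^2) (X := v^3) hs (by positivity) (by positivity)
    have e1 : v^2/v^3 = v⁻¹ := by field_simp
    rw [e1, Real.log_inv] at hl
    have e2 : max (-Real.log v) 0 = -Real.log v := max_eq_left (by linarith [Real.log_nonpos h0 h1])
    rw [e2] at hl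
    have e3 : v^2 * (-Real.log v) ≤ 1 := by
      have := neglog_le h00
      calc v^2 * (-Real.log v) = v * (v * (-Real.log v)) := by ring
        _ ≤ v * 1 := by gcongr
        _ ≤ 1 := by linarith
    have e4 : s * v^2 ≤ 2*Th v*esf s + 1 := by
      have := mul_le_mul_of_nonneg_right t2 hes
      linarith
    have e5 : s * Th1 v ≤ 3*(2*Th v*esf s + 1) := by
      have := mul_le_mul_of_nonneg_left t1 hs
      linarith
    have hT := Th_nonneg v
    have heG : e ≤ G := by rw [hGv]; nlinarith
    calc s * Th1 v * (a*G) ≤ 3*(2*Th v*esf s + 1) * (a*G) := by gcongr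
      _ = 6*(a * esf s * Th v)*G + 3*(a*G) := by ring
      _ ≤ 6*(a * esf s * Th v)*(2*e) + 12*(a*G)*ρ := by
          have q1 : 3*(a*G) ≤ 12*(a*G)*ρ := by nlinarith
          have q2 := mul_le_mul_of_nonneg_left hG2 (show 0 ≤ 6*(a * esf s * Th v) by positivity)
          linarith
      _ = _ := by ring
  · rw [(Th_big h1).1, (Th_big h1).2.1]
    have : G ≤ 12*(e*(v-1/2)) := by rw [hGv]; nlinarith
    calc s*1*(a*G) ≤ esf s * 1 * (a*G) := by gcongr
      _ = a*esf s*G := by ring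
      _ ≤ a*esf s*(12*(e*(v-1/2))) := by gcongr
      _ ≤ _ := by linarith

lemma I2_harm {v s η : ℝ} (hv0 : 0 < v) (hv1 : v ≤ 1) (hs : 0 ≤ s) (hη : 0 < η) (hη1 : η ≤ 1) :
    s * v * η^3 ≤ 2*η*(η^4*Th v)*esf s + 4*η^2 := by
  have hes := esf_nonneg s
  have t2 : v^3 ≤ 2*Th v := by have := cl_cube_le v; rwa [cl_mid hv0.le hv1] at this
  have hl := leg (s := s) (α := v) (X := η^2*v^3) hs hv0.le (by positivity)
  have e1 : v/(η^2*v^3) = ((η*v)^2)⁻¹ := by field_simp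
  rw [e1, Real.log_inv, Real.log_pow, Real.log_mul hη.ne' hv0.ne'] at hl
  have l1 := Real.log_nonpos hη.le hη1
  have l2 := Real.log_nonpos hv0.le hv1
  have e2 : max (-(((2:ℕ):ℝ) * (Real.log η + Real.log v))) 0 = 2*(-Real.log η) + 2*(-Real.log v) := by
    rw [max_eq_left (by push_cast; linarith)]; push_cast; ring
  rw [e2] at hl
  have e3 := neglog_le hv0
  have e4 := neglog_le hη
  have e5 : η * (v * (2*(-Real.log η) + 2*(-Real.log v))) ≤ 4 := by
    have a1 : v*(η*(-Real.log η)) ≤ 1*1 := mul_le_mul hv1 e4 (mul_nonneg hη.le (by linarith)) zero_le_one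
    have a2 : η*(v*(-Real.log v)) ≤ 1*1 := mul_le_mul hη1 e3 (mul_nonneg hv0.le (by linarith)) zero_le_one
    nlinarith
  have e6 : η^2*v^3*esf s ≤ η^2*(2*Th v)*esf s := by gcongr
  calc s*v*η^3 = η^3*(s*v) := by ring
    _ ≤ η^3 * (η^2*(2*Th v)*esf s + v * (2*(-Real.log η) + 2*(-Real.log v))) := by gcongr; linarith
    _ = 2*η*(η^4*Th v)*esf s + η^2*(η * (v * (2*(-Real.log η) + 2*(-Real.log v)))) := by ring
    _ ≤ 2*η*(η^4*Th v)*esf s + η^2*4 := by gcongr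
    _ = _ := by ring

variable {N : ℕ} {Ω : Set (Eu N)} {w g b : Eu N → ℝ} {x0 : Eu N} {B Cg CB D cg r0 cb : ℝ}

lemma pq_lin {f1 f2 f3 : Eu N → ℝ} (h1 : Integrable f1) (h2 : Integrable f2) (h3 : Integrable f3) {c α β t : ℝ} (ht : 0 < t)
    (z : Eu N) (hle : ∀ y, c * f1 y ≤ α * f2 y + β * f3 y) : c * pq f1 t z ≤ α * pq f2 t z + β * pq f3 t z := by
  have hi : c * ∫ y in Metric.ball z t, f1 y ≤ α * (∫ y in Metric.ball z t, f2 y) + β * ∫ y in Metric.ball z t, f3 y := by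
    rw [← integral_const_mul, ← integral_const_mul, ← integral_const_mul,
      ← integral_add (h2.integrableOn.const_mul α) (h3.integrableOn.const_mul β)]
    exact integral_mono (h1.integrableOn.const_mul c) ((h2.integrableOn.const_mul α).add (h3.integrableOn.const_mul β)) hle
  have hp : 0 ≤ (t^N)⁻¹ := by positivity
  unfold pq
  have := mul_le_mul_of_nonneg_left hi hp
  linarith

lemma tele_sum (h : GD Ω w g b x0 B Cg CB D cg r0 cb) {e : ℝ} (he : 0 < e) {k0 n : ℕ} (hn : k0 ≤ n) {z : Eu N}
    (hz : ∀ y, dist y z < tk k0 → b y = 0) :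
    ∑ j ∈ Finset.Ico k0 (n+1), pj w g j z * (rr e (ph g (tk j) z)^7)⁻¹ * tk j ≤ 16384 * 4^N * e := by
  have hterm : ∀ j ∈ Finset.Ico k0 (n+1), pj w g j z * (rr e (ph g (tk j) z)^7)⁻¹ * tk j ≤
      16384*4^N*e * ((rr e (ph g (tk (j+1+3)) z)^2)⁻¹ - (rr e (ph g (tk (j+3)) z)^2)⁻¹) := by
    intro j hj
    have hkj := (Finset.mem_Ico.1 hj).1
    have d := (h.D1 (tk_pos (j+3)) (hzmono hz (by omega : k0 ≤ j+3))).1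
    have e1 : tk (j+3)/4 = tk (j+5) := by rw [tk_succ (j+4), tk_succ (j+3)]; ring
    have e2 : tk (j+3)/2 = tk (j+1+3) := by rw [← tk_succ (j+3)]
    have e3 : tk (j+3) = tk j/8 := by rw [tk_succ (j+2), tk_succ (j+1), tk_succ j]; ring
    rw [e1, e2] at d
    rw [e3] at d
    rw [← e3] at d
    have hp3 := ph_nonneg h.gnn (tk_pos (j+3)) z
    have hp4 := ph_nonneg h.gnn (tk_pos (j+1+3)) z
    have hp0 := ph_nonneg h.gnn (tk_pos j) z
    have hm : ph g (tk (j+1+3)) z ≤ ph g (tk (j+3)) z := h.ph_anti' (by omega) (hzmono hz (by omega : k0 ≤ j+3))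
    have hm0 : ph g (tk (j+3)) z ≤ ph g (tk j) z := h.ph_anti' (by omega) (hzmono hz hkj)
    have t := tele_step (rr_ge he hp4) (rr_mono he hm)
    rw [rr_pow he hp3, rr_pow he hp4] at t
    set R := rr e (ph g (tk (j+3)) z) with hR
    have hR1 : 1 ≤ R := rr_ge he hp3
    have hRR : R ≤ rr e (ph g (tk j) z) := rr_mono he hm0
    set R0 := rr e (ph g (tk j) z)
    have q1 : (R0^7)⁻¹ ≤ (R^6)⁻¹ := by
      apply inv_anti₀ (by positivity)
      calc R^6 ≤ R0^6 := by gcongr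
        _ ≤ R0^7 := pow_le_pow_right₀ (hR1.trans hRR) (by norm_num)
    have q2 : pj w g j z * tk j ≤ 8192*4^N*(ph g (tk (j+3)) z - ph g (tk (j+1+3)) z) := by
      unfold pj
      have e4 : (tk j * pq (ff w g) (tk (j+5)) z) * tk j = 8192*4^N*(((4:ℝ)^N)⁻¹/128*(tk j/8)^2*pq (ff w g) (tk (j+5)) z) := by
        field_simp; ring
      rw [e4]
      rw [e3] at d ⊢
      gcongr
    have q0 : 0 ≤ pj w g j z * tk j := mul_nonneg (h.pj_nonneg j z) (tk_pos j).le
    have q3 : 0 ≤ (R^6)⁻¹ := by positivity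
    calc pj w g j z * (R0^7)⁻¹ * tk j = pj w g j z * tk j * (R0^7)⁻¹ := by ring
      _ ≤ 8192*4^N*(ph g (tk (j+3)) z - ph g (tk (j+1+3)) z) * (R^6)⁻¹ := mul_le_mul q2 q1 (inv_nonneg.2 (pow_nonneg (by linarith) _)) (q0.trans q2)
      _ = 8192*4^N*e*((1 + ph g (tk (j+3)) z/e - (1 + ph g (tk (j+1+3)) z/e)) * (R^6)⁻¹) := by field_simp; ring
      _ ≤ 8192*4^N*e*(2 * ((rr e (ph g (tk (j+1+3)) z)^2)⁻¹ - (R^2)⁻¹)) := by gcongr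
      _ = _ := by ring
  refine (Finset.sum_le_sum hterm).trans ?_
  rw [← Finset.mul_sum, Finset.sum_Ico_sub (fun j => (rr e (ph g (tk (j+3)) z)^2)⁻¹) (by omega)]
  have a1 := rr_inv_le he (ph_nonneg h.gnn (tk_pos (n+1+3)) z) 2
  have a2 : 0 ≤ (rr e (ph g (tk (k0+3)) z)^2)⁻¹ := by positivity
  have : (rr e (ph g (tk (n+1+3)) z)^2)⁻¹ - (rr e (ph g (tk (k0+3)) z)^2)⁻¹ ≤ 1 := by linarith
  calc _ ≤ 16384*4^N*e*1 := by gcongr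
    _ = _ := by ring

noncomputable def K1 (N : ℕ) : ℝ := 64/27*2^N*(32768*4^N)
lemma K1_pos : 0 < K1 N := by unfold K1; positivity

lemma inner_pt (h : GD Ω w g b x0 B Cg CB D cg r0 cb) {e δ v s : ℝ} (he : 0 < e) (hδ : 0 < δ) (hδ1 : δ ≤ 1) (hv : 0 < v) (hv1 : v ≤ 1)
    (hs : 0 ≤ s) {k0 j i : ℕ} (hj : k0 ≤ j) (hi : j ≤ i) {z : Eu N} (hz : ∀ y, dist y z < tk k0 → b y = 0) :
    (s*v) * pq (ff w g) (tk (i+5)) z ≤ 64/27*2^N*δ*Real.exp (-B)*e*v^3*esf s +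
      ((7 + (-Real.log δ))*rr e (ph g (tk j) z)) * pq (FF w g B) (tk (i+5)) z := by
  have hφi := ph_nonneg h.gnn (tk_pos i) z
  have hφij : ph g (tk i) z ≤ ph g (tk j) z := h.ph_anti' hi (hzmono hz hj)
  set R := rr e (ph g (tk i) z) with hR
  set R0 := rr e (ph g (tk j) z) with hR0
  have hR1 : 1 ≤ R := rr_ge he hφi
  have hRR : R ≤ R0 := rr_mono he hφij
  have hR4 : R^4 = 1 + ph g (tk i) z/e := rr_pow he hφi
  set X := Real.exp (-B)*δ*(R^4)⁻¹*v^2 with hX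
  have hXp : 0 < X := by positivity
  have hld := Real.log_nonpos hδ.le hδ1
  have hlv := Real.log_nonpos hv.le hv1
  have hlR : 0 ≤ Real.log R := Real.log_nonneg hR1
  have hlR' : Real.log R ≤ R := by linarith [Real.log_le_sub_one_of_pos (show 0 < R by linarith)]
  have hes := esf_nonneg s
  have hpt : ∀ y, (s*v) * ff w g y ≤ (v*X*esf s) * g y + ((7 + (-Real.log δ))*R0) * FF w g B y := by
    intro y
    have hl := leg (s := s) (α := Real.exp (w y)) (X := X) hs (Real.exp_pos _).le hXp
    have hwB : 0 ≤ w y + B := by linarith [h.wB y]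
    have e1 : Real.log (Real.exp (w y)/X) = (w y + B) + (-Real.log δ) + 4*Real.log R + 2*(-Real.log v) := by
      rw [Real.log_div (Real.exp_pos _).ne' hXp.ne', hX, Real.log_mul (by positivity) (by positivity),
        Real.log_mul (by positivity) (by positivity), Real.log_mul (by positivity) (by positivity), Real.log_inv,
        Real.log_pow, Real.log_pow, Real.log_exp, Real.log_exp]
      push_cast; ring
    rw [e1, max_eq_left (by linarith)] at hl
    have e2 : v * ((w y + B) + (-Real.log δ) + 4*Real.log R + 2*(-Real.log v)) ≤ (7 + (-Real.log δ))*R0*(w y + B + 1) := by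
      have a0 := neglog_le hv
      have a1 : v * ((w y + B) + (-Real.log δ) + 4*Real.log R) ≤ 1 * ((w y + B) + (-Real.log δ) + 4*R0) := by
        apply mul_le_mul hv1 _ (by linarith) zero_le_one
        linarith
      have a2 : 1 ≤ R0 := hR1.trans hRR
      have a3 : 1 ≤ w y + B + 1 := by linarith
      have a4 : R0 ≤ R0*(w y+B+1) := le_mul_of_one_le_right (by linarith) a3
      have a5 : w y+B+1 ≤ R0*(w y+B+1) := le_mul_of_one_le_left (by linarith) a2
      have a6 : (-Real.log δ)*1 ≤ (-Real.log δ)*(R0*(w y+B+1)) := by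
        apply mul_le_mul_of_nonneg_left (by linarith) (by linarith)
      nlinarith
    have hgy := h.gnn y
    have hay := (Real.exp_pos (w y)).le
    have e3 := mul_le_mul_of_nonneg_left hl (mul_nonneg hv.le hgy)
    have e4 := mul_le_mul_of_nonneg_left e2 (mul_nonneg hay hgy)
    unfold FF ff
    calc (s*v)*(Real.exp (w y)*g y) = v*g y*(s*Real.exp (w y)) := by ring
      _ ≤ _ := e3
      _ = (v*X*esf s)*g y + Real.exp (w y)*g y*(v * ((w y + B) + (-Real.log δ) + 4*Real.log R + 2*(-Real.log v))) := by ring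
      _ ≤ (v*X*esf s)*g y + Real.exp (w y)*g y*((7 + (-Real.log δ))*R0*(w y + B + 1)) := by linarith
      _ = _ := by ring
  have hl := pq_lin h.fi h.gi h.FFi (tk_pos (i+5)) z hpt
  refine hl.trans ?_
  have hpg : pq g (tk (i+5)) z ≤ 64/27*2^N*(e*R^4) := by
    have a1 := ph_ge h.gi h.gnn (tk_pos (i+4)) z
    rw [← tk_succ (i+4)] at a1
    have a2 : ph g (tk (i+4)) z ≤ ph g (tk i) z := h.ph_anti' (by omega) (hzmono hz (hj.trans hi))
    have a3 : ph g (tk i) z ≤ e*R^4 := by rw [hR4]; field_simp; linarith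
    have a4 : pq g (tk (i+4+1)) z = 64/27*2^N*(27/64*((2:ℝ)^N)⁻¹*pq g (tk (i+4+1)) z) := by field_simp
    rw [show i+5 = i+4+1 from rfl, a4]
    exact mul_le_mul_of_nonneg_left (by linarith) (by positivity)
  have hb : (v*X*esf s) * pq g (tk (i+5)) z ≤ (v*X*esf s)*(64/27*2^N*(e*R^4)) := by gcongr
  have hb2 : (v*X*esf s)*(64/27*2^N*(e*R^4)) = 64/27*2^N*δ*Real.exp (-B)*e*v^3*esf s := by
    rw [hX]; field_simp
  linarith

lemma I2_main (h : GD Ω w g b x0 B Cg CB D cg r0 cb) {e δ v s : ℝ} (he : 0 < e) (hδ : 0 < δ) (hδ1 : δ ≤ 1) (hv : 0 < v) (hv1 : v ≤ 1)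
    (hs : 0 ≤ s) {k0 n : ℕ} (hn : k0 ≤ n) {z : Eu N} (hz : ∀ y, dist y z < tk k0 → b y = 0) :
    s*v*Bz w g e k0 n z ≤ K1 N*δ*Real.exp (-B)*e^2*v^3*esf s + (7 + (-Real.log δ))*WS w g B e k0 n z := by
  set A := 64/27*2^N*δ*Real.exp (-B)*e*v^3*esf s with hA
  have hes := esf_nonneg s
  have hA0 : 0 ≤ A := by positivity
  set K := 7 + (-Real.log δ) with hK
  have hterm : ∀ j ∈ Finset.Ico k0 (n+1), s*v*(pj w g j z * (rr e (ph g (tk j) z)^7)⁻¹ * ∑ i ∈ Finset.Ico j (n+1), pj w g i z) ≤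
      A*2*(pj w g j z * (rr e (ph g (tk j) z)^7)⁻¹ * tk j) + K * ∑ i ∈ Finset.Ico j (n+1),
        pj w g j z*(rr e (ph g (tk j) z)^6)⁻¹*(tk i*pq (FF w g B) (tk (i+5)) z) := by
    intro j hj
    have hkj := (Finset.mem_Ico.1 hj).1
    have hR1 : 1 ≤ rr e (ph g (tk j) z) := rr_ge he (ph_nonneg h.gnn (tk_pos j) z)
    set R := rr e (ph g (tk j) z) with hR
    have hp := h.pj_nonneg j z
    have hc : 0 ≤ pj w g j z * (R^7)⁻¹ := by positivity
    have s1 : s*v*∑ i ∈ Finset.Ico j (n+1), pj w g i z ≤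
        A*(2*tk j) + ∑ i ∈ Finset.Ico j (n+1), K*R*(tk i*pq (FF w g B) (tk (i+5)) z) := by
      have : s*v*∑ i ∈ Finset.Ico j (n+1), pj w g i z ≤
          ∑ i ∈ Finset.Ico j (n+1), (A*tk i + K*R*(tk i*pq (FF w g B) (tk (i+5)) z)) := by
        rw [Finset.mul_sum]
        apply Finset.sum_le_sum
        intro i hi
        have ip := inner_pt h he hδ hδ1 hv hv1 hs hkj (Finset.mem_Ico.1 hi).1 hz
        have := mul_le_mul_of_nonneg_left ip (tk_pos i).le
        unfold pj
        calc s*v*(tk i*pq (ff w g) (tk (i+5)) z) = tk i*(s*v*pq (ff w g) (tk (i+5)) z) := by ring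
          _ ≤ _ := this
          _ = _ := by ring
      refine this.trans ?_
      rw [Finset.sum_add_distrib, ← Finset.mul_sum]
      have := mul_le_mul_of_nonneg_left (tk_sum j (n+1)) hA0
      linarith
    have s2 := mul_le_mul_of_nonneg_left s1 hc
    calc _ = pj w g j z * (R^7)⁻¹ * (s*v*∑ i ∈ Finset.Ico j (n+1), pj w g i z) := by ring
      _ ≤ _ := s2
      _ = _ := by
        rw [mul_add, Finset.mul_sum, Finset.mul_sum]
        congr 1
        · ring
        · apply Finset.sum_congr rfl
          intro i _
          field_simp
  have e1 : s*v*Bz w g e k0 n z = ∑ j ∈ Finset.Ico k0 (n+1),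
      s*v*(pj w g j z * (rr e (ph g (tk j) z)^7)⁻¹ * ∑ i ∈ Finset.Ico j (n+1), pj w g i z) := by
    unfold Bz; rw [Finset.mul_sum]
  rw [e1]
  refine (Finset.sum_le_sum hterm).trans ?_
  rw [Finset.sum_add_distrib, ← Finset.mul_sum, ← Finset.mul_sum]
  have ts := mul_le_mul_of_nonneg_left (tele_sum h he hn hz) (show 0 ≤ A*2 by positivity)
  have e2 : A*2*(16384*4^N*e) = K1 N*δ*Real.exp (-B)*e^2*v^3*esf s := by rw [hA]; unfold K1; ring
  have e3 : WS w g B e k0 n z = ∑ j ∈ Finset.Ico k0 (n+1), ∑ i ∈ Finset.Ico j (n+1),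
        pj w g j z*(rr e (ph g (tk j) z)^6)⁻¹*(tk i*pq (FF w g B) (tk (i+5)) z) := rfl
  rw [e3]
  linarith

end pointwise

section stage
variable {N : ℕ} {Ω : Set (Eu N)} {U : ℕ → Eu N → ℝ} {V : Eu N → ℝ} {g b : Eu N → ℝ} {x0 : Eu N} {B Cg CB D cg r0 cb : ℝ}

noncomputable def Er (w g : Eu N → ℝ) (t : ℝ) (z : Eu N) : ℝ :=
  |ph (ff w g) t z - c3 N * ff w g z| + Real.exp (w z) * |ph g t z - c3 N * g z|

lemma Er_nonneg (w g : Eu N → ℝ) (t : ℝ) (z : Eu N) : 0 ≤ Er w g t z := by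
  unfold Er; positivity

noncomputable def C0 (N : ℕ) (CH δ : ℝ) : ℝ := 12 * c3 N + 6*CH*(7 + (-Real.log δ))*(v1 N * (2^13*8^N/c2 N))

lemma c2_le_one : c2 N ≤ 1 := by
  unfold c2
  have : ((4:ℝ)^N)⁻¹ ≤ 1 := inv_le_one_of_one_le₀ (one_le_pow₀ (by norm_num))
  linarith

lemma Er_int (hG : GD Ω (WW Ω U) g b x0 B Cg CB D cg r0 cb) {Q1 : Set (Eu N)} (hQ : IsCompact Q1) (hQΩ : Q1 ⊆ Ω) {t : ℝ} (ht : 0 < t) :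
    Integrable (Q1.indicator (Er (WW Ω U) g t)) := by
  obtain ⟨M, hM0, hM⟩ := hG.wloc Q1 hQ hQΩ
  rw [integrable_indicator_iff hQ.measurableSet]
  have c1 := (ph_contDiff hG.fi ht).continuous
  have c2' := (ph_contDiff hG.gi ht).continuous
  have i1 : IntegrableOn (fun z => ph (ff (WW Ω U) g) t z - c3 N * ff (WW Ω U) g z) Q1 :=
    (c1.continuousOn.integrableOn_compact hQ).sub (hG.fi.integrableOn.const_mul _)
  have i2 : IntegrableOn (fun z => ph g t z - c3 N * g z) Q1 :=
    (c2'.continuousOn.integrableOn_compact hQ).sub (hG.gi.integrableOn.const_mul _)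
  refine i1.norm.add ?_
  refine i2.norm.bdd_mul (c := M) hG.wm.exp.aestronglyMeasurable ?_
  refine (ae_restrict_iff' hQ.measurableSet).2 (Eventually.of_forall fun x hx => ?_)
  rw [Real.norm_eq_abs, abs_of_pos (Real.exp_pos _)]
  exact hM x hx

set_option maxHeartbeats 1600000 in
lemma stage (h : Sys Ω U V B) (hG : GD Ω (WW Ω U) g b x0 B Cg CB D cg r0 cb) {Q1 : Set (Eu N)} (hQ : IsCompact Q1) (hQΩ : Q1 ⊆ Ω)
    {MV η δ CH : ℝ} (hMV0 : 0 ≤ MV) (hMV : ∀ x ∈ Q1, ss Ω U V 3 x ≤ MV) (hη : 0 < η) (hη1 : η ≤ 1) (hδ : 0 < δ) (hδ1 : δ ≤ 1) (hCH0 : 0 ≤ CH)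
    {k0 n : ℕ} (hn : k0 ≤ n)
    (hsup : ∀ z, η^4 ≤ ph g (tk (n+5)) z → z ∈ Q1)
    (hLz : ∀ z, ph g (tk (n+5)) z < 2*η^4 → ∀ y, dist y z < tk k0 → b y = 0)
    (hφn : ∀ z, η^4 < ph g (tk (n+5)) z → ph g (tk (n+5)) z < 2*η^4 → ph g (tk n) z ≤ 4*η^4)
    (hCH : ∀ z, (∀ y, dist y z < tk k0 → b y = 0) → ph g (tk (n + 5)) z ≤ 2 * η ^ 4 →
      ph g (tk n) z ≤ 4 * η ^ 4 → gradSq (ph g (tk (n + 5))) z ≤ CH * (Bz (WW Ω U) g (η ^ 4) k0 n z + η ^ 7))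
    (hd : 12*CH*K1 N*δ ≤ 1) (he : 12*CH*η*Real.exp B ≤ 1) :
    ∫ z, ss Ω U V 3 z * (Th1 ((ph g (tk (n+5)) z - η^4)/η^4) * ph b (tk (n+5)) z) ≤
      C0 N CH δ * (∫ y, FF (WW Ω U) g B y * (rr (η^4 / c2 N) (ph g (tk (n + 5)) y) ^ 2)⁻¹) +
      (MV+12) * (∫ z, Q1.indicator (Er (WW Ω U) g (tk (n+5))) z) + 24*CH*η^2*(volume Ω).toReal := by
  set w := WW Ω U with hw
  set s := ss Ω U V 3 with hsd
  set G := ph g (tk (n+5)) with hGd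
  set e := η^4 with hed
  have hep : 0 < e := by positivity
  have ht := tk_pos (n+5)
  have hGcd : ContDiff ℝ 2 G := ph_contDiff hG.gi ht
  have hGc := hGcd.continuous
  have hG0 : ∀ z, 0 ≤ G z := fun z => ph_nonneg hG.gnn ht z
  have hf0 : ∀ z, 0 ≤ ph (ff w g) (tk (n+5)) z := fun z => ph_nonneg hG.ffnn ht z
  have hb0 : ∀ z, 0 ≤ ph b (tk (n+5)) z := fun z => ph_nonneg hG.bnn ht z
  have hfc := (ph_contDiff hG.fi ht).continuous
  have hbc := (ph_contDiff hG.bi ht).continuous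
  have hs0 : ∀ z, 0 ≤ s z := fun z => ss_nonneg 3 z
  have hsm : Measurable s := ss_meas h 3
  set vv : Eu N → ℝ := fun z => (G z - e)/e with hvv
  have hvc : Continuous vv := (hGc.sub continuous_const).div_const e
  set ζ : Eu N → ℝ := fun z => Ths e (G z - e) with hζd
  have hζcd : ContDiff ℝ 2 ζ := (Ths_contDiff hep).comp (hGcd.sub contDiff_const)
  have hζe : ∀ z, ζ z = e*Th (vv z) := fun z => rfl
  have hζ0 : ∀ z, 0 ≤ ζ z := fun z => Ths_nonneg hep _
  have hvneg : ∀ z, z ∉ Q1 → vv z ≤ 0 := fun z hz => by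
    have : G z < e := by by_contra hc; exact hz (hsup z (not_lt.1 hc))
    exact div_nonpos_of_nonpos_of_nonneg (by linarith) hep.le
  have hζoff : ∀ z, z ∉ Q1 → ζ z = 0 := fun z hz => by rw [hζe, (Th_neg (hvneg z hz)).1, mul_zero]
  have hζt : tsupport ζ ⊆ Q1 := closure_minimal (fun z hz => by by_contra hc; exact hz (hζoff z hc)) hQ.isClosed
  have hζc : HasCompactSupport ζ := HasCompactSupport.intro hQ hζoff
  have hζs := hζt.trans hQΩ
  have kt := kato_s h (by norm_num : (0:ℝ) ≤ 3) hζcd hζc hζs hζ0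
  rw [← hw, ← hsd] at kt
  set J := ∫ x, Real.exp (w x) * esf (s x) * ζ x with hJ
  -- integrability
  have hsk : ∀ k : Eu N → ℝ, Continuous k → (∀ z ∉ Q1, k z = 0) → Integrable (fun z => s z * k z) := by
    intro k hk hk0
    have hki : Integrable k := hk.integrable_of_hasCompactSupport (HasCompactSupport.intro hQ hk0)
    refine (hki.norm.const_mul MV).mono' (hsm.mul hk.measurable).aestronglyMeasurable (Eventually.of_forall fun z => ?_)
    by_cases hz : z ∈ Q1
    · rw [norm_mul, Real.norm_eq_abs, abs_of_nonneg (hs0 z)]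
      exact mul_le_mul_of_nonneg_right (hMV z hz) (norm_nonneg _)
    · rw [hk0 z hz]; simp
  have hlap : ∀ z, laplacian ζ z = Th2 (vv z)/e * gradSq G z + Th1 (vv z) * (ph (ff w g) (tk (n+5)) z - ph b (tk (n+5)) z) := by
    intro z
    have h1 := lap_Ths (u := fun y => G y - e) (x := z) hep (hGcd.sub contDiff_const).contDiffAt
    have h2 := lap_sub (u := G) (v := fun _ => e) (x := z) hGcd.contDiffAt contDiffAt_const
    rw [lap_const, sub_zero, hG.lap_ph ht z] at h2
    rw [h2] at h1
    have h3 : gradSq (fun y => G y - e) z = gradSq G z := by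
      unfold gradSq
      refine Finset.sum_congr rfl fun i _ => ?_
      rw [pd_sub (cd_diff hGcd.contDiffAt) (differentiableAt_const _), pd_const, sub_zero]
    rw [h3] at h1
    exact h1
  have iA : Integrable (fun z => s z * laplacian ζ z) := hsk _ (lap_continuous hζcd) fun z hz =>
    image_eq_zero_of_notMem_tsupport (fun hc => hz (hζt (tsupport_lap hc)))
  have iB : Integrable (fun z => s z * (Th1 (vv z) * ph b (tk (n+5)) z)) :=
    hsk _ ((Th1_continuous.comp hvc).mul hbc) fun z hz => by rw [(Th_neg (hvneg z hz)).2.1, zero_mul]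
  have iJ : Integrable (fun x => Real.exp (w x) * esf (s x) * ζ x) := by
    have hexpV : Integrable (fun x => Real.exp (V x) * ζ x) :=
      mul_cs_int h.op (Real.continuous_exp.comp_continuousOn h.Vcd.continuousOn) hζcd.continuous.continuousOn hζs hζc
    refine hexpV.mono' ((hG.wm.exp.mul (esf_meas.comp hsm)).mul hζcd.continuous.measurable).aestronglyMeasurable
      (Eventually.of_forall fun x => ?_)
    rw [Real.norm_eq_abs, abs_of_nonneg (mul_nonneg (mul_nonneg (Real.exp_pos _).le (esf_nonneg _)) (hζ0 x))]
    by_cases hx : x ∈ Q1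
    · refine mul_le_mul_of_nonneg_right ?_ (hζ0 x)
      calc Real.exp (w x) * esf (s x) ≤ Real.exp (w x) * Real.exp (s x) :=
            mul_le_mul_of_nonneg_left (esf_le _) (Real.exp_pos _).le
        _ = Real.exp (w x + s x) := (Real.exp_add _ _).symm
        _ ≤ _ := Real.exp_le_exp.2 (wss_le h (by norm_num) (hQΩ hx))
    · rw [hζoff x hx]; simp
  have hJ0 : 0 ≤ J := integral_nonneg fun x => mul_nonneg (mul_nonneg (Real.exp_pos _).le (esf_nonneg _)) (hζ0 x)
  set L : Set (Eu N) := {z | e < G z ∧ G z < 2*e} with hLd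
  have hLm : MeasurableSet L := (measurableSet_lt measurable_const hGc.measurable).inter (measurableSet_lt hGc.measurable measurable_const)
  have hLQ : L ⊆ Q1 := fun z hz => hsup z hz.1.le
  have hΩv : volume Ω < ⊤ := h.bdd.measure_lt_top
  have hLv : volume L < ⊤ := (measure_mono (hLQ.trans hQΩ)).trans_lt hΩv
  have hW := hG.W hep hn hLm hLv (fun z hz => hLz z hz.2)
  have iW := hG.WS_integrable hep k0 n hLm hLv
  set ρ : Eu N → ℝ := fun y => (rr (e / c2 N) (G y) ^ 2)⁻¹ with hρd
  have hec : 0 < e / c2 N := div_pos hep c2_pos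
  have iF : Integrable (fun y => FF w g B y * ρ y) := by
    refine hG.FFi.mul_bdd (c := 1) ((rr_meas hGc _).pow_const 2).inv.aestronglyMeasurable (Eventually.of_forall fun y => ?_)
    rw [Real.norm_eq_abs, abs_of_nonneg (by positivity)]
    exact rr_inv_le hec (hG0 y) 2
  set E := Q1.indicator (Er w g (tk (n+5))) with hEd
  have iE : Integrable E := Er_int hG hQ hQΩ ht
  have hE0 : ∀ z, 0 ≤ E z := fun z => indicator_nonneg (fun z _ => Er_nonneg _ _ _ _) z
  have iL : Integrable (L.indicator (fun _ => (1:ℝ))) := (integrable_indicator_iff hLm).2 (integrableOn_const hLv.ne)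
  set K := 7 + (-Real.log δ) with hK
  have hK0 : 0 ≤ K := by linarith [Real.log_nonpos hδ.le hδ1]
  have hWS0 : ∀ z, 0 ≤ WS w g B e k0 n z := fun z => by
    unfold WS
    refine Finset.sum_nonneg fun j _ => Finset.sum_nonneg fun i _ => ?_
    exact mul_nonneg (mul_nonneg (hG.pj_nonneg j z) (by positivity)) (mul_nonneg (tk_pos i).le (pq_nonneg hG.FFnn (tk_pos _) z))
  -- pointwise
  have hpt : ∀ z, s z * laplacian ζ z + s z * (Th1 (vv z) * ph b (tk (n+5)) z) ≤
      14 * (Real.exp (w z) * esf (s z) * ζ z) + 12*c3 N*(FF w g B z * ρ z) + (MV+12)*E z +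
        6*CH*K/e * L.indicator (WS w g B e k0 n) z + 24*CH*η^2*L.indicator (fun _ => (1:ℝ)) z := by
    intro z
    have ha := (Real.exp_pos (w z))
    have hes := esf_nonneg (s z)
    have hsz := hs0 z
    have hz1 := hζ0 z
    have p0 : s z * laplacian ζ z + s z * (Th1 (vv z) * ph b (tk (n+5)) z) =
        s z * Th1 (vv z) * ph (ff w g) (tk (n+5)) z + s z * (Th2 (vv z)/e * gradSq G z) := by rw [hlap z]; ring
    rw [p0]
    have hρ0 : 0 ≤ ρ z := by simp only [hρd]; positivity
    have hFF := hG.FFnn z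
    have hc3 := c3_nonneg (N := N)
    have p1 : s z * Th1 (vv z) * ph (ff w g) (tk (n+5)) z ≤
        12 * (Real.exp (w z) * esf (s z) * ζ z) + 12*c3 N*(FF w g B z * ρ z) + (MV+12)*E z := by
      by_cases hzQ : z ∈ Q1
      swap
      · rw [(Th_neg (hvneg z hzQ)).2.1, mul_zero, zero_mul]
        have := hE0 z
        positivity
      have hEz : E z = Er w g (tk (n+5)) z := indicator_of_mem hzQ _
      have q0 : 0 ≤ |ph (ff w g) (tk (n+5)) z - c3 N * ff w g z| := abs_nonneg _
      have q0' : 0 ≤ Real.exp (w z) * |G z - c3 N * g z| := by positivity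
      have q1 : ph (ff w g) (tk (n+5)) z ≤ Real.exp (w z) * G z + E z := by
        have a1 := le_abs_self (ph (ff w g) (tk (n+5)) z - c3 N * ff w g z)
        have a2 := neg_abs_le (G z - c3 N * g z)
        have a3 := mul_le_mul_of_nonneg_left a2 ha.le
        have a4 : c3 N * ff w g z = Real.exp (w z) * (c3 N * g z) := by unfold ff; ring
        rw [hEz]; unfold Er
        linarith
      have q2 : Real.exp (w z) * G z ≤ c3 N * FF w g B z + E z := by
        have a1 := hG.ff_le_FF z
        have a2 := le_abs_self (G z - c3 N * g z)
        have a3 := mul_le_mul_of_nonneg_left a2 ha.le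
        have a4 : c3 N * ff w g z = Real.exp (w z) * (c3 N * g z) := by unfold ff; ring
        have a5 := mul_le_mul_of_nonneg_left a1 hc3
        rw [hEz]; unfold Er
        linarith
      have q3 : G z ≤ 2*e → 1/2 ≤ ρ z := by
        intro hGz
        simp only [hρd]
        rw [one_div]
        have r1 : 1 ≤ rr (e/c2 N) (G z) := rr_ge hec (hG0 z)
        apply inv_anti₀ (by positivity)
        have r2 := rr_pow hec (hG0 z)
        have r3 : G z/(e/c2 N) ≤ 2 := by
          rw [div_le_iff₀ hec]
          have : 1 ≤ 1/c2 N := by rw [le_div_iff₀ c2_pos]; linarith [c2_le_one (N := N)]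
          calc G z ≤ 2*e := hGz
            _ ≤ 2*(e*(1/c2 N)) := by nlinarith
            _ = _ := by ring
        nlinarith [sq_nonneg (rr (e/c2 N) (G z))]
      have q4 := I1_pt (s := s z) (ρ := ρ z) hep ha.le hsz (hG0 z) hρ0 q3
      have hρ1 : ρ z ≤ 1 := rr_inv_le hec (hG0 z) 2
      have q5 : s z * Th1 (vv z) * E z ≤ MV * E z := by
        refine mul_le_mul_of_nonneg_right ?_ (hE0 z)
        calc s z * Th1 (vv z) ≤ MV * 1 := mul_le_mul (hMV z hzQ) (Th1_le_one _) (Th1_nonneg _) hMV0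
          _ = MV := mul_one _
      have q6 := mul_le_mul_of_nonneg_left q1 (mul_nonneg hsz (Th1_nonneg (vv z)))
      have q7 := mul_le_mul_of_nonneg_right q2 hρ0
      have q8 : E z * ρ z ≤ E z := mul_le_of_le_one_right (hE0 z) hρ1
      have q9 : ζ z = e * Th ((G z - e)/e) := rfl
      rw [q9]
      have q10 : s z * Th1 (vv z) * (Real.exp (w z) * G z) ≤ _ := q4
      linarith
    have p2 : s z * (Th2 (vv z)/e * gradSq G z) ≤ 2 * (Real.exp (w z) * esf (s z) * ζ z) +
        6*CH*K/e * L.indicator (WS w g B e k0 n) z + 24*CH*η^2*L.indicator (fun _ => (1:ℝ)) z := by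
      by_cases hzL : z ∈ L
      swap
      · rw [indicator_of_notMem hzL, indicator_of_notMem hzL]
        have : Th2 (vv z) = 0 := by
          rcases le_or_gt (G z) e with hc | hc
          · exact (Th_neg (div_nonpos_of_nonpos_of_nonneg (by linarith) hep.le)).2.2
          · have : 2*e ≤ G z := by by_contra hc2; exact hzL ⟨hc, not_le.1 hc2⟩
            exact (Th_big (by rw [le_div_iff₀ hep]; linarith)).2.2
        rw [this]
        simp only [zero_div, zero_mul, mul_zero, add_zero]
        positivity
      rw [indicator_of_mem hzL, indicator_of_mem hzL]
      have hv0 : 0 < vv z := div_pos (by linarith [hzL.1]) hep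
      have hv1 : vv z ≤ 1 := by simp only [hvv]; rw [div_le_one hep]; linarith [hzL.2]
      have hz' := hLz z hzL.2
      have g1 := hCH z hz' hzL.2.le (hφn z hzL.1 hzL.2)
      have g2 : Th2 (vv z) ≤ 6*vv z := by have := Th2_le (vv z); rwa [cl_mid hv0.le hv1] at this
      have m1 := I2_main (w := w) hG hep hδ hδ1 hv0 hv1 hsz hn hz'
      have m2 := I2_harm (η := η) hv0 hv1 hsz hη hη1
      have t2 : vv z^3 ≤ 2*Th (vv z) := by have := cl_cube_le (vv z); rwa [cl_mid hv0.le hv1] at this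
      have hTh := Th_nonneg (vv z)
      have haB : Real.exp (-B) ≤ Real.exp (w z) := Real.exp_le_exp.2 (hG.wB z)
      have hgs : 0 ≤ gradSq G z := gradSq_nonneg
      have b1 : s z * (Th2 (vv z)/e * gradSq G z) ≤ 6*CH/e * (s z * vv z * Bz w g e k0 n z) + 6*CH*(s z*vv z*η^3) := by
        calc s z * (Th2 (vv z)/e * gradSq G z) ≤ s z * (6*vv z/e * (CH * (Bz w g e k0 n z + η^7))) := by gcongr
          _ = 6*CH/e * (s z * vv z * Bz w g e k0 n z) + 6*CH*(s z*vv z*(η^7/e)) := by ring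
          _ = _ := by
            have : η^7/e = η^3 := by rw [hed]; field_simp
            rw [this]
      have b2 : 6*CH/e * (s z * vv z * Bz w g e k0 n z) ≤ 1*(Real.exp (w z) * esf (s z) * ζ z) + 6*CH*K/e * WS w g B e k0 n z := by
        have c1 := mul_le_mul_of_nonneg_left m1 (show 0 ≤ 6*CH/e by positivity)
        have c2' : 6*CH/e*(K1 N*δ*Real.exp (-B)*e^2*vv z^3*esf (s z)) ≤ 1*(Real.exp (w z) * esf (s z) * ζ z) := by
          have hK1 := K1_pos (N := N)
          calc 6*CH/e*(K1 N*δ*Real.exp (-B)*e^2*vv z^3*esf (s z)) = 6*CH*K1 N*δ*(Real.exp (-B)*esf (s z)*(e*vv z^3)) := by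
                field_simp
            _ ≤ 6*CH*K1 N*δ*(Real.exp (w z)*esf (s z)*(e*(2*Th (vv z)))) := by gcongr
            _ = 12*CH*K1 N*δ*(Real.exp (w z)*esf (s z)*ζ z) := by rw [hζe]; ring
            _ ≤ _ := by gcongr
        calc _ ≤ _ := c1
          _ = 6*CH/e*(K1 N*δ*Real.exp (-B)*e^2*vv z^3*esf (s z)) + 6*CH*K/e * WS w g B e k0 n z := by ring
          _ ≤ _ := by linarith
      have b3 : 6*CH*(s z*vv z*η^3) ≤ 1*(Real.exp (w z) * esf (s z) * ζ z) + 24*CH*η^2 := by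
        have c1 := mul_le_mul_of_nonneg_left m2 (show 0 ≤ 6*CH by positivity)
        have c2' : 6*CH*(2*η*(η^4*Th (vv z))*esf (s z)) ≤ 1*(Real.exp (w z) * esf (s z) * ζ z) := by
          have hone : (1:ℝ) = Real.exp B * Real.exp (-B) := by rw [← Real.exp_add]; simp
          calc 6*CH*(2*η*(η^4*Th (vv z))*esf (s z)) = 12*CH*η*1*(esf (s z)*ζ z) := by rw [hζe]; ring
            _ = 12*CH*η*(Real.exp B * Real.exp (-B))*(esf (s z)*ζ z) := by rw [← hone]
            _ = 12*CH*η*Real.exp B * (Real.exp (-B)*esf (s z)*ζ z) := by ring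
            _ ≤ 1 * (Real.exp (w z)*esf (s z)*ζ z) := by gcongr
        linarith
      linarith
    linarith
  have hitg := integral_mono (iA.add iB) (((((iJ.const_mul 14).add (iF.const_mul (12*c3 N))).add (iE.const_mul (MV+12))).add
    (iW.const_mul (6*CH*K/e))).add (iL.const_mul (24*CH*η^2))) hpt
  rw [integral_add' iA iB, integral_add' ((((iJ.const_mul 14).add (iF.const_mul (12*c3 N))).add (iE.const_mul (MV+12))).add
    (iW.const_mul (6*CH*K/e))) (iL.const_mul (24*CH*η^2)),
    integral_add' (((iJ.const_mul 14).add (iF.const_mul (12*c3 N))).add (iE.const_mul (MV+12))) (iW.const_mul (6*CH*K/e)),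
    integral_add' ((iJ.const_mul 14).add (iF.const_mul (12*c3 N))) (iE.const_mul (MV+12)),
    integral_add' (iJ.const_mul 14) (iF.const_mul (12*c3 N)),
    integral_const_mul, integral_const_mul, integral_const_mul, integral_const_mul, integral_const_mul] at hitg
  have hLi : ∫ z, L.indicator (fun _ => (1:ℝ)) z ≤ (volume Ω).toReal := by
    rw [integral_indicator hLm]
    simp only [integral_const, smul_eq_mul, mul_one, measureReal_restrict_apply_univ]
    exact ENNReal.toReal_mono hΩv.ne (measure_mono (hLQ.trans hQΩ))
  have hexp : 14 ≤ Real.exp 3 - 1 := by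
    have h1 := Real.exp_one_gt_d9
    have h2 : Real.exp 3 = Real.exp 1^3 := by rw [← Real.exp_nat_mul]; norm_num
    rw [h2]
    have : (2.5:ℝ)^3 ≤ Real.exp 1^3 := by gcongr; linarith
    norm_num at this; linarith
  have f1 := mul_le_mul_of_nonneg_right hexp hJ0
  have f2 := mul_le_mul_of_nonneg_left hW (show 0 ≤ 6*CH*K/e by positivity)
  have f3 := mul_le_mul_of_nonneg_left hLi (show 0 ≤ 24*CH*η^2 by positivity)
  set IF := ∫ y, FF w g B y * ρ y with hIF
  have f4 : 6*CH*K/e*(v1 N * (2^13*8^N/c2 N) * e * IF) = 6*CH*K*(v1 N * (2^13*8^N/c2 N))*IF := by field_simp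
  have f5 : C0 N CH δ * IF = 12*c3 N*IF + 6*CH*K*(v1 N * (2^13*8^N/c2 N))*IF := by unfold C0; rw [hK]; ring
  have f2' : 6*CH*K/e * (∫ z, L.indicator (WS w g B e k0 n) z) ≤ 6*CH*K/e*(v1 N * (2^13*8^N/c2 N) * e * IF) := f2
  rw [f4] at f2'
  change ∫ z, s z * (Th1 (vv z) * ph b (tk (n+5)) z) ≤ C0 N CH δ * IF + _ + _
  rw [f5]
  linarith

end stage

section limits
variable {N : ℕ} {Ω : Set (Eu N)} {U : ℕ → Eu N → ℝ} {V : Eu N → ℝ} {g b : Eu N → ℝ} {x0 : Eu N} {B Cg CB D cg r0 cb : ℝ}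

lemma c3_pos : 0 < c3 N := by
  unfold c3
  have hc := pwq_cont (N := N) 3 1 0
  have hcs : HasCompactSupport (fun y : Eu N => pw 3 (qd 1 1 0 y)) := by
    have := pwq_hcs (N := N) 2 (t := 1) one_pos 0
    simpa using this
  refine hc.integral_pos_of_hasCompactSupport_nonneg_nonzero hcs (fun y => pw_nonneg _ _) (x := 0) ?_
  simp [qd, pw]

lemma ph_ae {f : Eu N → ℝ} (hf : Integrable f) : ∀ᵐ z, Tendsto (fun n => ph f (tk (n+5)) z) atTop (𝓝 (c3 N * f z)) := by
  have hL := IsUnifLocDoublingMeasure.ae_tendsto_average_norm_sub (μ := (volume : Measure (Eu N))) hf.locallyIntegrable 1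
  filter_upwards [hL] with z hz
  have ht : Tendsto (fun n => tk (n+5)) atTop (𝓝[>] 0) :=
    tendsto_nhdsWithin_iff.2 ⟨(tendsto_add_atTop_iff_nat 5).2 tk_tendsto, Eventually.of_forall fun n => tk_pos _⟩
  have h1 := hz (fun _ => z) (fun n => tk (n+5)) ht (Eventually.of_forall fun n => by
    simpa using (tk_pos (n+5)).le)
  have h2 := h1.const_mul (v1 N)
  rw [mul_zero] at h2
  rw [tendsto_iff_dist_tendsto_zero]
  refine squeeze_zero (fun _ => dist_nonneg) (fun n => ?_) h2
  rw [Real.dist_eq]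
  refine (ph_sub hf (tk_pos (n+5)) z).trans ?_
  rw [setAverage_eq, smul_eq_mul]
  have hv : volume.real (Metric.closedBall z (tk (n+5))) = tk (n+5)^N * v1 N := by
    rw [measureReal_def, Measure.addHaar_closedBall _ _ (tk_pos (n+5)).le, ENNReal.toReal_mul,
      ENNReal.toReal_ofReal (pow_nonneg (tk_pos _).le _), finrank_euclideanSpace, Fintype.card_fin]
    rfl
  rw [hv, mul_inv]
  have hvp := v1_pos (N := N)
  have e1 : v1 N * ((tk (n+5)^N)⁻¹ * (v1 N)⁻¹ * ∫ y in Metric.closedBall z (tk (n+5)), ‖f y - f z‖) =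
      (tk (n+5)^N)⁻¹ * ∫ y in Metric.closedBall z (tk (n+5)), ‖f y - f z‖ := by field_simp
  rw [e1]
  refine mul_le_mul_of_nonneg_left ?_ (inv_nonneg.2 (pow_nonneg (tk_pos _).le _))
  refine setIntegral_mono_set ?_ (Eventually.of_forall fun y => norm_nonneg (f y - f z)) (Metric.ball_subset_closedBall).eventuallyLE
  exact (hf.integrableOn.sub (integrableOn_const measure_closedBall_lt_top.ne)).norm

lemma rr_sq (e x : ℝ) : rr e x^2 = √(1+x/e) := by unfold rr; exact Real.sq_sqrt (Real.sqrt_nonneg _)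

lemma rr_cont (e : ℝ) : Continuous (rr e) := by
  unfold rr
  exact Real.continuous_sqrt.comp (Real.continuous_sqrt.comp (continuous_const.add (continuous_id.div_const e)))

lemma sk_int (h : Sys Ω U V B) {Q1 : Set (Eu N)} (hQ : IsCompact Q1) {MV H0 : ℝ} (hMV : ∀ x ∈ Q1, ss Ω U V H0 x ≤ MV)
    {k : Eu N → ℝ} (hk : Continuous k) (hk0 : ∀ z ∉ Q1, k z = 0) : Integrable (fun z => ss Ω U V H0 z * k z) := by
  have hki : Integrable k := hk.integrable_of_hasCompactSupport (HasCompactSupport.intro hQ hk0)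
  refine (hki.norm.const_mul MV).mono' ((ss_meas h H0).mul hk.measurable).aestronglyMeasurable (Eventually.of_forall fun z => ?_)
  by_cases hz : z ∈ Q1
  · rw [norm_mul, Real.norm_eq_abs, abs_of_nonneg (ss_nonneg H0 z)]
    exact mul_le_mul_of_nonneg_right (hMV z hz) (norm_nonneg _)
  · rw [hk0 z hz]; simp

lemma tk_ev {r : ℝ} (hr : 0 < r) : ∀ᶠ n in atTop, tk n ≤ r := by
  filter_upwards [tk_tendsto.eventually (gt_mem_nhds hr)] with n hn using le_of_lt hn

/-- convergence of the error term -/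
lemma Er_tendsto (hG : GD Ω (WW Ω U) g b x0 B Cg CB D cg r0 cb) {Q1 Q2 : Set (Eu N)} (hQ : IsCompact Q1) (hQΩ : Q1 ⊆ Ω)
    {M τ : ℝ} (hτ : 0 < τ) (hM0 : 0 ≤ M) (hM : ∀ x ∈ Q2, Real.exp (WW Ω U x) ≤ M) (hQ12 : ∀ z ∈ Q1, Metric.ball z τ ⊆ Q2) :
    Tendsto (fun n => ∫ z, Q1.indicator (Er (WW Ω U) g (tk (n+5))) z) atTop (𝓝 0) := by
  have hv := v1_pos (N := N)
  have hc := c3_nonneg (N := N)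
  have hCg : 0 ≤ Cg := (hG.gnn x0).trans (hG.gle x0)
  set Cc := (M*Cg*v1 N + c3 N*(M*Cg)) + M*(Cg*v1 N + c3 N*Cg) with hCc
  rw [← integral_zero (Eu N) ℝ (μ := volume)]
  refine tendsto_integral_filter_of_dominated_convergence (Q1.indicator fun _ => Cc)
    (Eventually.of_forall fun n => (Er_int hG hQ hQΩ (tk_pos _)).aestronglyMeasurable) ?_
    ((integrable_indicator_iff hQ.measurableSet).2 (integrableOn_const hQ.measure_lt_top.ne)) ?_
  · filter_upwards [(tendsto_add_atTop_iff_nat 5).2 tk_tendsto |>.eventually (gt_mem_nhds hτ)] with n hn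
    refine Eventually.of_forall fun z => ?_
    by_cases hz : z ∈ Q1
    swap
    · rw [indicator_of_notMem hz, indicator_of_notMem hz]; simp
    rw [indicator_of_mem hz, indicator_of_mem hz, Real.norm_eq_abs, abs_of_nonneg (Er_nonneg _ _ _ _)]
    have hfle : ∀ y ∈ Metric.ball z τ, ff (WW Ω U) g y ≤ M*Cg := fun y hy =>
      mul_le_mul (hM y (hQ12 z hz hy)) (hG.gle y) (hG.gnn y) hM0
    have hzz : z ∈ Metric.ball z τ := Metric.mem_ball_self hτ
    have a1 := (ph_le hG.fi hG.ffnn (tk_pos (n+5)) z).trans (pq_le_of hG.fi (tk_pos (n+5)) z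
      (fun y hy => hfle y (Metric.ball_subset_ball hn.le hy)))
    have a2 := (ph_le hG.gi hG.gnn (tk_pos (n+5)) z).trans (pq_le_of hG.gi (tk_pos (n+5)) z (fun y _ => hG.gle y))
    have a1' := ph_nonneg hG.ffnn (tk_pos (n+5)) z
    have a2' := ph_nonneg hG.gnn (tk_pos (n+5)) z
    have a3 := mul_le_mul_of_nonneg_left (hfle z hzz) hc
    have a4 := mul_le_mul_of_nonneg_left (hG.gle z) hc
    have a3' := mul_nonneg hc (hG.ffnn z)
    have a4' := mul_nonneg hc (hG.gnn z)
    unfold Er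
    rw [hCc]
    refine add_le_add (abs_sub_le_iff.2 ⟨by linarith [mul_nonneg hc (mul_nonneg hM0 hCg)], by linarith [mul_nonneg (mul_nonneg hM0 hCg) hv.le]⟩) ?_
    refine mul_le_mul (hM z (hQ12 z hz hzz)) (abs_sub_le_iff.2 ⟨by linarith [mul_nonneg hc hCg], by linarith [mul_nonneg hCg hv.le]⟩)
      (abs_nonneg _) hM0
  · filter_upwards [ph_ae hG.fi, ph_ae hG.gi] with z h1 h2
    by_cases hz : z ∈ Q1
    swap
    · simp only [indicator_of_notMem hz]; exact tendsto_const_nhds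
    simp only [indicator_of_mem hz]
    unfold Er
    have b1 : Tendsto (fun n => |ph (ff (WW Ω U) g) (tk (n+5)) z - c3 N * ff (WW Ω U) g z|) atTop (𝓝 0) := by
      have := (h1.sub_const (c3 N * ff (WW Ω U) g z)).abs
      simpa using this
    have b2 : Tendsto (fun n => |ph g (tk (n+5)) z - c3 N * g z|) atTop (𝓝 0) := by
      have := (h2.sub_const (c3 N * g z)).abs
      simpa using this
    simpa using b1.add (b2.const_mul (Real.exp (WW Ω U z)))

lemma FF_tendsto (hG : GD Ω (WW Ω U) g b x0 B Cg CB D cg r0 cb) {e : ℝ} (he : 0 < e) :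
    Tendsto (fun n => ∫ y, FF (WW Ω U) g B y * (rr e (ph g (tk (n + 5)) y) ^ 2)⁻¹) atTop
      (𝓝 (∫ y, FF (WW Ω U) g B y * (rr e (c3 N * g y) ^ 2)⁻¹)) := by
  refine tendsto_integral_of_dominated_convergence (FF (WW Ω U) g B) (fun n => ?_) hG.FFi (fun n => ?_) ?_
  · exact hG.FFi.aestronglyMeasurable.mul ((rr_meas (ph_contDiff hG.gi (tk_pos _)).continuous _).pow_const 2).inv.aestronglyMeasurable
  · refine Eventually.of_forall fun y => ?_
    rw [Real.norm_eq_abs, abs_of_nonneg (mul_nonneg (hG.FFnn y) (by positivity))]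
    exact mul_le_of_le_one_right (hG.FFnn y) (rr_inv_le he (ph_nonneg hG.gnn (tk_pos _) y) 2)
  · filter_upwards [ph_ae hG.gi] with y hy
    refine Tendsto.const_mul _ ?_
    refine Tendsto.inv₀ ((((rr_cont e).tendsto _).comp hy).pow 2) ?_
    have := rr_ge he (mul_nonneg c3_nonneg (hG.gnn y) : 0 ≤ c3 N * g y)
    positivity

set_option maxHeartbeats 1000000 in
lemma ss_zero (h : Sys Ω U V B) (hN : 1 ≤ N) (hx0 : x0 ∈ Ω) : ∃ r > 0, ∀ᵐ x, x ∈ Metric.ball x0 r → ss Ω U V 3 x = 0 := by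
  obtain ⟨g, b, Cg, CB, D, cg, r0, cb, hG⟩ := GD_exists h hx0 hN
  have hv := v1_pos (N := N)
  have hD := hG.Dpos
  have hr0 := hG.r0pos
  have hcg := hG.cgpos
  have hcb := hG.cbpos
  have hCg : 0 ≤ Cg := (hG.gnn x0).trans (hG.gle x0)
  obtain ⟨k0, hk0⟩ := (tk_ev (show 0 < D/2 by positivity)).exists
  obtain ⟨CH, hCH0, hCH⟩ := hG.H k0
  have hK1 := K1_pos (N := N)
  set δ : ℝ := 1/(12*CH*K1 N + 1) with hδd
  have hden : 0 < 12*CH*K1 N + 1 := by positivity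
  have hδ : 0 < δ := by positivity
  have hδ1 : δ ≤ 1 := by rw [hδd, div_le_one hden]; linarith [show 0 ≤ 12*CH*K1 N by positivity]
  have hd : 12*CH*K1 N*δ ≤ 1 := by rw [hδd, mul_one_div, div_le_one hden]; linarith
  set c4 : ℝ := 27/64*(2^N)⁻¹*v1 N with hc4
  have hc4p : 0 < c4 := by positivity
  have hb' : ∀ x, dist x x0 < r0 → b x ≠ 0 := fun x hx => (hcb.trans_le (hG.bx0 x hx)).ne'
  set r1 := min r0 D/2 with hr1
  have hmin : 0 < min r0 D := lt_min hr0 hD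
  have hr1p : 0 < r1 := by positivity
  have hr1a : r1 ≤ r0/2 := by rw [hr1]; linarith [min_le_left r0 D]
  have hr1b : r1 ≤ D/2 := by rw [hr1]; linarith [min_le_right r0 D]
  set A := ∫ x in Metric.ball x0 r1, ss Ω U V 3 x with hA
  -- lower bound for averages of g near points of supp b
  have hglow : ∀ z y, b y ≠ 0 → dist z y ≤ D/2 → ∀ t, 0 < t → t ≤ D/2 → c4*cg ≤ ph g t z := by
    intro z y hby hzy t ht htD
    have a1 := ph_ge hG.gi hG.gnn ht z
    have a2 := pq_ge_of hG.gi (half_pos ht) z (M := cg) (fun y' hy' => hG.bg y y' hby (by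
      have := dist_triangle y' z y
      have := Metric.mem_ball.1 hy'
      linarith))
    refine le_trans ?_ a1
    have := mul_le_mul_of_nonneg_left a2 (show 0 ≤ 27/64*((2:ℝ)^N)⁻¹ by positivity)
    rw [hc4]; linarith
  have hΩball : Metric.ball x0 r0 ⊆ Ω := fun x hx => by
    by_contra hc; exact hb' x hx (hG.boff x hc)
  have claim : ∀ η : ℝ, 0 < η → η ≤ 1 → 12*CH*η*Real.exp B ≤ 1 → 2*η^4 ≤ c4*cg →
      c4*cb*A ≤ C0 N CH δ * (∫ y, FF (WW Ω U) g B y * (rr (η^4/c2 N) (c3 N * g y) ^ 2)⁻¹) + 24*CH*η^2*(volume Ω).toReal := by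
    intro η hη hη1 hηB hηg
    have hep : 0 < η^4 := by positivity
    obtain ⟨Q, hQΩ, hQc, hQ⟩ := hG.gcpt (η^4/(2*v1 N)) (by positivity)
    obtain ⟨τ, hτ, hτΩ⟩ := hQc.exists_cthickening_subset_open h.op hQΩ
    set Q1 := Metric.cthickening (τ/2) Q with hQ1
    set Q2 := Metric.cthickening τ Q with hQ2
    have hQ1c : IsCompact Q1 := hQc.cthickening
    have hQ2c : IsCompact Q2 := hQc.cthickening
    have hQ1Ω : Q1 ⊆ Ω := (Metric.cthickening_mono (by linarith) Q).trans hτΩ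
    have hQ12 : ∀ z ∈ Q1, Metric.ball z (τ/2) ⊆ Q2 := by
      intro z hz y hy
      have h1 : y ∈ Metric.cthickening (τ/2) (Metric.cthickening (τ/2) Q) :=
        Metric.mem_cthickening_of_dist_le y z _ _ hz (Metric.mem_ball.1 hy).le
      have h2 := Metric.cthickening_cthickening_subset (by positivity : 0 ≤ τ/2) (by positivity : 0 ≤ τ/2) Q h1
      rwa [add_halves] at h2
    obtain ⟨M, hM0, hM⟩ := hG.wloc Q2 hQ2c hτΩ
    obtain ⟨MV, hMV0, hMV⟩ : ∃ MV, 0 ≤ MV ∧ ∀ x ∈ Q1, ss Ω U V 3 x ≤ MV := by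
      obtain ⟨C, hC⟩ := hQ1c.exists_bound_of_continuousOn (h.Vcd.continuousOn.mono hQ1Ω)
      refine ⟨max (C + B) 0, le_max_right _ _, fun x hx => ?_⟩
      have h1 := ss_le h (by norm_num : (0:ℝ) ≤ 3) (hQ1Ω hx)
      have h2 := hC x hx
      rw [Real.norm_eq_abs] at h2
      exact (by linarith : ss Ω U V 3 x ≤ C + B).trans (le_max_left _ _)
    set q := 5*2^N*(M*Cg*v1 N) with hq
    have hq0 : 0 ≤ q := by positivity
    have hqt : ∀ᶠ n in atTop, tk n^2*q ≤ 2*η^4 := by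
      have : Tendsto (fun n => tk n^2*q) atTop (𝓝 (0^2*q)) := (tk_tendsto.pow 2).mul_const q
      rw [zero_pow two_ne_zero, zero_mul] at this
      filter_upwards [this.eventually (gt_mem_nhds (show 0 < 2*η^4 by positivity))] with n hn using le_of_lt hn
    have hlim := ((FF_tendsto hG (div_pos hep (c2_pos (N := N)))).const_mul (C0 N CH δ)).add
      ((Er_tendsto hG hQ1c hQ1Ω (half_pos hτ) hM0 hM hQ12).const_mul (MV+12))
    have hlim' := hlim.add_const (24*CH*η^2*(volume Ω).toReal)
    rw [mul_zero, add_zero] at hlim'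
    refine ge_of_tendsto hlim' ?_
    filter_upwards [hqt, tk_ev (half_pos hτ), tk_ev hr1p, eventually_ge_atTop k0] with n hn1 hn2 hn3 hn4
    have ht := tk_pos (n+5)
    have htn : tk (n+5) ≤ tk n := tk_anti (by omega)
    have hsup : ∀ z, η^4 ≤ ph g (tk (n+5)) z → z ∈ Q1 := by
      intro z hz
      by_contra hc
      have a1 := (ph_le hG.gi hG.gnn ht z).trans (pq_le_of hG.gi ht z (M := η^4/(2*v1 N)) (fun y hy => hQ y (fun hyQ => hc (
        Metric.mem_cthickening_of_dist_le z y _ _ hyQ (by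
          have := Metric.mem_ball.1 hy
          rw [dist_comm] at this
          linarith)))))
      have a2 : η^4/(2*v1 N)*v1 N = η^4/2 := by field_simp
      rw [a2] at a1
      linarith
    have hLz : ∀ z, ph g (tk (n+5)) z < 2*η^4 → ∀ y, dist y z < tk k0 → b y = 0 := by
      intro z hz y hy
      by_contra hc
      have := hglow z y hc (by rw [dist_comm]; linarith) (tk (n+5)) ht (by linarith)
      linarith
    have hφn : ∀ z, η^4 < ph g (tk (n+5)) z → ph g (tk (n+5)) z < 2*η^4 → ph g (tk n) z ≤ 4*η^4 := by
      intro z hz1 hz2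
      have hzQ := hsup z hz1.le
      have hz' := hLz z hz2
      have step : ∀ k, n ≤ k → ph g (tk k) z - ph g (tk (k+1)) z ≤ 2^N*tk n^2*(M*Cg*v1 N) := by
        intro k hk
        have d := (hG.D1 (tk_pos k) (hzmono hz' (hn4.trans hk))).2
        rw [← tk_succ] at d
        have hkn : tk k ≤ tk n := tk_anti hk
        have hp := pq_le_of hG.fi (tk_pos k) z (M := M*Cg) (fun y hy =>
          mul_le_mul (hM y (hQ12 z hzQ (Metric.ball_subset_ball (hkn.trans hn2) hy))) (hG.gle y) (hG.gnn y) hM0)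
        have hp0 := pq_nonneg hG.ffnn (tk_pos k) z
        have hkp := (tk_pos k).le
        refine d.trans ?_
        gcongr
      have s0 := step n le_rfl
      have s1 := step (n+1) (by omega)
      have s2 := step (n+2) (by omega)
      have s3 := step (n+3) (by omega)
      have s4 := step (n+4) (by omega)
      rw [hq] at hn1
      linarith
    have st := stage h hG hQ1c hQ1Ω hMV0 hMV hη hη1 hδ hδ1 hCH0 hn4 hsup hLz hφn
      (fun z => hCH n η z hn4 hη hη1) hd hηB
    refine le_trans ?_ st
    -- lower bound of the left-hand side
    have hk0' : ∀ z ∉ Q1, Th1 ((ph g (tk (n+5)) z - η^4)/η^4) * ph b (tk (n+5)) z = 0 := by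
      intro z hz
      have : ph g (tk (n+5)) z < η^4 := by by_contra hc; exact hz (hsup z (not_lt.1 hc))
      rw [(Th_neg (div_nonpos_of_nonpos_of_nonneg (by linarith) hep.le)).2.1, zero_mul]
    have hkc : Continuous (fun z => Th1 ((ph g (tk (n+5)) z - η^4)/η^4) * ph b (tk (n+5)) z) :=
      (Th1_continuous.comp (((ph_contDiff hG.gi ht).continuous.sub continuous_const).div_const _)).mul (ph_contDiff hG.bi ht).continuous
    have hi := sk_int h hQ1c hMV hkc hk0'
    have hnn : ∀ z, 0 ≤ ss Ω U V 3 z * (Th1 ((ph g (tk (n+5)) z - η^4)/η^4) * ph b (tk (n+5)) z) := fun z =>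
      mul_nonneg (ss_nonneg _ _) (mul_nonneg (Th1_nonneg _) (ph_nonneg hG.bnn ht z))
    rw [hA, ← integral_const_mul]
    refine le_trans ?_ (setIntegral_le_integral (s := Metric.ball x0 r1) hi (Eventually.of_forall hnn))
    refine integral_mono_of_nonneg (Eventually.of_forall fun z => mul_nonneg (by positivity) (ss_nonneg _ _)) hi.integrableOn ?_
    refine (ae_restrict_iff' measurableSet_ball).2 (Eventually.of_forall fun z hz => ?_)
    have hz' := Metric.mem_ball.1 hz
    have u1 := hglow z x0 (hb' x0 (by rw [dist_self]; exact hr0)) (by linarith) (tk (n+5)) ht (by linarith)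
    have u2 : Th1 ((ph g (tk (n+5)) z - η^4)/η^4) = 1 := (Th_big (by rw [le_div_iff₀ hep]; linarith)).2.1
    have u3 : c4*cb ≤ ph b (tk (n+5)) z := by
      have a1 := ph_ge hG.bi hG.bnn ht z
      have a2 := pq_ge_of hG.bi (half_pos ht) z (M := cb) (fun y' hy' => hG.bx0 y' (by
        have := dist_triangle y' z x0
        have := Metric.mem_ball.1 hy'
        linarith))
      refine le_trans ?_ a1
      have := mul_le_mul_of_nonneg_left a2 (show 0 ≤ 27/64*((2:ℝ)^N)⁻¹ by positivity)
      rw [hc4]; linarith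
    simp only [u2, one_mul]
    rw [mul_comm]
    exact mul_le_mul_of_nonneg_left u3 (ss_nonneg _ _)
  -- limit in η
  obtain ⟨η0, hη0, hη01, hη02, hη03⟩ : ∃ η0 : ℝ, 0 < η0 ∧ η0 ≤ 1 ∧ 12*CH*η0*Real.exp B ≤ 1 ∧ 2*η0 ≤ c4*cg := by
    refine ⟨min 1 (min (1/(12*CH*Real.exp B + 1)) (c4*cg/2)), by positivity, min_le_left _ _, ?_, ?_⟩
    · have h1 : min 1 (min (1/(12*CH*Real.exp B + 1)) (c4*cg/2)) ≤ 1/(12*CH*Real.exp B + 1) := (min_le_right _ _).trans (min_le_left _ _)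
      have h0 : 0 ≤ 12*CH*Real.exp B := by positivity
      calc _ = 12*CH*Real.exp B * min 1 (min (1/(12*CH*Real.exp B + 1)) (c4*cg/2)) := by ring
        _ ≤ 12*CH*Real.exp B * (1/(12*CH*Real.exp B + 1)) := by gcongr
        _ ≤ 1 := by rw [mul_one_div, div_le_one (by positivity)]; linarith
    · have h1 : min 1 (min (1/(12*CH*Real.exp B + 1)) (c4*cg/2)) ≤ c4*cg/2 := (min_le_right _ _).trans (min_le_right _ _)
      linarith
  set et : ℕ → ℝ := fun m => η0 * (1/((m:ℝ)+1)) with het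
  have hm1 : ∀ m : ℕ, 1/((m:ℝ)+1) ≤ 1 := fun m => by rw [div_le_one (by positivity)]; linarith [show (0:ℝ) ≤ m from Nat.cast_nonneg m]
  have hetp : ∀ m, 0 < et m := fun m => by simp only [het]; positivity
  have hetle : ∀ m, et m ≤ η0 := fun m => by simp only [het]; exact mul_le_of_le_one_right hη0.le (hm1 m)
  have hett : Tendsto et atTop (𝓝 0) := by
    have := (tendsto_one_div_add_atTop_nhds_zero_nat (𝕜 := ℝ)).const_mul η0
    rwa [mul_zero] at this
  have hcl : ∀ m, c4*cb*A ≤ C0 N CH δ * (∫ y, FF (WW Ω U) g B y * (rr ((et m)^4/c2 N) (c3 N * g y) ^ 2)⁻¹) +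
      24*CH*(et m)^2*(volume Ω).toReal := fun m => by
    have hp := hetp m
    have hl := hetle m
    refine claim (et m) hp (hl.trans hη01) ?_ ?_
    · refine le_trans ?_ hη02; gcongr
    · have : et m^4 ≤ et m := pow_le_of_le_one hp.le (hl.trans hη01) (by norm_num)
      linarith
  have hI : Tendsto (fun m => ∫ y, FF (WW Ω U) g B y * (rr ((et m)^4/c2 N) (c3 N * g y) ^ 2)⁻¹) atTop (𝓝 0) := by
    rw [← integral_zero (Eu N) ℝ (μ := volume)]
    have hpe : ∀ m, 0 < (et m)^4/c2 N := fun m => div_pos (pow_pos (hetp m) 4) c2_pos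
    refine tendsto_integral_of_dominated_convergence (FF (WW Ω U) g B) (fun m => ?_) hG.FFi (fun m => ?_) ?_
    · exact hG.FFi.aestronglyMeasurable.mul
        (((rr_cont _).measurable.comp (hG.gm.const_mul (c3 N))).pow_const 2).inv.aestronglyMeasurable
    · refine Eventually.of_forall fun y => ?_
      rw [Real.norm_eq_abs, abs_of_nonneg (mul_nonneg (hG.FFnn y) (by positivity))]
      exact mul_le_of_le_one_right (hG.FFnn y) (rr_inv_le (hpe m) (mul_nonneg c3_nonneg (hG.gnn y)) 2)
    · refine Eventually.of_forall fun y => ?_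
      rcases (hG.gnn y).eq_or_lt with hg0 | hg0
      · have : FF (WW Ω U) g B y = 0 := by unfold FF; rw [← hg0]; ring
        simp only [this, zero_mul]; exact tendsto_const_nhds
      · have key : Tendsto (fun m => (rr ((et m)^4/c2 N) (c3 N * g y) ^ 2)⁻¹) atTop (𝓝 0) := by
          simp only [rr_sq]
          refine tendsto_inv_atTop_zero.comp (Real.tendsto_sqrt_atTop.comp (tendsto_atTop_add_const_left _ _ ?_))
          have hx : 0 < c3 N * g y := mul_pos c3_pos hg0
          have e0 : Tendsto (fun m => (et m)^4/c2 N) atTop (𝓝[>] 0) := by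
            refine tendsto_nhdsWithin_iff.2 ⟨?_, Eventually.of_forall hpe⟩
            have := (hett.pow 4).div_const (c2 N)
            simpa using this
          have := (tendsto_inv_nhdsGT_zero.comp e0).const_mul_atTop hx
          exact this
        simpa using key.const_mul (FF (WW Ω U) g B y)
  have hfin : Tendsto (fun m => C0 N CH δ * (∫ y, FF (WW Ω U) g B y * (rr ((et m)^4/c2 N) (c3 N * g y) ^ 2)⁻¹) +
      24*CH*(et m)^2*(volume Ω).toReal) atTop (𝓝 0) := by
    have := (hI.const_mul (C0 N CH δ)).add (((hett.pow 2).const_mul (24*CH)).mul_const (volume Ω).toReal)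
    simpa using this
  have hA0 : c4*cb*A ≤ 0 := ge_of_tendsto' hfin hcl
  have hAle : A ≤ 0 := by
    by_contra hc
    have : 0 < c4*cb*A := by have := not_le.1 hc; positivity
    linarith
  have hcb1 : Metric.closedBall x0 r1 ⊆ Ω := (Metric.closedBall_subset_ball (by linarith)).trans hΩball
  have hitg : IntegrableOn (ss Ω U V 3) (Metric.ball x0 r1) := by
    obtain ⟨C, hC⟩ := (isCompact_closedBall x0 r1).exists_bound_of_continuousOn (h.Vcd.continuousOn.mono hcb1)
    refine Measure.integrableOn_of_bounded (M := C + B) measure_ball_lt_top.ne (ss_meas h 3).aestronglyMeasurable ?_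
    refine (ae_restrict_iff' measurableSet_ball).2 (Eventually.of_forall fun x hx => ?_)
    have hx' := Metric.ball_subset_closedBall hx
    have h1 := ss_le h (by norm_num : (0:ℝ) ≤ 3) (hcb1 hx')
    have h2 := hC x hx'
    rw [Real.norm_eq_abs] at h2 ⊢
    rw [abs_of_nonneg (ss_nonneg _ _)]
    linarith
  refine ⟨r1, hr1p, ?_⟩
  have hAeq : A = 0 := le_antisymm hAle (integral_nonneg fun x => ss_nonneg _ _)
  have := (setIntegral_eq_zero_iff_of_nonneg_ae (Eventually.of_forall fun x => ss_nonneg _ _) hitg).1 hAeq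
  exact (ae_restrict_iff' measurableSet_ball).1 this

end limits

section e1
variable {N : ℕ} {Ω : Set (Eu N)} {U : ℕ → Eu N → ℝ} {V : Eu N → ℝ} {B : ℝ}

lemma ph_deriv_gen {g : Eu N → ℝ} (hgi : Integrable g) {t : ℝ} (ht : 0 < t) (z : Eu N) :
    HasDerivAt (fun τ => ph g τ z)
      (∫ y, g y * laplacian (fun y => (t * (t^N)⁻¹ / 8) * pw 4 (qd 1 ((t^2)⁻¹) z y)) y) t := by
  have hd := deriv_int hgi (k := fun τ y => (τ^N)⁻¹ * pw 3 (qd 1 ((τ^2)⁻¹) z y))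
    (k' := fun τ y => -(N * (τ^(N+1))⁻¹) * pw 3 (qd 1 ((τ^2)⁻¹) z y) +
      (τ^N)⁻¹ * (3 * pw 2 (qd 1 ((τ^2)⁻¹) z y) * (2 * (τ^3)⁻¹ * ‖y - z‖^2)))
    (t := t) (C := (N + 6) * ((t/2)^(N+1))⁻¹) (C0 := (t^N)⁻¹) ht
    (fun τ => continuous_const.mul (pwq_cont _ _ _)) ?_ ?_ ?_ ?_
  · have e1 : (fun τ => ph g τ z) = fun τ => ∫ y, g y * ((τ^N)⁻¹ * pw 3 (qd 1 ((τ^2)⁻¹) z y)) := by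
      ext τ; unfold ph; rw [← integral_const_mul]; congr 1; ext y; ring
    rw [e1]
    refine hd.congr_deriv ?_
    have c1 : ContDiff ℝ 2 (fun y => pw 4 (qd 1 ((t^2)⁻¹) z y)) := (pw_contDiff 1).comp (qd_contDiff _ _ _)
    congr 1; ext y
    have h3 := lap_pw 1 1 ((t^2)⁻¹) z y
    rw [lap_cmul (u := fun y => pw 4 (qd 1 ((t^2)⁻¹) z y)) _ c1.contDiffAt]
    norm_num at h3
    rw [h3]
    field_simp
    ring
  · intro y
    rw [abs_of_nonneg (mul_nonneg (by positivity) (pw_nonneg _ _))]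
    exact mul_le_of_le_one_right (by positivity) (pw_le_one (qd_le_one _ _))
  · have := pwq_cont (N := N) 3 ((t^2)⁻¹) z
    have := pwq_cont (N := N) 2 ((t^2)⁻¹) z
    fun_prop
  · intro τ hτ y
    have hτ0 : 0 < τ := by linarith
    refine ((invpow_deriv N hτ0).mul ((pw_hasDerivAt 1 _).comp τ (qd_deriv hτ0 z y))).congr_deriv ?_
    norm_num
  · intro τ hτ y
    have hτ0 : 0 < τ := by linarith
    have h1 := pw_nonneg 3 (qd 1 ((τ^2)⁻¹) z y)
    have h2 : pw 3 (qd 1 ((τ^2)⁻¹) z y) ≤ 1 := pw_le_one (qd_le_one _ _)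
    have h3 := pw_nonneg 2 (qd 1 ((τ^2)⁻¹) z y)
    have h4 : pw 2 (qd 1 ((τ^2)⁻¹) z y) ≤ 1 := pw_le_one (qd_le_one _ _)
    have h5 := rho_pw hτ0 1 z y
    norm_num at h5
    set p3 := pw 3 (qd 1 ((τ^2)⁻¹) z y)
    set p2 := pw 2 (qd 1 ((τ^2)⁻¹) z y)
    have h6 : ‖y - z‖^2 * p2 ≤ τ^2 := by nlinarith [norm_nonneg (y - z)]
    have h7 := inv_anti (m := N + 1) (by linarith : 0 < t/2) hτ
    have h8 : 0 < (τ^(N+1))⁻¹ := by positivity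
    have h9 : (τ^N)⁻¹ * (3 * p2 * (2 * (τ^3)⁻¹ * ‖y - z‖^2)) ≤ 6 * (τ^(N+1))⁻¹ := by
      have : (τ^N)⁻¹ * (3 * p2 * (2 * (τ^3)⁻¹ * ‖y - z‖^2)) = 6 * (τ^(N+1))⁻¹ * ((τ^2)⁻¹ * (‖y - z‖^2 * p2)) := by
        field_simp
        ring
      rw [this]
      apply mul_le_of_le_one_right (by positivity)
      rw [inv_mul_eq_div, div_le_one (by positivity)]
      exact h6
    have h10 : 0 ≤ (τ^N)⁻¹ * (3 * p2 * (2 * (τ^3)⁻¹ * ‖y - z‖^2)) := by positivity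
    have h11 : 0 ≤ (N * (τ^(N+1))⁻¹) * p3 := by positivity
    have h12 : (N * (τ^(N+1))⁻¹) * p3 ≤ N * (τ^(N+1))⁻¹ := mul_le_of_le_one_right (by positivity) h2
    have h13 : (N + 6) * (τ^(N+1))⁻¹ ≤ (N + 6) * ((t/2)^(N+1))⁻¹ :=
      mul_le_mul_of_nonneg_left h7 (by positivity)
    have h14 : 0 ≤ N * (τ^(N+1))⁻¹ := by positivity
    rw [abs_le]
    constructor <;> nlinarith


lemma ph_ge_c {f : Eu N → ℝ} (hf : Integrable f) {t : ℝ} (ht : 0 < t) (z : Eu N) {a : ℝ}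
    (h : ∀ y ∈ Metric.ball z t, a ≤ f y) : a * c3 N ≤ ph f t z := by
  have hkc := pwq_cont 3 ((t^2)⁻¹) z
  have hks := pwq_hcs 2 ht z
  have hki : Integrable (fun y => pw 3 (qd 1 ((t^2)⁻¹) z y)) := hkc.integrable_of_hasCompactSupport hks
  rw [← c3_eq ht z]
  unfold ph
  rw [mul_left_comm, ← integral_const_mul]
  apply mul_le_mul_of_nonneg_left _ (by positivity)
  apply integral_mono (hki.const_mul a)
  · refine hf.mul_bdd (c := 1) hkc.aestronglyMeasurable (Eventually.of_forall fun y => ?_)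
    rw [Real.norm_eq_abs, abs_of_nonneg (pw_nonneg _ _)]
    exact pw_le_one (qd_le_one _ _)
  · intro y
    rcases lt_or_ge (dist y z) t with hy | hy
    · exact mul_le_mul_of_nonneg_right (h y hy) (pw_nonneg _ _)
    · have := pw_of_nonpos 2 (qd_nonpos ht hy)
      norm_num at this
      simp [this]

lemma mv_ineq {h : Eu N → ℝ} (hΩ : IsOpen Ω) (hh : ContDiffOn ℝ 2 h Ω) (hl : ∀ x ∈ Ω, 0 ≤ laplacian h x)
    {x0 : Eu N} {R t : ℝ} (ht : 0 < t) (htR : t ≤ R) (hR : Metric.closedBall x0 R ⊆ Ω) :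
    h x0 * c3 N ≤ ph (indicator (Metric.closedBall x0 R) h) t x0 := by
  have hR0 : 0 < R := ht.trans_le htR
  set g := indicator (Metric.closedBall x0 R) h with hg
  have hx0 : x0 ∈ Ω := hR (Metric.mem_closedBall_self hR0.le)
  have gi : Integrable g := by
    rw [hg, integrable_indicator_iff Metric.isClosed_closedBall.measurableSet]
    exact (hh.continuousOn.mono hR).integrableOn_compact (isCompact_closedBall _ _)
  have hmono : MonotoneOn (fun τ => ph g τ x0) (Ioc 0 R) := by
    apply monotoneOn_of_deriv_nonneg (convex_Ioc 0 R)
    · intro τ hτ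
      exact (ph_deriv_gen gi hτ.1 x0).continuousAt.continuousWithinAt
    · intro τ hτ
      rw [interior_Ioc] at hτ
      exact (ph_deriv_gen gi hτ.1 x0).differentiableAt.differentiableWithinAt
    · intro τ hτ
      rw [interior_Ioc] at hτ
      rw [(ph_deriv_gen gi hτ.1 x0).deriv]
      set Φ : Eu N → ℝ := fun y => (τ * (τ^N)⁻¹ / 8) * pw 4 (qd 1 ((τ^2)⁻¹) x0 y) with hΦ
      have hτ0 := hτ.1
      have c1 : ContDiff ℝ 2 (fun y => pw 4 (qd 1 ((τ^2)⁻¹) x0 y)) := (pw_contDiff 1).comp (qd_contDiff _ _ _)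
      have hΦc : ContDiff ℝ 2 Φ := contDiff_const.mul c1
      have hΦs : HasCompactSupport Φ := (pwq_hcs 3 hτ.1 x0).mul_left
      have hts : tsupport Φ ⊆ Metric.closedBall x0 τ := by
        apply closure_minimal _ Metric.isClosed_closedBall
        intro y hy
        by_contra hc
        rw [Metric.mem_closedBall, not_le] at hc
        apply hy
        have := pw_of_nonpos 3 (qd_nonpos hτ.1 hc.le)
        norm_num at this
        simp only [hΦ, this, mul_zero]
      have hts2 : tsupport Φ ⊆ Metric.closedBall x0 R := hts.trans (Metric.closedBall_subset_closedBall hτ.2.le)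
      have e1 : ∫ y, g y * laplacian Φ y = ∫ y, h y * laplacian Φ y := by
        congr 1; ext y
        by_cases hy : y ∈ Metric.closedBall x0 R
        · rw [hg, indicator_of_mem hy]
        · have : laplacian Φ y = 0 := by
            by_contra hne
            exact hy (hts2 (tsupport_lap (subset_tsupport _ hne)))
          rw [this, mul_zero, mul_zero]
      rw [e1, green hΩ hh hΦc hΦs (hts2.trans hR)]
      apply integral_nonneg
      intro y
      by_cases hy : y ∈ Ω
      · exact mul_nonneg (hl y hy) (mul_nonneg (by positivity) (pw_nonneg _ _))
      · have : Φ y = 0 := by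
          by_contra hne
          exact hy (hR (hts2 (subset_tsupport _ hne)))
        simp [this]
  have hc := c3_pos (N := N)
  refine le_of_forall_pos_sub_le fun ε hε => ?_
  have hcx : ContinuousAt h x0 := (hh.contDiffAt (hΩ.mem_nhds hx0)).continuousAt
  obtain ⟨δ, hδ, hb⟩ := Metric.continuousAt_iff.1 hcx (ε / c3 N) (by positivity)
  set s := min δ t with hs
  have hs0 : 0 < s := lt_min hδ ht
  have h1 := ph_ge_c gi hs0 x0 (a := h x0 - ε / c3 N) (by
    intro y hy
    have hy1 : dist y x0 < δ := lt_of_lt_of_le hy (min_le_left _ _)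
    have hy2 : y ∈ Metric.closedBall x0 R := by
      rw [Metric.mem_closedBall]
      exact (le_of_lt (lt_of_lt_of_le hy (min_le_right _ _))).trans htR
    rw [hg, indicator_of_mem hy2]
    have := hb hy1
    rw [Real.dist_eq, abs_lt] at this
    linarith)
  have h2 : ph g s x0 ≤ ph g t x0 := hmono ⟨hs0, (min_le_right _ _).trans htR⟩ ⟨ht, htR⟩ (min_le_right _ _)
  have h3 : (h x0 - ε / c3 N) * c3 N = h x0 * c3 N - ε := by field_simp
  linarith

lemma VW_le (h : Sys Ω U V B) (hN : 1 ≤ N) {x0 : Eu N} (hx0 : x0 ∈ Ω) : V x0 - WW Ω U x0 ≤ 3 := by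
  obtain ⟨r, hr, hae⟩ := ss_zero h hN hx0
  obtain ⟨r1, hr1, hb1⟩ := Metric.nhds_basis_closedBall.mem_iff.1 (h.op.mem_nhds hx0)
  set R := min (r / 2) r1 with hRdef
  have hR0 : 0 < R := lt_min (by linarith) hr1
  have hRΩ : Metric.closedBall x0 R ⊆ Ω := (Metric.closedBall_subset_closedBall (min_le_right _ _)).trans hb1
  have hRr : Metric.closedBall x0 R ⊆ Metric.ball x0 r :=
    Metric.closedBall_subset_ball (lt_of_le_of_lt (min_le_left _ _) (by linarith))
  have hc := c3_pos (N := N)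
  have h1 : ∀ n, (V x0 - U n x0) * c3 N ≤ ph (indicator (Metric.closedBall x0 R) (fun y => V y - U n y)) R x0 := by
    intro n
    refine mv_ineq (h := fun y => V y - U n y) h.op (h.Vcd.sub (h.Ucd n)) ?_ hR0 le_rfl hRΩ
    intro x hx
    rw [lap_sub (h.Vcd.contDiffAt (h.op.mem_nhds hx)) ((h.Ucd n).contDiffAt (h.op.mem_nhds hx)), h.Veq x hx, h.Ueq n x hx]
    have := Real.exp_le_exp.2 (h.UV n x hx)
    linarith
  have hkc := pwq_cont 3 ((R^2)⁻¹) x0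
  have hms := (Metric.isClosed_closedBall (x := x0) (ε := R)).measurableSet
  have hcV : ContinuousOn V (Metric.closedBall x0 R) := h.Vcd.continuousOn.mono hRΩ
  have hlim : Tendsto (fun n => ph (indicator (Metric.closedBall x0 R) (fun y => V y - U n y)) R x0) atTop
      (𝓝 (ph (indicator (Metric.closedBall x0 R) (fun y => V y - WW Ω U y)) R x0)) := by
    unfold ph
    apply Tendsto.const_mul
    apply tendsto_integral_of_dominated_convergence (indicator (Metric.closedBall x0 R) (fun y => V y + B))
    · intro n
      apply AEStronglyMeasurable.mul _ hkc.aestronglyMeasurable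
      rw [aestronglyMeasurable_indicator_iff hms]
      exact (hcV.sub ((h.Ucd n).continuousOn.mono hRΩ)).aestronglyMeasurable hms
    · rw [integrable_indicator_iff hms]
      exact (hcV.add continuousOn_const).integrableOn_compact (isCompact_closedBall _ _)
    · intro n
      refine Eventually.of_forall fun y => ?_
      rw [norm_mul, Real.norm_eq_abs, Real.norm_eq_abs, abs_of_nonneg (pw_nonneg _ _)]
      have hp : pw 3 (qd 1 ((R^2)⁻¹) x0 y) ≤ 1 := pw_le_one (qd_le_one _ _)
      by_cases hy : y ∈ Metric.closedBall x0 R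
      · rw [indicator_of_mem hy, indicator_of_mem hy]
        have a1 := h.UV n y (hRΩ hy)
        have a2 := h.Uge n y (hRΩ hy)
        rw [abs_of_nonneg (by linarith)]
        exact (mul_le_of_le_one_right (by linarith) hp).trans (by linarith)
      · rw [indicator_of_notMem hy, indicator_of_notMem hy]; simp
    · refine Eventually.of_forall fun y => ?_
      apply Tendsto.mul_const
      by_cases hy : y ∈ Metric.closedBall x0 R
      · simp only [indicator_of_mem hy]
        exact tendsto_const_nhds.sub (WW_tendsto' h (hRΩ hy))
      · simp only [indicator_of_notMem hy]
        exact tendsto_const_nhds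
  have hl2 : Tendsto (fun n => (V x0 - U n x0) * c3 N) atTop (𝓝 ((V x0 - WW Ω U x0) * c3 N)) :=
    (tendsto_const_nhds.sub (WW_tendsto' h hx0)).mul_const _
  have h2 := le_of_tendsto_of_tendsto' hl2 hlim h1
  have h3 : ph (indicator (Metric.closedBall x0 R) (fun y => V y - WW Ω U y)) R x0 ≤ 3 * c3 N := by
    rw [← c3_eq hR0 x0]
    unfold ph
    rw [mul_left_comm, ← integral_const_mul (3:ℝ)]
    apply mul_le_mul_of_nonneg_left _ (by positivity)
    have hki : Integrable (fun y => pw 3 (qd 1 ((R^2)⁻¹) x0 y)) :=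
      hkc.integrable_of_hasCompactSupport (pwq_hcs 2 hR0 x0)
    apply integral_mono_of_nonneg _ (hki.const_mul 3)
    · filter_upwards [hae] with y hy
      apply mul_le_mul_of_nonneg_right _ (pw_nonneg _ _)
      by_cases hyb : y ∈ Metric.closedBall x0 R
      · rw [indicator_of_mem hyb]
        have e := hy (hRr hyb)
        rw [ss_in (hRΩ hyb)] at e
        have := le_max_left (V y - WW Ω U y - 3) 0
        linarith
      · rw [indicator_of_notMem hyb]; norm_num
    · refine Eventually.of_forall fun y => ?_
      apply mul_nonneg _ (pw_nonneg _ _)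
      apply indicator_nonneg
      intro y hy
      have := WW_le h (hRΩ hy)
      linarith
  exact le_of_mul_le_mul_right (h2.trans h3) hc

lemma Klev (h : Sys Ω U V B) (m : ℝ) : IsCompact {x | x ∈ Ω ∧ V x ≤ m} := by
  obtain ⟨K, hK, hKc, hKb⟩ := h.Vbd (max m 0 + 1) (by positivity)
  have e : {x | x ∈ Ω ∧ V x ≤ m} = K ∩ V ⁻¹' (Iic m) := by
    ext x
    constructor
    · rintro ⟨hx, hm⟩
      refine ⟨?_, hm⟩
      by_contra hc
      have := hKb x ⟨hx, hc⟩
      have := le_max_left m 0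
      linarith
    · rintro ⟨hx, hm⟩
      exact ⟨hK hx, hm⟩
  rw [e]
  have := (h.Vcd.continuousOn.mono hK).preimage_isClosed_of_isClosed hKc.isClosed (isClosed_Iic (a := m))
  exact hKc.of_isClosed_subset this inter_subset_left

lemma dini (h : Sys Ω U V B) (hN : 1 ≤ N) (m : ℝ) : ∃ n, ∀ x ∈ Ω, V x ≤ m → V x - U n x ≤ 4 := by
  by_contra hcon
  push Not at hcon
  have hK := Klev h m
  set K := {x | x ∈ Ω ∧ V x ≤ m} with hKdef
  have hKΩ : K ⊆ Ω := fun x hx => hx.1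
  set S : ℕ → Set (Eu N) := fun n => K ∩ (fun x => V x - U n x) ⁻¹' (Ici 4) with hS
  have hScl : ∀ n, IsClosed (S n) := fun n =>
    ((h.Vcd.continuousOn.sub (h.Ucd n).continuousOn).mono hKΩ).preimage_isClosed_of_isClosed hK.isClosed isClosed_Ici
  obtain ⟨x, hx⟩ := IsCompact.nonempty_iInter_of_sequence_nonempty_isCompact_isClosed S
    (fun n x hx => ⟨hx.1, by
      have h1 : (4:ℝ) ≤ V x - U (n+1) x := hx.2
      have h2 := h.Umono n (n+1) (Nat.le_succ n) x hx.1.1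
      show (4:ℝ) ≤ V x - U n x
      linarith⟩)
    (fun n => by
      obtain ⟨x, hx, hm, h4⟩ := hcon n
      exact ⟨x, ⟨hx, hm⟩, h4.le⟩)
    (hK.of_isClosed_subset (hScl 0) inter_subset_left) hScl
  rw [mem_iInter] at hx
  have hxΩ : x ∈ Ω := (hx 0).1.1
  have h3 := VW_le h hN hxΩ
  have h4 : (4:ℝ) ≤ V x - WW Ω U x :=
    ge_of_tendsto' (tendsto_const_nhds.sub (WW_tendsto' h hxΩ)) (fun n => (hx n).2)
  linarith

lemma final_bd (h : Sys Ω U V B) (hN : 1 ≤ N) {η : ℝ} (hη : 0 < η) (m0 : ℝ) :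
    ∃ n, ∀ x ∈ Ω, V x ≤ m0 → V x - U n x ≤ η * (m0 + B + 1) := by
  have hB := h.Bpos
  set m := max (m0 + 1) (4 * (1 + η) / η) with hm
  have hm1 : m0 + 1 ≤ m := le_max_left _ _
  have hm2 : 4 * (1 + η) ≤ η * m := by
    have : 4 * (1 + η) / η ≤ m := le_max_right _ _
    rw [div_le_iff₀ hη] at this
    linarith
  obtain ⟨n, hn⟩ := dini h hN m
  have hlog : 0 < Real.log (1 + η) := Real.log_pos (by linarith)
  have hlog2 : Real.log (1 + η) ≤ η := by
    have := Real.log_le_sub_one_of_pos (show 0 < 1 + η by linarith)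
    linarith
  set A := {x | x ∈ Ω ∧ V x < m} with hA
  have hAo : IsOpen A := h.Vcd.continuousOn.isOpen_inter_preimage h.op isOpen_Iio
  have hAK : A ⊆ {x | x ∈ Ω ∧ V x ≤ m} := fun x hx => ⟨hx.1, hx.2.le⟩
  have hKm := Klev h m
  have hAcl : closure A ⊆ {x | x ∈ Ω ∧ V x ≤ m} := closure_minimal hAK hKm.isClosed
  have hAΩ : A ⊆ Ω := fun x hx => hx.1
  set f : Eu N → ℝ := fun x => V x - ((1 + η) * U n x + (η * B + Real.log (1 + η))) with hf
  have hfc : ContDiffOn ℝ 2 f Ω := h.Vcd.sub ((contDiffOn_const.mul (h.Ucd n)).add contDiffOn_const)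
  have key := comparison hAo (f := f) (hfc.mono hAΩ) (by
    intro x hx hpos
    have hxn := h.op.mem_nhds hx.1
    have cV := h.Vcd.contDiffAt hxn
    have cU := (h.Ucd n).contDiffAt hxn
    have cU2 : ContDiffAt ℝ 2 (fun x => (1 + η) * U n x) x := contDiffAt_const.mul cU
    have e : laplacian f x = Real.exp (V x) - (1 + η) * Real.exp (U n x) := by
      rw [hf, lap_sub cV (cU2.add contDiffAt_const), lap_add cU2 contDiffAt_const, lap_cmul _ cU, lap_const,
        h.Veq x hx.1, h.Ueq n x hx.1, add_zero]
    rw [e]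
    have h1 : U n x + Real.log (1 + η) < V x := by
      have := h.Uge n x hx.1
      simp only [hf] at hpos
      nlinarith
    have h2 := Real.exp_lt_exp.2 h1
    rw [Real.exp_add, Real.exp_log (by linarith)] at h2
    linarith) (bd_of_cont hAo (h.bdd.subset hAΩ) (hfc.continuousOn.mono (hAcl.trans fun x hx => hx.1)) (by
      intro x hx
      have hxc := hAcl (frontier_subset_closure hx)
      have hxA : x ∉ A := by
        rw [hAo.frontier_eq] at hx; exact hx.2
      have hVm : V x = m := le_antisymm hxc.2 (not_lt.1 fun hlt => hxA ⟨hxc.1, hlt⟩)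
      have := hn x hxc.1 hxc.2
      simp only [hf]
      nlinarith))
  refine ⟨n, fun x hx hxm => ?_⟩
  have h1 := key x ⟨hx, by linarith⟩
  simp only [hf] at h1
  have h2 := h.UV n x hx
  nlinarith

end e1

/-- Corollary 1.8: for `f(t) = e^t`, `u_λ + log(-λ)` converges locally uniformly in `Ω`
to the large solution `v` of `Δ v = e^v` in `Ω` as `λ → -∞`. -/
theorem stmt_13 {N : ℕ} (hN : 2 ≤ N) (Ω : Set (EuclideanSpace ℝ (Fin N)))
    (hΩo : IsOpen Ω) (hΩb : Bornology.IsBounded Ω) (hΩne : Ω.Nonempty)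
    (u : ℝ → EuclideanSpace ℝ (Fin N) → ℝ)
    (hu : ∀ lam < (0:ℝ), IsClassicalSolution Ω lam Real.exp (u lam))
    (v : EuclideanSpace ℝ (Fin N) → ℝ)
    (hvd : ContDiffOn ℝ 2 v Ω)
    (hveq : ∀ x ∈ Ω, laplacian v x = Real.exp (v x))
    (hvbd : ∀ M > (0:ℝ), ∃ K, K ⊆ Ω ∧ IsCompact K ∧ ∀ x ∈ Ω \ K, M ≤ v x) :
    ∀ K ⊆ Ω, IsCompact K →
      TendstoUniformlyOn (fun lam x => u lam x + Real.log (-lam)) v atBot K := by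
  intro K hK hKc
  obtain ⟨B, hS⟩ := sys_exists hΩo hΩb hu hvd hveq hvbd
  have hB := hS.Bpos
  obtain ⟨m0, hm0⟩ := (hKc.image_of_continuousOn (hvd.continuousOn.mono hK)).bddAbove
  set m := max m0 0 with hm
  have hm_nn : 0 ≤ m := le_max_right _ _
  rw [Metric.tendstoUniformlyOn_iff]
  intro ε hε
  obtain ⟨n, hn⟩ := final_bd hS (by omega) (η := ε / (2 * (m + B + 1))) (by positivity) m
  filter_upwards [eventually_le_atBot (-Real.exp n)] with lam hlam x hx
  have hxΩ := hK hx
  have hpos : 0 < -lam := by have := Real.exp_pos (n:ℝ); linarith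
  have e : u lam x + Real.log (-lam) = Uf u (Real.log (-lam)) x := by
    unfold Uf; rw [Real.exp_log hpos, neg_neg]
  have hln : (n:ℝ) ≤ Real.log (-lam) := by
    rw [Real.le_log_iff_exp_le hpos]; linarith
  have h1 := Uf_mono hΩo hΩb hu hln x hxΩ
  have h2 := Uf_le_V hΩo hΩb hu hvd hveq hvbd (Real.log (-lam)) x hxΩ
  have h3 := hn x hxΩ ((hm0 (mem_image_of_mem v hx)).trans (le_max_left _ _))
  have h4 : ε / (2 * (m + B + 1)) * (m + B + 1) = ε / 2 := by field_simp
  rw [e, Real.dist_eq, abs_of_nonneg (by linarith)]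
  linarith
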